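/- Let L be a CM-field with maximal totally real subfield L⁺. Then the class number h_{L⁺} of L⁺ divides the class number h_L of L. -/

import Mathlib

open NumberField

/-- A field is totally real if every complex embedding is real. -/
def IsTotallyRealField (K : Type*) [Field K] : Prop :=
  ∀ φ : K →+* ℂ, ComplexEmbedding.IsReal φ

/-- A field is totally imaginary if no complex embedding is real. -/
def IsTotallyImaginaryField (K : Type*) [Field K] : Prop :=
  ∀ φ : K →+* ℂ, ¬ ComplexEmbedding.IsReal φ

section
open MeasureTheory Filter Topology

namespace CN

lemma summable_prod_pi {ι : Type*} [Fintype ι] (f : ℤ → ℝ) (hf0 : ∀ n, 0 ≤ f n) (hf : Summable f) :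
    Summable (fun k : ι → ℤ => ∏ i, f (k i)) := by
  classical
  refine summable_of_sum_le (c := ∏ _i : ι, ∑' n, f n) (fun k => Finset.prod_nonneg fun i _ => hf0 _) ?_
  intro s
  let T : Finset ℤ := s.biUnion (fun k => Finset.univ.image k)
  have hs : s ⊆ Fintype.piFinset (fun _ : ι => T) := by
    intro k hk
    rw [Fintype.mem_piFinset]
    intro i
    exact Finset.mem_biUnion.2 ⟨k, hk, Finset.mem_image_of_mem _ (Finset.mem_univ _)⟩
  calc ∑ k ∈ s, ∏ i, f (k i) ≤ ∑ k ∈ Fintype.piFinset (fun _ : ι => T), ∏ i, f (k i) :=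
        Finset.sum_le_sum_of_subset_of_nonneg hs (fun k _ _ => Finset.prod_nonneg fun i _ => hf0 _)
    _ = ∏ _i : ι, ∑ n ∈ T, f n := (Finset.prod_univ_sum (fun _ : ι => T) (fun _ n => f n)).symm
    _ ≤ _ := Finset.prod_le_prod (fun _ _ => Finset.sum_nonneg fun n _ => hf0 n)
        (fun _ _ => hf.sum_le_tsum _ (fun n _ => hf0 n))

lemma summable_exp_int {δ : ℝ} (hδ : 0 < δ) : Summable (fun n : ℤ => Real.exp (-δ * (n:ℝ)^2)) := by
  have h1 : Summable (fun n : ℕ => Real.exp (-δ * ((n:ℤ):ℝ)^2)) := by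
    have : Summable (fun n : ℕ => (Real.exp (-δ))^n) :=
      summable_geometric_of_lt_one (Real.exp_pos _).le (by rw [Real.exp_lt_one_iff]; linarith)
    refine Summable.of_nonneg_of_le (fun _ => (Real.exp_pos _).le) (fun n => ?_) this
    rw [← Real.exp_nat_mul]
    apply Real.exp_le_exp.2
    have : (n:ℝ) ≤ (n:ℝ)^2 := by exact_mod_cast Nat.le_self_pow (by norm_num) n
    push_cast
    nlinarith
  refine Summable.of_nat_of_neg h1 ?_
  simpa using h1

lemma summable_gauss {ι : Type*} [Fintype ι] {δ : ℝ} (hδ : 0 < δ) :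
    Summable (fun k : ι → ℤ => Real.exp (-δ * ∑ i, ((k i : ℝ))^2)) := by
  have := summable_prod_pi (ι := ι) _ (fun n => (Real.exp_pos _).le) (summable_exp_int hδ)
  refine this.congr fun k => ?_
  rw [← Real.exp_sum, Finset.mul_sum]

lemma one_le_sum_sq {ι : Type*} [Fintype ι] {k : ι → ℤ} (hk : k ≠ 0) : (1:ℝ) ≤ ∑ i, ((k i : ℝ))^2 := by
  obtain ⟨i, hi⟩ := Function.ne_iff.1 hk
  have h1 : (1:ℝ) ≤ (k i : ℝ)^2 := by
    have : 1 ≤ (k i)^2 := by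
      have := sq_pos_of_ne_zero (a := k i) hi
      omega
    exact_mod_cast this
  exact h1.trans (Finset.single_le_sum (f := fun i => ((k i : ℝ))^2) (fun _ _ => sq_nonneg _) (Finset.mem_univ i))

/-- gaussian tails -/
lemma tsum_gauss_tail {ι : Type*} [Fintype ι] [DecidableEq ι] {δ : ℝ} (hδ : 0 < δ) :
    Tendsto (fun T : ℝ => ∑' k : ι → ℤ, if k = 0 then 0 else Real.exp (-(T * δ) * ∑ i, ((k i : ℝ))^2))
      atTop (𝓝 0) := by
  set S := ∑' k : ι → ℤ, Real.exp (-δ * ∑ i, ((k i : ℝ))^2)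
  have hb : ∀ T : ℝ, 1 ≤ T → ∀ k : ι → ℤ, (if k = 0 then 0 else Real.exp (-(T * δ) * ∑ i, ((k i : ℝ))^2))
      ≤ Real.exp (-(T-1) * δ) * Real.exp (-δ * ∑ i, ((k i : ℝ))^2) := by
    intro T hT k
    split_ifs with h
    · positivity
    · rw [← Real.exp_add]
      apply Real.exp_le_exp.2
      have := one_le_sum_sq h
      nlinarith [mul_nonneg (mul_nonneg (sub_nonneg.2 hT) hδ.le) (sub_nonneg.2 this)]
  have hs := summable_gauss (ι := ι) hδ
  refine squeeze_zero' (g := fun T => Real.exp (-(T-1) * δ) * S) ?_ ?_ ?_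
  · exact Eventually.of_forall fun T => tsum_nonneg fun k => by split_ifs <;> positivity
  · filter_upwards [eventually_ge_atTop 1] with T hT
    rw [← tsum_mul_left]
    refine Summable.tsum_le_tsum (hb T hT) ?_ (hs.mul_left _)
    exact Summable.of_nonneg_of_le (fun k => by split_ifs <;> positivity) (hb T hT) (hs.mul_left _)
  · have : Tendsto (fun T : ℝ => Real.exp (-(T-1) * δ)) atTop (𝓝 0) := by
      apply Real.tendsto_exp_atBot.comp
      have : Tendsto (fun T : ℝ => (T - 1) * δ) atTop atTop :=
        (tendsto_atTop_add_const_right _ (-1) tendsto_id).atTop_mul_const hδ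
      refine (tendsto_neg_atTop_atBot.comp this).congr fun T => ?_
      simp only [Function.comp_apply]; ring
    simpa using this.mul_const S

end CN
end

section
open MeasureTheory Filter Topology
namespace CN
open UnitAddTorus in
/-- multidimensional Poisson summation -/
theorem poisson {ι : Type*} [Fintype ι] (G : (ι → ℝ) → ℂ) (hG : Continuous G) (hGi : Integrable G)
    (hB : ∀ R : ℝ, ∃ B : (ι → ℤ) → ℝ, Summable B ∧ ∀ x : ι → ℝ, (∀ i, |x i| ≤ R) → ∀ k : ι → ℤ,
      ‖G (fun i => x i + k i)‖ ≤ B k)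
    (hS : Summable (fun m : ι → ℤ => ∫ u : ι → ℝ, Complex.exp (-2 * Real.pi * Complex.I * ∑ i, (m i : ℂ) * (u i : ℂ)) * G u))
    (x : ι → ℝ) :
    ∑' k : ι → ℤ, G (fun i => x i + k i) =
     ∑' m : ι → ℤ, (∫ u : ι → ℝ, Complex.exp (-2 * Real.pi * Complex.I * ∑ i, (m i : ℂ) * (u i : ℂ)) * G u) *
      Complex.exp (2 * Real.pi * Complex.I * ∑ i, (m i : ℂ) * (x i : ℂ)) := by
  classical
  set F : (ι → ℝ) → ℂ := fun x => ∑' k : ι → ℤ, G (fun i => x i + k i) with hF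
  have hFc : Continuous F := by
    rw [continuous_iff_continuousAt]
    intro y
    obtain ⟨B, hBs, hBb⟩ := hB (‖y‖ + 1)
    have hco : ContinuousOn F (Metric.ball y 1) := by
      refine continuousOn_tsum (u := B) (fun k => ?_) hBs ?_
      · exact (hG.comp (by fun_prop)).continuousOn
      · intro k z hz
        apply hBb
        intro i
        have h1 : ‖z‖ ≤ ‖y‖ + 1 := by
          have : ‖z - y‖ < 1 := by simpa [dist_eq_norm] using hz
          linarith [norm_le_norm_add_norm_sub' z y]
        exact (by simpa using norm_le_pi_norm z i : |z i| ≤ ‖z‖).trans h1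
    exact hco.continuousAt (Metric.ball_mem_nhds y one_pos)
  have hFp : ∀ (x : ι → ℝ) (k : ι → ℤ), F (fun i => x i + k i) = F x := by
    intro x k
    simp only [hF]
    rw [← (Equiv.addLeft k).tsum_eq (fun k' : ι → ℤ => G (fun i => x i + k' i))]
    refine tsum_congr fun k' => ?_
    congr 1; ext i; simp [add_assoc]
  let π : (ι → ℝ) → UnitAddTorus ι := fun x i => (x i : UnitAddCircle)
  have hπ : IsOpenQuotientMap π := by
    apply IsOpenQuotientMap.piMap (f := fun (_ : ι) (x : ℝ) => (x : UnitAddCircle))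
    intro i
    exact QuotientAddGroup.isOpenQuotientMap_mk
  let f : UnitAddTorus ι → ℂ := fun t => F (fun i => (AddCircle.equivIoc (1:ℝ) 0 (t i)).1)
  have hfF : ∀ x, f (π x) = F x := by
    intro x
    have : ∀ i, ∃ k : ℤ, (AddCircle.equivIoc (1:ℝ) 0 (x i : UnitAddCircle)).1 = x i + k := by
      intro i
      have h1 : (((AddCircle.equivIoc (1:ℝ) 0 (x i : UnitAddCircle)).1 : ℝ) : UnitAddCircle) = (x i : UnitAddCircle) :=
        (AddCircle.equivIoc (1:ℝ) 0).symm_apply_apply _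
      rw [← sub_eq_zero, ← AddCircle.coe_sub, AddCircle.coe_eq_zero_iff] at h1
      obtain ⟨n, hn⟩ := h1
      exact ⟨n, by simp at hn; linarith⟩
    choose k hk using this
    simp only [f, π, hk]
    exact hFp x k
  have hfc : Continuous f := by
    rw [hπ.isQuotientMap.continuous_iff]
    convert hFc using 1
    ext x; exact hfF x
  let fc : C(UnitAddTorus ι, ℂ) := ⟨f, hfc⟩
  have hfour : ∀ (m : ι → ℤ) (x : ι → ℝ), mFourier m (π x) = Complex.exp (2 * Real.pi * Complex.I * ∑ i, (m i : ℂ) * (x i : ℂ)) := by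
    intro m x
    simp only [mFourier, ContinuousMap.coe_mk, π, fourier_coe_apply]
    rw [← Complex.exp_sum, Finset.mul_sum]
    congr 1
    refine Finset.sum_congr rfl fun i _ => ?_
    push_cast; ring
  have hcoef : ∀ m, mFourierCoeff fc m = ∫ u : ι → ℝ, Complex.exp (-2 * Real.pi * Complex.I * ∑ i, (m i : ℂ) * (u i : ℂ)) * G u := by
    intro m
    rw [mFourierCoeff_eq_integral _ _ (0 : ι → ℝ)]
    set C : (ι → ℤ) → Set (ι → ℝ) := fun k => {x | ∀ i, x i ∈ Set.Ioc (k i : ℝ) (k i + 1)} with hC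
    have hC0 : {x : ι → ℝ | ∀ i, x i ∈ Set.Ioc ((0 : ι → ℝ) i) ((0 : ι → ℝ) i + 1)} = C 0 := by
      simp [hC]
    rw [hC0]
    set H : (ι → ℝ) → ℂ := fun u => Complex.exp (-2 * Real.pi * Complex.I * ∑ i, (m i : ℂ) * (u i : ℂ)) * G u with hH
    have hexp1 : ∀ u : ι → ℝ, ‖Complex.exp (-2 * Real.pi * Complex.I * ∑ i, (m i : ℂ) * (u i : ℂ))‖ = 1 := by
      intro u
      have : (-2 * Real.pi * Complex.I * ∑ i, (m i : ℂ) * (u i : ℂ)) = ((-2 * Real.pi * ∑ i, (m i : ℝ) * u i : ℝ) : ℂ) * Complex.I := by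
        push_cast; ring
      rw [this, Complex.norm_exp_ofReal_mul_I]
    have hHc : Continuous H := by fun_prop
    have hHn : ∀ u, ‖H u‖ = ‖G u‖ := fun u => by rw [hH]; simp only [norm_mul, hexp1, one_mul]
    have hHi : Integrable H := (integrable_norm_iff hHc.aestronglyMeasurable).1 (by simpa only [hHn] using hGi.norm)
    have hCm : ∀ k, MeasurableSet (C k) := fun k => MeasurableSet.univ_pi' (fun i => measurableSet_Ioc)
    have hCd : Pairwise (Function.onFun Disjoint C) := by
      intro k l hkl
      rw [Function.onFun, Set.disjoint_left]
      intro x hx hy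
      apply hkl
      ext i
      have h1 := hx i
      have h2 := hy i
      have a1 : (k i : ℝ) < l i + 1 := h1.1.trans_le h2.2
      have a2 : (l i : ℝ) < k i + 1 := h2.1.trans_le h1.2
      have a1' : k i < l i + 1 := by exact_mod_cast a1
      have a2' : l i < k i + 1 := by exact_mod_cast a2
      omega
    have hCu : (⋃ k, C k) = Set.univ := by
      rw [Set.eq_univ_iff_forall]
      intro x
      refine Set.mem_iUnion.2 ⟨fun i => ⌈x i⌉ - 1, fun i => ⟨?_, ?_⟩⟩
      · push_cast; linarith [Int.ceil_lt_add_one (x i)]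
      · push_cast; linarith [Int.le_ceil (x i)]
    have h1 : ∫ u, H u = ∑' k, ∫ u in C k, H u := by
      rw [← integral_iUnion hCm hCd (by rw [hCu]; exact hHi.integrableOn), hCu, setIntegral_univ]
    rw [h1]
    have h2 : ∀ k : ι → ℤ, ∫ u in C k, H u = ∫ u in C 0, H (fun i => u i + k i) := by
      intro k
      have hmp : MeasurePreserving (fun u : ι → ℝ => u + (fun i => (k i : ℝ))) volume volume := measurePreserving_add_right _ _
      have := hmp.setIntegral_preimage_emb (measurableEmbedding_addRight _) H (C k)
      rw [← this]
      have hs : (fun u : ι → ℝ => u + (fun i => (k i : ℝ))) ⁻¹' C k = C 0 := by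
        ext u
        simp only [hC, Set.mem_preimage, Set.mem_ofPred_eq, Pi.add_apply, Set.mem_Ioc, Pi.zero_apply, Int.cast_zero]
        refine forall_congr' fun i => ?_
        constructor <;> rintro ⟨p, q⟩ <;> constructor <;> linarith
      rw [hs]; rfl
    simp_rw [h2]
    have h3 : ∀ (k : ι → ℤ) (u : ι → ℝ), H (fun i => u i + k i) = mFourier (-m) (π u) * G (fun i => u i + k i) := by
      intro k u
      simp only [hH]
      congr 1
      rw [hfour]
      have : (-2 * Real.pi * Complex.I * ∑ i, (m i : ℂ) * ((u i + k i : ℝ) : ℂ)) =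
          2 * Real.pi * Complex.I * ∑ i, ((-m) i : ℂ) * (u i : ℂ) + ((-∑ i, m i * k i : ℤ) : ℂ) * (2 * Real.pi * Complex.I) := by
        push_cast
        simp only [Pi.neg_apply, Int.cast_neg, mul_add, Finset.sum_add_distrib, neg_mul, Finset.sum_neg_distrib]
        ring
      rw [this, Complex.exp_add, Complex.exp_int_mul_two_pi_mul_I, mul_one]
    obtain ⟨B, hBs, hBb⟩ := hB 1
    have hvol : volume (C 0) < ⊤ := by
      have : C 0 ⊆ Set.Icc 0 1 := by
        intro x hx
        exact ⟨fun i => by simpa using (hx i).1.le, fun i => by simpa using (hx i).2⟩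
      exact (measure_mono this).trans_lt isCompact_Icc.measure_lt_top
    have hbd : ∀ k : ι → ℤ, ∀ u ∈ C 0, ‖H (fun i => u i + k i)‖ ≤ B k := by
      intro k u hu
      rw [hHn]
      apply hBb
      intro i
      have := hu i
      simp at this
      rw [abs_of_pos this.1]; exact this.2
    have hIntg : ∀ k : ι → ℤ, Integrable (fun u : ι → ℝ => H (fun i => u i + k i)) (volume.restrict (C 0)) := by
      intro k
      refine Measure.integrableOn_of_bounded (M := B k) hvol.ne ?_ ?_
      · exact (hHc.comp (by fun_prop)).aestronglyMeasurable
      · exact (ae_restrict_iff' (hCm 0)).2 (Eventually.of_forall fun u hu => hbd k u hu)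
    have h4 := hasSum_integral_of_summable_integral_norm (μ := volume.restrict (C 0)) hIntg ?_
    · rw [h4.tsum_eq]
      refine integral_congr_ae (Eventually.of_forall fun u => ?_)
      simp only [h3]
      rw [tsum_mul_left]
      show _ • f (π u) = _
      rw [hfF]
      rfl
    · refine Summable.of_nonneg_of_le (fun k => integral_nonneg fun _ => norm_nonneg _) (fun k => ?_) (hBs.mul_right (volume.real (C 0)))
      have := norm_setIntegral_le_of_norm_le_const (μ := volume) (s := C 0) (f := fun u : ι → ℝ => ‖H (fun i => u i + k i)‖) (C := B k) hvol
        (fun u hu => by rw [norm_norm]; exact hbd k u hu)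
      exact (le_abs_self _).trans this
  have hsum : Summable (mFourierCoeff fc) := by
    refine hS.congr fun m => (hcoef m).symm
  have key := hasSum_mFourier_series_apply_of_summable hsum (π x)
  have h5 : fc (π x) = F x := hfF x
  rw [h5] at key
  change F x = _
  rw [← key.tsum_eq]
  refine tsum_congr fun m => ?_
  rw [hcoef, hfour, smul_eq_mul]
end CN
end

section
open MeasureTheory Filter Topology
namespace CN

lemma coercive {ι : Type*} [Fintype ι] [DecidableEq ι] (M : Matrix ι ι ℝ) (hM : M.det ≠ 0) :
    ∃ δ : ℝ, 0 < δ ∧ ∀ u : ι → ℝ, δ * ∑ i, (u i)^2 ≤ ∑ v, (M.mulVec u v)^2 := by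
  set F := ∑ i, ∑ j, (M⁻¹ i j)^2 with hF
  have hF0 : 0 ≤ F := Finset.sum_nonneg fun i _ => Finset.sum_nonneg fun j _ => sq_nonneg _
  refine ⟨1/(1+F), by positivity, fun u => ?_⟩
  have h1 : ∀ i, (u i)^2 ≤ (∑ j, (M⁻¹ i j)^2) * ∑ v, (M.mulVec u v)^2 := by
    intro i
    have : u i = ∑ j, M⁻¹ i j * M.mulVec u j := by
      have h2 : M⁻¹.mulVec (M.mulVec u) = u := by
        rw [Matrix.mulVec_mulVec, Matrix.nonsing_inv_mul _ (isUnit_iff_ne_zero.2 hM), Matrix.one_mulVec]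
      exact (congrFun h2 i).symm
    conv_lhs => rw [this]
    exact Finset.sum_mul_sq_le_sq_mul_sq _ _ _
  have h2 : ∑ i, (u i)^2 ≤ F * ∑ v, (M.mulVec u v)^2 := by
    rw [hF, Finset.sum_mul]
    exact Finset.sum_le_sum fun i _ => h1 i
  have h3 : 0 ≤ ∑ v, (M.mulVec u v)^2 := Finset.sum_nonneg fun _ _ => sq_nonneg _
  rw [one_div, inv_mul_le_iff₀ (by positivity)]
  linarith

/-- the complex gaussian attached to a matrix -/
noncomputable def gs {ι : Type*} [Fintype ι] (M : Matrix ι ι ℝ) (b : ι → ℂ) (u : ι → ℝ) : ℂ :=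
  Complex.exp (-Real.pi * ∑ v, b v * ((M.mulVec u v : ℝ) : ℂ)^2)

lemma norm_gs {ι : Type*} [Fintype ι] (M : Matrix ι ι ℝ) (b : ι → ℂ) (u : ι → ℝ) :
    ‖gs M b u‖ = Real.exp (-Real.pi * ∑ v, (b v).re * (M.mulVec u v)^2) := by
  rw [gs, Complex.norm_exp]
  congr 1
  have : (-Real.pi * ∑ v, b v * ((M.mulVec u v : ℝ) : ℂ)^2) = ((-Real.pi : ℝ) : ℂ) * ∑ v, b v * ((M.mulVec u v ^ 2: ℝ) : ℂ) := by
    push_cast; rfl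
  rw [this, Complex.re_ofReal_mul, Complex.re_sum]
  simp only [Complex.re_mul_ofReal]

lemma norm_gs_le {ι : Type*} [Fintype ι] (M : Matrix ι ι ℝ) {δ : ℝ}
    (hδ : ∀ u : ι → ℝ, δ * ∑ i, (u i)^2 ≤ ∑ v, (M.mulVec u v)^2)
    (b : ι → ℂ) {β : ℝ} (hβ : 0 ≤ β) (hb : ∀ v, β ≤ (b v).re) (u : ι → ℝ) :
    ‖gs M b u‖ ≤ Real.exp (-(β * (Real.pi * δ)) * ∑ i, (u i)^2) := by
  rw [norm_gs]
  apply Real.exp_le_exp.2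
  have h1 : β * (δ * ∑ i, (u i)^2) ≤ ∑ v, (b v).re * (M.mulVec u v)^2 := by
    refine (mul_le_mul_of_nonneg_left (hδ u) hβ).trans ?_
    rw [Finset.mul_sum]
    exact Finset.sum_le_sum fun v _ => mul_le_mul_of_nonneg_right (hb v) (sq_nonneg _)
  nlinarith [Real.pi_pos]

lemma exists_lower {ι : Type*} [Fintype ι] (b : ι → ℂ) (hb : ∀ v, 0 < (b v).re) :
    ∃ β : ℝ, 0 < β ∧ ∀ v, β ≤ (b v).re := by
  cases isEmpty_or_nonempty ι
  · exact ⟨1, one_pos, fun v => isEmptyElim v⟩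
  · obtain ⟨v0, h0⟩ := Finite.exists_min (fun v => (b v).re)
    exact ⟨_, hb v0, h0⟩

lemma summable_gs {ι : Type*} [Fintype ι] [DecidableEq ι] (M : Matrix ι ι ℝ) (hM : M.det ≠ 0)
    (b : ι → ℂ) (hb : ∀ v, 0 < (b v).re) : Summable (fun k : ι → ℤ => ‖gs M b (fun i => k i)‖) := by
  obtain ⟨δ, hδ, hd⟩ := coercive M hM
  obtain ⟨β, hβ, hbb⟩ := exists_lower b hb
  exact Summable.of_nonneg_of_le (fun _ => norm_nonneg _) (fun k => norm_gs_le M hd b hβ.le hbb _)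
    (summable_gauss (by have := Real.pi_pos; positivity))

lemma det_inv_transpose {ι : Type*} [Fintype ι] [DecidableEq ι] (M : Matrix ι ι ℝ) (hM : M.det ≠ 0) :
    (M⁻¹.transpose).det ≠ 0 := by
  rw [Matrix.det_transpose, Matrix.det_nonsing_inv]
  simp [hM]

lemma re_inv_pos {z : ℂ} (hz : 0 < z.re) : 0 < (1/z).re := by
  rw [one_div, Complex.inv_re]
  exact div_pos hz (Complex.normSq_pos.2 (fun h => by simp [h] at hz))

theorem gauss_poisson {ι : Type*} [Fintype ι] [DecidableEq ι] (M : Matrix ι ι ℝ) (hM : M.det ≠ 0)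
    (b : ι → ℂ) (hb : ∀ v, 0 < (b v).re) (x : ι → ℝ) :
    ∑' k : ι → ℤ, gs M b (fun i => x i + k i) =
      ((|M.det|⁻¹ : ℝ) : ℂ) * (∏ v, (1 / b v)^(1/2 : ℂ)) *
      ∑' m : ι → ℤ, gs (M⁻¹.transpose) (fun v => 1 / b v) (fun i => m i) * Complex.exp (2 * Real.pi * Complex.I * ∑ i, (m i : ℂ) * (x i : ℂ)) := by
  obtain ⟨δ, hδ, hd⟩ := coercive M hM
  obtain ⟨β, hβ, hbb⟩ := exists_lower b hb
  have hpi := Real.pi_pos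
  have hle := norm_gs_le M hd b hβ.le hbb
  have hcont : Continuous (gs M b) := by
    unfold gs Matrix.mulVec dotProduct
    fun_prop
  have hIntg : Integrable (gs M b) := by
    have h0 := (GaussianFourier.integrable_cexp_neg_sum_mul_add (ι := ι) (b := fun _ => ((β * (Real.pi * δ) : ℝ) : ℂ)) (fun _ => by rw [Complex.ofReal_re]; positivity) (fun _ => 0)).norm
    refine h0.mono hcont.aestronglyMeasurable (Eventually.of_forall fun u => ?_)
    refine (hle u).trans (le_of_eq ?_)
    rw [norm_norm, Complex.norm_exp]
    congr 1
    have : (-∑ i, ((β * (Real.pi * δ) : ℝ) : ℂ) * ((u i : ℝ) : ℂ)^2 + ∑ i : ι, (0:ℂ) * (u i : ℂ)) = ((-(β * (Real.pi * δ)) * ∑ i, (u i)^2 : ℝ) : ℂ) := by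
      push_cast
      simp [Finset.mul_sum]
    rw [this, Complex.ofReal_re]
  have hcoef : ∀ m : ι → ℤ, ∫ u : ι → ℝ, Complex.exp (-2 * Real.pi * Complex.I * ∑ i, (m i : ℂ) * (u i : ℂ)) * gs M b u =
      ((|M.det|⁻¹ : ℝ) : ℂ) * (∏ v, (1 / b v)^(1/2 : ℂ)) * gs (M⁻¹.transpose) (fun v => 1 / b v) (fun i => m i) := by
    intro m
    set w : ι → ℝ := (M⁻¹.transpose).mulVec (fun i => (m i : ℝ)) with hw
    set H : (ι → ℝ) → ℂ := fun y => Complex.exp (-∑ i, (Real.pi * b i) * (y i : ℂ)^2 + ∑ i, (-2 * Real.pi * Complex.I * w i) * (y i : ℂ)) with hH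
    have h1 : ∀ u : ι → ℝ, Complex.exp (-2 * Real.pi * Complex.I * ∑ i, (m i : ℂ) * (u i : ℂ)) * gs M b u = H (M.mulVec u) := by
      intro u
      simp only [gs, hH]
      rw [← Complex.exp_add]
      congr 1
      have h2 : ∑ i, (m i : ℝ) * u i = ∑ i, w i * M.mulVec u i := by
        have : (fun i => (m i : ℝ)) ⬝ᵥ u = w ⬝ᵥ M.mulVec u := by
          rw [hw, Matrix.mulVec_transpose, ← Matrix.dotProduct_mulVec, Matrix.mulVec_mulVec, Matrix.nonsing_inv_mul _ (isUnit_iff_ne_zero.2 hM), Matrix.one_mulVec]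
        exact this
      have h3 : ∑ i, (m i : ℂ) * (u i : ℂ) = ∑ i, (w i : ℂ) * ((M.mulVec u i : ℝ) : ℂ) := by exact_mod_cast h2
      rw [h3, Finset.mul_sum, Finset.mul_sum, add_comm]
      congr 1
      · rw [← Finset.sum_neg_distrib]
        refine Finset.sum_congr rfl fun i _ => ?_
        ring
      · refine Finset.sum_congr rfl fun i _ => ?_
        ring
    simp_rw [h1]
    have h4 : ∫ u : ι → ℝ, H (M.mulVec u) = |M.det|⁻¹ • ∫ y, H y := by
      have hmap := Real.map_matrix_volume_pi_eq_smul_volume_pi hM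
      have hemb : MeasurableEmbedding (Matrix.toLin' M) := by
        have : Function.Injective (Matrix.toLin' M) := by
          change Function.Injective M.mulVec
          exact Matrix.mulVec_injective_iff_isUnit.2 ((Matrix.isUnit_iff_isUnit_det _).2 (isUnit_iff_ne_zero.2 hM))
        exact ((LinearMap.continuous_of_finiteDimensional (Matrix.toLin' M)).measurableEmbedding this)
      have h5 := hemb.integral_map (μ := volume) H
      rw [hmap, integral_smul_measure] at h5
      rw [ENNReal.toReal_ofReal (abs_nonneg _), abs_inv] at h5
      rw [h5]; rfl
    rw [h4]
    simp only [hH]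
    rw [GaussianFourier.integral_cexp_neg_sum_mul_add (fun i => by rw [Complex.re_ofReal_mul]; exact mul_pos hpi (hb i))]
    rw [Finset.prod_mul_distrib, ← Complex.exp_sum, Complex.real_smul, ← mul_assoc]
    congr 1
    · congr 1
      refine Finset.prod_congr rfl fun i _ => ?_
      congr 1
      have : b i ≠ 0 := fun h => by have := hb i; simp [h] at this
      have hpc : (Real.pi : ℂ) ≠ 0 := by exact_mod_cast hpi.ne'
      field_simp
    · rw [gs, ← hw, Finset.mul_sum]
      congr 1
      refine Finset.sum_congr rfl fun i _ => ?_
      have : b i ≠ 0 := fun h => by have := hb i; simp [h] at this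
      have hpc : (Real.pi : ℂ) ≠ 0 := by exact_mod_cast hpi.ne'
      field_simp
      ring_nf
      simp [Complex.I_sq]
  have hsum' := (summable_gs (M⁻¹.transpose) (det_inv_transpose M hM) (fun v => 1 / b v) (fun v => re_inv_pos (hb v))).of_norm
  rw [poisson (gs M b) hcont hIntg ?_ ?_ x]
  · simp_rw [hcoef]
    rw [← tsum_mul_left]
    exact tsum_congr fun m => by ring
  · intro R
    refine ⟨fun k => Real.exp ((β * (Real.pi * δ)) * (Fintype.card ι * R^2)) * Real.exp (-(β * (Real.pi * δ)/2) * ∑ i, (k i : ℝ)^2), (summable_gauss (by positivity)).mul_left _, ?_⟩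
    intro x hx k
    refine (hle _).trans ?_
    beta_reduce
    rw [← Real.exp_add]
    apply Real.exp_le_exp.2
    have h6 : ∑ i, (k i : ℝ)^2 / 2 ≤ ∑ i, ((x i + k i)^2 + R^2) := by
      refine Finset.sum_le_sum fun i _ => ?_
      have : (x i)^2 ≤ R^2 := sq_le_sq' (by linarith [(abs_le.1 (hx i)).1]) (abs_le.1 (hx i)).2
      nlinarith [sq_nonneg (2 * x i + k i)]
    rw [Finset.sum_add_distrib, Finset.sum_const, Finset.card_univ, nsmul_eq_mul, ← Finset.sum_div] at h6
    have h7 : 0 < β * (Real.pi * δ) := by positivity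
    nlinarith
  · simp_rw [hcoef]
    exact hsum'.mul_left _

end CN
end

section
open MeasureTheory Filter Topology
namespace CN

lemma mean_one {ι : Type*} [Fintype ι] [DecidableEq ι] (M : Matrix ι ι ℝ) (hM : M.det ≠ 0)
    {l : Filter ℝ} (b : ℝ → ι → ℂ) (hb : ∀ᶠ t in l, ∀ v, 0 < (b t v).re)
    (hb2 : ∀ v, Tendsto (fun t => (1 / b t v).re) l atTop) (x : ι → ℝ) :
    Tendsto (fun t => ((|M.det| : ℝ) : ℂ) * (∏ v, (1 / b t v)^(1/2 : ℂ))⁻¹ * ∑' k : ι → ℤ, gs M (b t) (fun i => x i + k i)) l (𝓝 1) := by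
  set M' := M⁻¹.transpose
  have hM' : M'.det ≠ 0 := det_inv_transpose M hM
  set e : (ι → ℤ) → ℂ := fun m => Complex.exp (2 * Real.pi * Complex.I * ∑ i, (m i : ℂ) * (x i : ℂ)) with he
  have he1 : ∀ m, ‖e m‖ = 1 := by
    intro m
    have : (2 * Real.pi * Complex.I * ∑ i, (m i : ℂ) * (x i : ℂ)) = ((2 * Real.pi * ∑ i, (m i : ℝ) * x i : ℝ) : ℂ) * Complex.I := by
      push_cast; ring
    rw [he]
    beta_reduce
    rw [this, Complex.norm_exp_ofReal_mul_I]
  have hev : ∀ᶠ t in l, ∑' m : ι → ℤ, gs M' (fun v => 1 / b t v) (fun i => m i) * e m =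
     ((|M.det| : ℝ) : ℂ) * (∏ v, (1 / b t v)^(1/2 : ℂ))⁻¹ * ∑' k : ι → ℤ, gs M (b t) (fun i => x i + k i) := by
    filter_upwards [hb] with t ht
    rw [gauss_poisson M hM (b t) ht x]
    have h1 : (∏ v, (1 / b t v)^(1/2 : ℂ)) ≠ 0 := by
      refine Finset.prod_ne_zero_iff.2 fun v _ => ?_
      rw [Complex.cpow_ne_zero_iff]
      left
      have := re_inv_pos (ht v)
      intro h; rw [h] at this; simp at this
    have h2 : ((|M.det| : ℝ) : ℂ) ≠ 0 := by exact_mod_cast abs_ne_zero.2 hM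
    push_cast
    field_simp
    rfl
  refine Tendsto.congr' hev ?_
  obtain ⟨δ, hδ, hd⟩ := coercive M' hM'
  have hpi := Real.pi_pos
  have htail := tsum_gauss_tail (ι := ι) (δ := Real.pi * δ) (by positivity)
  rw [Metric.tendsto_nhds]
  intro ε hε
  obtain ⟨T, hT1, hT⟩ := ((eventually_gt_atTop 0).and (htail.eventually (gt_mem_nhds hε))).exists
  have hTe : ∀ᶠ t in l, ∀ v, T ≤ (1 / b t v).re := eventually_all.2 fun v => (hb2 v).eventually_ge_atTop T
  filter_upwards [hb, hTe] with t ht htT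
  refine lt_of_le_of_lt ?_ hT
  have hs := summable_gs M' hM' (fun v => 1 / b t v) (fun v => re_inv_pos (ht v))
  have hs' : Summable (fun m : ι → ℤ => gs M' (fun v => 1 / b t v) (fun i => m i) * e m) := by
    refine Summable.of_norm (hs.congr fun m => ?_)
    rw [norm_mul, he1, mul_one]
  rw [dist_eq_norm, hs'.tsum_eq_add_tsum_ite (0 : ι → ℤ)]
  have h0 : gs M' (fun v => 1 / b t v) (fun i => ((0 : ι → ℤ) i : ℝ)) * e 0 = 1 := by
    have : (fun i : ι => ((0 : ι → ℤ) i : ℝ)) = 0 := by ext; simp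
    rw [this]
    simp [gs, he]
  rw [h0, add_sub_cancel_left]
  refine tsum_of_norm_bounded (Summable.hasSum ?_) ?_
  · have h3 := summable_gauss (ι := ι) (δ := T * (Real.pi * δ)) (by positivity)
    refine Summable.of_nonneg_of_le (fun k => ?_) (fun k => ?_) h3
    · split_ifs <;> positivity
    · split_ifs
      · positivity
      · exact le_rfl
  · intro m
    split_ifs with hm
    · simp
    · rw [norm_mul, he1, mul_one]
      exact norm_gs_le M' hd _ hT1.le htT _

/-- average of a periodic function over a box -/
noncomputable def avg {ι : Type*} [Fintype ι] [DecidableEq ι] (N : ℕ) (f : (ι → ℤ) → ℂ) : ℂ :=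
  ((N : ℂ) ^ (Fintype.card ι))⁻¹ * ∑ r : ι → Fin N, f (fun i => ((r i : ℕ) : ℤ))

def Periodic {ι : Type*} (N : ℕ) (f : (ι → ℤ) → ℂ) : Prop :=
  ∀ k k' : ι → ℤ, (∀ i, (N : ℤ) ∣ k i - k' i) → f k = f k'

lemma mean_avg {ι : Type*} [Fintype ι] [DecidableEq ι] (M : Matrix ι ι ℝ) (hM : M.det ≠ 0)
    {l : Filter ℝ} (b : ℝ → ι → ℂ) (hb : ∀ᶠ t in l, ∀ v, 0 < (b t v).re)
    (hb2 : ∀ v, Tendsto (fun t => (1 / b t v).re) l atTop) (N : ℕ) (hN : N ≠ 0)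
    (f : (ι → ℤ) → ℂ) (hf : Periodic N f) :
    Tendsto (fun t => ((|M.det| : ℝ) : ℂ) * (∏ v, (1 / b t v)^(1/2 : ℂ))⁻¹ * ∑' k : ι → ℤ, f k * gs M (b t) (fun i => k i)) l
      (𝓝 (avg N f)) := by
  have : NeZero N := ⟨hN⟩
  set MN : Matrix ι ι ℝ := (N : ℝ) • M with hMN
  have hN' : (N : ℝ) ≠ 0 := by exact_mod_cast hN
  have hdet : MN.det = (N : ℝ)^(Fintype.card ι) * M.det := by rw [hMN, Matrix.det_smul]
  have hMNd : MN.det ≠ 0 := by rw [hdet]; positivity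
  let E : (ι → ℤ) ≃ (ι → Fin N) × (ι → ℤ) :=
    ((Equiv.piCongrRight fun _ => Int.divModEquiv N).trans (Equiv.arrowProdEquivProdArrow ι (fun _ => ℤ) (fun _ => Fin N))).trans (Equiv.prodComm _ _)
  have hE : ∀ r k, E.symm (r, k) = fun i => k i * N + ((r i : ℕ) : ℤ) := by
    intro r k; rfl
  have hgs : ∀ t (r : ι → Fin N) (k : ι → ℤ), gs M (b t) (fun i => ((E.symm (r,k) i : ℤ) : ℝ)) = gs MN (b t) (fun i => ((r i : ℕ) : ℝ) / N + k i) := by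
    intro t r k
    rw [hE]
    unfold gs
    congr 3
    ext v
    congr 3
    rw [hMN, Matrix.smul_mulVec]
    simp only [Pi.smul_apply, Matrix.mulVec, dotProduct, Finset.smul_sum]
    refine Finset.sum_congr rfl fun j _ => ?_
    push_cast
    simp only [smul_eq_mul]
    field_simp
    ring
  have hfE : ∀ (r : ι → Fin N) (k : ι → ℤ), f (E.symm (r,k)) = f (fun i => ((r i : ℕ) : ℤ)) := by
    intro r k
    apply hf
    intro i
    rw [hE]
    simp
  have hlim := tendsto_finsetSum (Finset.univ : Finset (ι → Fin N)) (fun r _ =>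
    ((mean_one MN hMNd b hb hb2 (fun i => ((r i : ℕ) : ℝ) / N)).const_mul (f (fun i => ((r i : ℕ) : ℤ)))))
  have hlim2 := hlim.const_mul ((N : ℂ) ^ (Fintype.card ι))⁻¹
  simp only [mul_one] at hlim2
  refine Tendsto.congr' ?_ hlim2
  filter_upwards [hb] with t ht
  have hs := summable_gs M hM (b t) ht
  have hfb : ∃ C, ∀ k, ‖f k‖ ≤ C := by
    refine ⟨∑ r : ι → Fin N, ‖f (fun i => ((r i : ℕ) : ℤ))‖, fun k => ?_⟩
    rw [← E.symm_apply_apply k, ← Prod.mk.eta (p := E k), hfE]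
    exact Finset.single_le_sum (f := fun r : ι → Fin N => ‖f (fun i => ((r i : ℕ) : ℤ))‖) (fun _ _ => norm_nonneg _) (Finset.mem_univ _)
  obtain ⟨C, hC⟩ := hfb
  have hsf : Summable (fun k : ι → ℤ => f k * gs M (b t) (fun i => k i)) := by
    refine Summable.of_norm (Summable.of_nonneg_of_le (fun _ => norm_nonneg _) (fun k => ?_) (hs.mul_left C))
    rw [norm_mul]
    exact mul_le_mul_of_nonneg_right (hC k) (norm_nonneg _)
  have h1 : ∑' k : ι → ℤ, f k * gs M (b t) (fun i => k i) = ∑ r : ι → Fin N, f (fun i => ((r i : ℕ) : ℤ)) * ∑' k : ι → ℤ, gs MN (b t) (fun i => ((r i : ℕ) : ℝ) / N + k i) := by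
    have h9 := Summable.tsum_prod ((E.symm.summable_iff).2 hsf)
    simp only [Function.comp_apply] at h9
    rw [← E.symm.tsum_eq, h9, tsum_fintype]
    refine Finset.sum_congr rfl fun r _ => ?_
    rw [← tsum_mul_left]
    refine tsum_congr fun k => ?_
    rw [hfE, hgs]
  rw [h1, Finset.mul_sum, Finset.mul_sum]
  refine Finset.sum_congr rfl fun r _ => ?_
  have h3 : ((|MN.det| : ℝ) : ℂ) = (N : ℂ)^(Fintype.card ι) * ((|M.det| : ℝ) : ℂ) := by
    rw [hdet, abs_mul, abs_of_nonneg (by positivity)]; push_cast; rfl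
  rw [h3]
  have : (N : ℂ) ≠ 0 := by exact_mod_cast hN
  field_simp

lemma avg_fin {ι : Type*} [Fintype ι] [DecidableEq ι] (N : ℕ) (hN : N ≠ 0) {F : Type*} [AddCommGroup F] [Fintype F]
    (hF : ∀ x : F, N • x = 0) (φ : (ι → ℤ) →+ F) (hφ : Function.Surjective φ) (g : F → ℂ) :
    avg N (fun k => g (φ k)) = (Fintype.card F : ℂ)⁻¹ * ∑ x, g x := by
  have : NeZero N := ⟨hN⟩
  have hper : ∀ k k' : ι → ℤ, (∀ i, (N : ℤ) ∣ k i - k' i) → φ k = φ k' := by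
    intro k k' h
    choose q hq using h
    have : k = k' + N • q := by
      ext i
      have := hq i
      simp
      linarith
    rw [this, map_add, map_nsmul, hF, add_zero]
  set P : (ι → Fin N) → F := fun r => φ (fun i => ((r i : ℕ) : ℤ)) with hP
  have hshift : ∀ c : F, ∑ r, g (P r) = ∑ r, g (P r + c) := by
    intro c
    obtain ⟨s, rfl⟩ := hφ c
    let s' : ι → Fin N := fun i => (Int.divModEquiv N (s i)).2
    have hs' : ∀ i, (N : ℤ) ∣ ((s' i : ℕ) : ℤ) - s i := by
      intro i
      have := (Int.divModEquiv N).symm_apply_apply (s i)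
      refine ⟨-(Int.divModEquiv N (s i)).1, ?_⟩
      have h2 : (Int.divModEquiv N (s i)).1 * N + ((s' i : ℕ) : ℤ) = s i := this
      linarith
    rw [← Equiv.sum_comp (Equiv.addRight s')]
    refine Finset.sum_congr rfl fun r _ => ?_
    congr 1
    simp only [hP, Equiv.coe_addRight]
    rw [← map_add]
    apply hper
    intro i
    simp only [Pi.add_apply, Fin.val_add]
    have h1 : (N : ℤ) ∣ (((r i : ℕ) + (s' i : ℕ) : ℕ) : ℤ) - ((((r i : ℕ) + (s' i : ℕ)) % N : ℕ) : ℤ) := by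
      push_cast
      exact Int.dvd_self_sub_emod
    obtain ⟨p, hp⟩ := h1
    obtain ⟨q, hq⟩ := hs' i
    refine ⟨q - p, ?_⟩
    push_cast at hp ⊢
    linarith
  have h1 : (Fintype.card F : ℂ) * ∑ r, g (P r) = (N : ℂ)^(Fintype.card ι) * ∑ x, g x := by
    calc (Fintype.card F : ℂ) * ∑ r, g (P r) = ∑ _c : F, ∑ r, g (P r) := by simp
      _ = ∑ c : F, ∑ r, g (P r + c) := Finset.sum_congr rfl fun c _ => hshift c
      _ = ∑ r, ∑ c : F, g (P r + c) := Finset.sum_comm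
      _ = ∑ r : ι → Fin N, ∑ x, g x := Finset.sum_congr rfl fun r _ => Equiv.sum_comp (Equiv.addLeft (P r)) g
      _ = _ := by simp
  have hN' : (N : ℂ) ≠ 0 := by exact_mod_cast hN
  have hc : (Fintype.card F : ℂ) ≠ 0 := by
    have : Fintype.card F ≠ 0 := Fintype.card_ne_zero
    exact_mod_cast this
  rw [avg]
  change _ * ∑ r, g (P r) = _
  field_simp
  rw [mul_comm, h1]

end CN
end

section
open MeasureTheory Filter Topology
namespace CN

lemma real_mul_cpow {r : ℝ} (hr : 0 < r) {z : ℂ} (hz : z ≠ 0) (w : ℂ) :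
    ((r : ℂ) * z) ^ w = (r : ℂ)^w * z^w := by
  have hr' : (r : ℂ) ≠ 0 := by exact_mod_cast hr.ne'
  rw [Complex.cpow_def_of_ne_zero (mul_ne_zero hr' hz), Complex.cpow_def_of_ne_zero hr', Complex.cpow_def_of_ne_zero hz,
    ← Complex.exp_add, Complex.log_ofReal_mul hr hz, Complex.ofReal_log hr.le]
  ring_nf

/-- the archimedean phase -/
noncomputable def ph (c : ℝ) : ℂ := (if 0 < c then Complex.I else -Complex.I) ^ (1/2 : ℂ)

lemma ph_ne (c : ℝ) : ph c ≠ 0 := by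
  unfold ph
  split_ifs <;> simp

lemma ph_congr {c d : ℝ} (h : 0 < c ↔ 0 < d) : ph c = ph d := by
  unfold ph; simp [h]

lemma limit_factor {c : ℝ} (hc : c ≠ 0) :
    Tendsto (fun t : ℝ => ((1 / (t : ℂ))^(1/2 : ℂ))⁻¹ * (1 / ((t : ℂ) - 2 * Complex.I * c))^(1/2 : ℂ) *
      (4 * (c:ℂ)^2 / t + 2 * Complex.I * c)^(1/2 : ℂ)) (𝓝[>] 0)
      (𝓝 (((2 * |c|) ^ (1/2 : ℝ) : ℝ) * ph c)) := by
  have hcC : (c : ℂ) ≠ 0 := by exact_mod_cast hc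
  have hpos : 0 < 2 * |c| := by positivity
  have h1 : Tendsto (fun t : ℝ => (1 / ((t : ℂ) - 2 * Complex.I * c))^(1/2 : ℂ)) (𝓝[>] 0)
      (𝓝 ((Complex.I / (2 * c))^(1/2 : ℂ))) := by
    have h0 : Tendsto (fun t : ℝ => 1 / ((t : ℂ) - 2 * Complex.I * c)) (𝓝[>] 0) (𝓝 (Complex.I / (2 * c))) := by
      have : (Complex.I / (2 * c)) = 1 / (((0:ℝ) : ℂ) - 2 * Complex.I * c) := by
        have : (((0:ℝ) : ℂ) - 2 * Complex.I * c) ≠ 0 := by simp [hc]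
        field_simp
        push_cast
        linear_combination (-2 * (c : ℂ)) * Complex.I_sq
      rw [this]
      apply tendsto_nhdsWithin_of_tendsto_nhds
      apply ContinuousAt.tendsto (f := fun t : ℝ => 1 / ((t : ℂ) - 2 * Complex.I * c))
      refine ContinuousAt.div continuousAt_const (by fun_prop) (by simp [hc])
    refine (continuousAt_cpow_const ?_).tendsto.comp h0
    right
    have : (Complex.I / (2 * (c:ℂ))) = ((1 / (2 * c) : ℝ) : ℂ) * Complex.I := by push_cast; ring
    rw [this]
    simp [hc]
  have h2 : Tendsto (fun t : ℝ => ((1 / (t : ℂ))^(1/2 : ℂ))⁻¹ * (4 * (c:ℂ)^2 / t + 2 * Complex.I * c)^(1/2 : ℂ)) (𝓝[>] 0)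
      (𝓝 ((4 * (c:ℂ)^2)^(1/2 : ℂ))) := by
    have h3 : Tendsto (fun t : ℝ => (4 * (c:ℂ)^2 + 2 * Complex.I * c * t)^(1/2 : ℂ)) (𝓝[>] 0) (𝓝 ((4 * (c:ℂ)^2)^(1/2 : ℂ))) := by
      apply tendsto_nhdsWithin_of_tendsto_nhds
      have h0 : Tendsto (fun t : ℝ => 4 * (c:ℂ)^2 + 2 * Complex.I * c * t) (𝓝 0) (𝓝 (4 * (c:ℂ)^2)) := by
        have : Continuous (fun t : ℝ => 4 * (c:ℂ)^2 + 2 * Complex.I * c * t) := by fun_prop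
        simpa using this.tendsto 0
      refine (continuousAt_cpow_const ?_).tendsto.comp h0
      left
      have : (4 * (c:ℂ)^2) = ((4 * c^2 : ℝ) : ℂ) := by push_cast; rfl
      rw [this, Complex.ofReal_re]; positivity
    refine h3.congr' ?_
    filter_upwards [self_mem_nhdsWithin] with t ht
    have ht : 0 < t := ht
    have htC : (t : ℂ) ≠ 0 := by exact_mod_cast ht.ne'
    have h5 : (4 * (c:ℂ)^2 + 2 * Complex.I * c * t) ≠ 0 := by
      intro h
      have := congrArg Complex.re h
      have h6 : (4 * (c:ℂ)^2 + 2 * Complex.I * c * t) = ((4 * c^2 : ℝ) : ℂ) + ((2 * c * t : ℝ) : ℂ) * Complex.I := by push_cast; ring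
      rw [h6, Complex.add_re, Complex.ofReal_re, Complex.re_ofReal_mul, Complex.I_re] at this
      simp at this
      exact hc this
    have h4 : 4 * (c:ℂ)^2 / t + 2 * Complex.I * c = ((1 / t : ℝ) : ℂ) * (4 * (c:ℂ)^2 + 2 * Complex.I * c * t) := by
      push_cast; field_simp
    rw [h4, real_mul_cpow (by positivity) h5]
    have : ((1 / t : ℝ) : ℂ)^(1/2 : ℂ) ≠ 0 := by
      rw [Complex.cpow_ne_zero_iff]; left; exact_mod_cast (by positivity : (1/t) ≠ 0)
    push_cast at this ⊢
    field_simp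
  have h3 := h1.mul h2
  have h7 : (((2 * |c|) ^ (1/2 : ℝ) : ℝ) : ℂ) * ph c = (Complex.I / (2 * c))^(1/2 : ℂ) * (4 * (c:ℂ)^2)^(1/2 : ℂ) := by
    have e1 : Complex.I / (2 * (c:ℂ)) = ((1 / (2 * |c|) : ℝ) : ℂ) * (if 0 < c then Complex.I else -Complex.I) := by
      split_ifs with h
      · rw [abs_of_pos h]; push_cast; ring
      · rw [abs_of_nonpos (not_lt.1 h)]; push_cast; field_simp
    have e2 : (4 * (c:ℂ)^2) = ((2 * |c| : ℝ) : ℂ) * ((2 * |c| : ℝ) : ℂ) := by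
      rw [← Complex.ofReal_mul, mul_mul_mul_comm, abs_mul_abs_self]; push_cast; ring
    rw [e1, e2, real_mul_cpow (by positivity) (by split_ifs <;> simp), real_mul_cpow hpos (by exact_mod_cast hpos.ne'), ← ph]
    have e3 : ((1 / (2 * |c|) : ℝ) : ℂ)^(1/2:ℂ) * ((2 * |c| : ℝ) : ℂ)^(1/2:ℂ) = 1 := by
      rw [← Complex.mul_cpow_ofReal_nonneg (by positivity) hpos.le, ← Complex.ofReal_mul, one_div, inv_mul_cancel₀ hpos.ne']
      simp
    rw [Complex.ofReal_cpow hpos.le]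
    push_cast at e3 ⊢
    linear_combination (-(2 * ((|c| : ℝ) : ℂ)) ^ (1/2 : ℂ) * ph c) * e3
  rw [h7]
  refine h3.congr fun t => ?_
  ring

theorem hecke_abs {ι : Type*} [Fintype ι] [DecidableEq ι] (M : Matrix ι ι ℝ) (hM : M.det ≠ 0)
    (c : ι → ℝ) (hc : ∀ v, c v ≠ 0) (N N' : ℕ) (hN : N ≠ 0) (hN' : N' ≠ 0)
    (hf : Periodic N (fun k : ι → ℤ => Complex.exp (2 * Real.pi * Complex.I * ∑ v, (c v : ℂ) * ((M.mulVec (fun i => (k i : ℝ)) v : ℝ) : ℂ)^2)))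
    (hf' : Periodic N' (fun k : ι → ℤ => Complex.exp (-(2 * Real.pi * Complex.I * ∑ v, ((M⁻¹.transpose.mulVec (fun i => (k i : ℝ)) v : ℝ) : ℂ)^2 / (4 * (c v : ℂ)))))) :
    ∃ q : ℝ, 0 < q ∧ avg N (fun k : ι → ℤ => Complex.exp (2 * Real.pi * Complex.I * ∑ v, (c v : ℂ) * ((M.mulVec (fun i => (k i : ℝ)) v : ℝ) : ℂ)^2))
      = q * (∏ v, ph (c v)) * avg N' (fun k : ι → ℤ => Complex.exp (-(2 * Real.pi * Complex.I * ∑ v, ((M⁻¹.transpose.mulVec (fun i => (k i : ℝ)) v : ℝ) : ℂ)^2 / (4 * (c v : ℂ))))) := by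
  set f := (fun k : ι → ℤ => Complex.exp (2 * Real.pi * Complex.I * ∑ v, (c v : ℂ) * ((M.mulVec (fun i => (k i : ℝ)) v : ℝ) : ℂ)^2)) with hfdef
  set f' := (fun k : ι → ℤ => Complex.exp (-(2 * Real.pi * Complex.I * ∑ v, ((M⁻¹.transpose.mulVec (fun i => (k i : ℝ)) v : ℝ) : ℂ)^2 / (4 * (c v : ℂ))))) with hfdef'
  refine ⟨|M.det| * ∏ v, (2 * |c v|) ^ (1/2 : ℝ), mul_pos (abs_pos.2 hM) (Finset.prod_pos fun v _ => Real.rpow_pos_of_pos (by have := hc v; positivity) _), ?_⟩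
  have hl1 := mean_avg M hM (l := 𝓝[>] (0:ℝ)) (fun t _ => (t : ℂ)) (by
      filter_upwards [self_mem_nhdsWithin] with t ht v
      simpa using ht) (by
      intro v
      refine (tendsto_inv_nhdsGT_zero (𝕜 := ℝ)).congr fun t => ?_
      rw [one_div, ← Complex.ofReal_inv, Complex.ofReal_re]) N hN f hf
  set b' : ℝ → ι → ℂ := fun t v => 1 / (4 * (c v:ℂ)^2 / t + 2 * Complex.I * c v) with hb'
  have hre : ∀ t v, (4 * (c v:ℂ)^2 / t + 2 * Complex.I * c v).re = 4 * (c v)^2 * t⁻¹ := by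
    intro t v
    have : (4 * (c v:ℂ)^2 / t + 2 * Complex.I * c v) = ((4 * (c v)^2 * t⁻¹ : ℝ) : ℂ) + ((2 * c v : ℝ) : ℂ) * Complex.I := by push_cast; ring
    rw [this, Complex.add_re, Complex.ofReal_re, Complex.re_ofReal_mul, Complex.I_re, mul_zero, add_zero]
  have hbp : ∀ t : ℝ, 0 < t → ∀ v, 0 < (4 * (c v:ℂ)^2 / t + 2 * Complex.I * c v).re := by
    intro t ht v
    rw [hre]; have := hc v; positivity
  have hb'' : ∀ t v, 1 / b' t v = 4 * (c v:ℂ)^2 / t + 2 * Complex.I * c v := by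
    intro t v; simp [hb']
  have hl2 := mean_avg M⁻¹.transpose (det_inv_transpose M hM) (l := 𝓝[>] (0:ℝ)) b' (by
      filter_upwards [self_mem_nhdsWithin] with t ht v
      exact re_inv_pos (hbp t ht v)) (by
      intro v
      simp_rw [hb'', hre]
      have := hc v
      exact (tendsto_inv_nhdsGT_zero (𝕜 := ℝ)).const_mul_atTop (by positivity)) N' hN' f' hf'
  have hl3 := tendsto_finsetProd (Finset.univ : Finset ι) (fun v _ => limit_factor (hc v))
  have hl4 := (hl3.mul hl2).const_mul ((|M.det| : ℝ) : ℂ)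
  have hl5 := hl1.congr' (f₂ := fun t : ℝ => ((|M.det| : ℝ) : ℂ) * ((∏ v, (((1 / (t : ℂ))^(1/2 : ℂ))⁻¹ * (1 / ((t : ℂ) - 2 * Complex.I * c v))^(1/2 : ℂ) *
      (4 * (c v:ℂ)^2 / t + 2 * Complex.I * c v)^(1/2 : ℂ))) * (((|M⁻¹.transpose.det| : ℝ) : ℂ) * (∏ v, (1 / b' t v)^(1/2 : ℂ))⁻¹ * ∑' k : ι → ℤ, f' k * gs M⁻¹.transpose (b' t) (fun i => k i)))) (by
    filter_upwards [self_mem_nhdsWithin] with t ht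
    have ht : 0 < t := ht
    have htC : (t : ℂ) ≠ 0 := by exact_mod_cast ht.ne'
    set B : ι → ℂ := fun v => (t : ℂ) - 2 * Complex.I * c v with hB
    have hBre : ∀ v, 0 < (B v).re := by intro v; simp [hB, ht]
    have h1 : ∀ k : ι → ℤ, f k * gs M (fun _ => (t : ℂ)) (fun i => k i) = gs M B (fun i => 0 + k i) := by
      intro k
      simp only [hfdef, gs, zero_add]
      rw [← Complex.exp_add, Finset.mul_sum, Finset.mul_sum, Finset.mul_sum, ← Finset.sum_add_distrib]
      congr 1
      refine Finset.sum_congr rfl fun v _ => ?_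
      simp only [hB]; ring
    have h2 : ∀ k : ι → ℤ, f' k * gs M⁻¹.transpose (b' t) (fun i => k i) = gs M⁻¹.transpose (fun v => 1 / B v) (fun i => k i) := by
      intro k
      simp only [hfdef', gs]
      rw [← Complex.exp_add, Finset.mul_sum, Finset.mul_sum, Finset.mul_sum, ← Finset.sum_neg_distrib, ← Finset.sum_add_distrib]
      congr 1
      refine Finset.sum_congr rfl fun v _ => ?_
      have hcv : (c v : ℂ) ≠ 0 := by exact_mod_cast hc v
      have hBv : B v ≠ 0 := fun h => by have := hBre v; simp [h] at this
      have hden : (4 * (c v:ℂ)^2 / t + 2 * Complex.I * c v) ≠ 0 := fun h => by have := hbp t ht v; simp [h] at this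
      have e1 : b' t v = 1 / B v - Complex.I / (2 * c v) := by
        simp only [hb']
        have e2 : (4 * (c v:ℂ)^2 / t + 2 * Complex.I * c v) = 2 * c v * Complex.I * B v / t := by
          simp only [hB]; field_simp; linear_combination (4 * (c v : ℂ)) * Complex.I_sq
        have e3 : (t:ℂ) = Complex.I * (2 * c v - Complex.I * B v) := by
          simp only [hB]; linear_combination ((t:ℂ) - 2 * Complex.I * c v) * Complex.I_sq
        have hI := Complex.I_ne_zero
        rw [e2, one_div_div, div_sub_div _ _ hBv (by simpa using hcv), div_eq_div_iff (mul_ne_zero (mul_ne_zero (mul_ne_zero two_ne_zero hcv) hI) hBv) (mul_ne_zero hBv (mul_ne_zero two_ne_zero hcv))]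
        linear_combination (2 * (c v : ℂ) * B v) * e3
      rw [e1]
      field_simp
      ring
    simp_rw [h1, h2]
    have h3 := gauss_poisson M hM B hBre 0
    simp only [Pi.zero_apply, Complex.ofReal_zero, mul_zero, Finset.sum_const_zero, Complex.exp_zero, mul_one] at h3
    rw [h3, Matrix.det_transpose, Matrix.det_nonsing_inv, Ring.inverse_eq_inv', abs_inv]
    simp_rw [hb'']
    rw [Finset.prod_mul_distrib, Finset.prod_mul_distrib, Finset.prod_inv_distrib]
    have h4 : ∏ v, (4 * (c v:ℂ)^2 / t + 2 * Complex.I * c v)^(1/2 : ℂ) ≠ 0 := by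
      refine Finset.prod_ne_zero_iff.2 fun v _ => ?_
      rw [Complex.cpow_ne_zero_iff]; left
      exact fun h => by have := hbp t ht v; simp [h] at this
    simp only [hB]
    generalize (∏ v, (4 * (c v:ℂ)^2 / t + 2 * Complex.I * c v)^(1/2 : ℂ)) = Q at h4 ⊢
    have h5 : ((|M.det| : ℝ) : ℂ) ≠ 0 := by exact_mod_cast abs_ne_zero.2 hM
    push_cast
    field_simp)
  rw [tendsto_nhds_unique hl5 hl4]
  push_cast
  rw [Finset.prod_mul_distrib]
  ring
end CN
end

section
open MeasureTheory Filter Topology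
namespace CN

lemma gauss_field_aux {F : Type*} [Field F] [Fintype F] [DecidableEq F] (hF : ringChar F ≠ 2)
    (ψ : AddChar F ℂ) (hψ : ψ ≠ 1) :
    ∑ x : F, ψ (x ^ 2) = gaussSum ((quadraticChar F).ringHomComp (Int.castRingHom ℂ)) ψ := by
  have h1 : ∑ x : F, ψ (x ^ 2) = ∑ y : F, ((quadraticChar F y + 1 : ℤ) : ℂ) * ψ y := by
    have := Finset.sum_fiberwise (Finset.univ : Finset F) (fun x : F => x ^ 2) (fun x => ψ (x ^ 2))
    rw [← this]
    refine Finset.sum_congr rfl fun y _ => ?_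
    rw [← quadraticChar_card_sqrts hF y]
    rw [Finset.sum_congr rfl (g := fun _ => ψ y)]
    · rw [Finset.sum_const, nsmul_eq_mul]
      congr 2
      simp
    · intro x hx
      rw [(Finset.mem_filter.mp hx).2]
  have h2 : ∑ y : F, ψ y = 0 := AddChar.sum_eq_zero_of_ne_one hψ
  rw [h1, gaussSum]
  push_cast
  simp_rw [add_mul, Finset.sum_add_distrib, one_mul, h2, add_zero]
  rfl

lemma gauss_field {F : Type*} [Field F] [Fintype F] [DecidableEq F] (hF : ringChar F ≠ 2)
    (ψ : AddChar F ℂ) (hψ : ψ ≠ 1) (a : F) (ha : a ≠ 0) :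
    ∑ x : F, ψ (a * x ^ 2) = ((quadraticChar F a : ℤ) : ℂ) * ∑ x : F, ψ (x ^ 2) := by
  have hp : ψ.IsPrimitive := AddChar.IsPrimitive.of_ne_one hψ
  have h3 := gauss_field_aux hF (ψ.mulShift a) (hp ha)
  simp only [AddChar.mulShift_apply] at h3
  rw [h3, gauss_field_aux hF ψ hψ]
  have h4 := gaussSum_mulShift_eq ((quadraticChar F).ringHomComp (Int.castRingHom ℂ)) ψ (Units.mk0 a ha)
  simp only [Units.val_mk0] at h4
  rw [h4]
  congr 1
  have h5 : ((quadraticChar F).ringHomComp (Int.castRingHom ℂ))⁻¹ = (quadraticChar F).ringHomComp (Int.castRingHom ℂ) :=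
    ((quadraticChar_isQuadratic F).comp _).inv
  rw [h5]
  simp

lemma gauss_field_ne {F : Type*} [Field F] [Fintype F] [DecidableEq F] (hF : ringChar F ≠ 2)
    (ψ : AddChar F ℂ) (hψ : ψ ≠ 1) : ∑ x : F, ψ (x ^ 2) ≠ 0 := by
  rw [gauss_field_aux hF ψ hψ]
  apply gaussSum_ne_zero_of_nontrivial
  · simp
  · intro h
    apply quadraticChar_ne_one hF
    ext u
    have := congrArg (fun χ : MulChar F ℂ => χ u) h
    simpa using this
  · exact AddChar.IsPrimitive.of_ne_one hψ

lemma gauss_pi {ι : Type*} [Fintype ι] [DecidableEq ι] {k : ι → Type*} [∀ i, Field (k i)] [∀ i, Fintype (k i)]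
    [∀ i, DecidableEq (k i)] (hk : ∀ i, ringChar (k i) ≠ 2) (ψ : AddChar (∀ i, k i) ℂ)
    (hψ : ∀ u, (∀ r, ψ (u * r) = 1) → u = 0) :
    (∑ x : ∀ i, k i, ψ (x ^ 2) ≠ 0) ∧ ∀ a : ∀ i, k i, (∀ i, a i ≠ 0) →
      ∑ x : ∀ i, k i, ψ (a * x ^ 2) = (∏ i, ((quadraticChar (k i) (a i) : ℤ) : ℂ)) * ∑ x : ∀ i, k i, ψ (x ^ 2) := by
  let φ : ∀ i, AddChar (k i) ℂ := fun i => ψ.compAddMonoidHom (AddMonoidHom.single k i)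
  have hφ : ∀ x, ψ x = ∏ i, φ i (x i) := by
    intro x
    conv_lhs => rw [← Finset.univ_sum_single x]
    have h0 : ∀ s : Finset ι, ψ (∑ i ∈ s, Pi.single i (x i)) = ∏ i ∈ s, φ i (x i) := by
      intro s
      induction s using Finset.induction_on with
      | empty => simp
      | insert i s hi ih => rw [Finset.sum_insert hi, Finset.prod_insert hi, AddChar.map_add_eq_mul, ih]; rfl
    exact h0 _
  have hn : ∀ i, φ i ≠ 1 := by
    intro i h
    have := hψ (Pi.single i 1) (fun r => by
      have : (Pi.single i 1 * r : ∀ i, k i) = Pi.single i (r i) := by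
        ext j
        by_cases hj : j = i
        · subst hj; simp
        · simp [hj]
      rw [this]
      exact congrArg (fun χ : AddChar (k i) ℂ => χ (r i)) h)
    have h2 := congrFun this i
    simp at h2
  have key : ∀ a : ∀ i, k i, ∑ x : ∀ i, k i, ψ (a * x ^ 2) = ∏ i, ∑ y : k i, φ i (a i * y ^ 2) := by
    intro a
    rw [Finset.prod_univ_sum]
    simp only [Fintype.piFinset_univ]
    exact Finset.sum_congr rfl fun x _ => by rw [hφ]; rfl
  have key1 : ∑ x : ∀ i, k i, ψ (x ^ 2) = ∏ i, ∑ y : k i, φ i (y ^ 2) := by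
    have := key 1
    simpa using this
  refine ⟨?_, fun a ha => ?_⟩
  · rw [key1]
    exact Finset.prod_ne_zero_iff.mpr fun i _ => gauss_field_ne (hk i) _ (hn i)
  · rw [key, key1, ← Finset.prod_mul_distrib]
    exact Finset.prod_congr rfl fun i _ => gauss_field (hk i) _ (hn i) _ (ha i)

lemma gauss_ring {R : Type*} [CommRing R] [Fintype R]
    {ι : Type*} [Fintype ι] [DecidableEq ι] {k : ι → Type*} [∀ i, Field (k i)] [∀ i, Fintype (k i)]
    [∀ i, DecidableEq (k i)] (e : R →+* ∀ i, k i) (he : Function.Bijective e)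
    (hk : ∀ i, ringChar (k i) ≠ 2) (ψ : AddChar R ℂ)
    (hψ : ∀ u, (∀ r, ψ (u * r) = 1) → u = 0) :
    (∑ x : R, ψ (x ^ 2) ≠ 0) ∧ ∀ a : R, (∀ i, e a i ≠ 0) →
      ∑ x : R, ψ (a * x ^ 2) = (∏ i, ((quadraticChar (k i) (e a i) : ℤ) : ℂ)) * ∑ x : R, ψ (x ^ 2) := by
  let E := RingEquiv.ofBijective e he
  let φ : AddChar (∀ i, k i) ℂ := ψ.compAddMonoidHom E.symm.toAddEquiv.toAddMonoidHom
  have hφ : ∀ x, φ (E x) = ψ x := fun x => by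
    change ψ (E.symm (E x)) = _
    rw [E.symm_apply_apply]
  obtain ⟨h1, h2⟩ := gauss_pi hk φ (fun u hu => by
    have := hψ (E.symm u) (fun r => by
      rw [← hφ, map_mul, E.apply_symm_apply]; exact hu _)
    simpa using this)
  have s : ∀ a, ∑ x : R, ψ (a * x ^ 2) = ∑ x : ∀ i, k i, φ (E a * x ^ 2) := by
    intro a
    refine Fintype.sum_equiv E.toEquiv _ _ fun x => ?_
    rw [← hφ, map_mul, map_pow]; rfl
  have s1 : ∑ x : R, ψ (x ^ 2) = ∑ x : ∀ i, k i, φ (x ^ 2) := by simpa using s 1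
  refine ⟨by rwa [s1], fun a ha => ?_⟩
  rw [s, s1]
  exact h2 _ ha

end CN
end

section
open MeasureTheory Filter Topology
namespace CN
open NumberField nonZeroDivisors

universe u
variable {K : Type u} [Field K] [NumberField K]

/-- the mean of a periodic function on a lattice -/
def HasMean (A : Submodule (𝓞 K) K) (f : K → ℂ) (μ : ℂ) : Prop :=
  ∃ (F : Type u) (_ : AddCommGroup F) (_ : Fintype F) (φ : A →+ F) (g : F → ℂ),
    Function.Surjective φ ∧ (∀ x : A, f x = g (φ x)) ∧ μ = (Fintype.card F : ℂ)⁻¹ * ∑ y, g y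

lemma avg_of_hasMean {ι : Type*} [Fintype ι] [DecidableEq ι] (b : Module.Basis ι ℚ K) (A : Submodule (𝓞 K) K)
    (hA : ∀ x, x ∈ A ↔ ∀ i, ∃ m : ℤ, b.repr x i = m) {f : K → ℂ} {μ : ℂ} (h : HasMean A f μ) :
    ∃ N : ℕ, N ≠ 0 ∧ ∀ N', N' ≠ 0 → N ∣ N' → Periodic N' (fun k : ι → ℤ => f (∑ i, (k i : ℚ) • b i)) ∧
      avg N' (fun k : ι → ℤ => f (∑ i, (k i : ℚ) • b i)) = μ := by
  obtain ⟨F, _, _, φ, g, hφ, hf, rfl⟩ := h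
  have hmem : ∀ k : ι → ℤ, ∑ i, (k i : ℚ) • b i ∈ A := fun k => by
    rw [hA]
    intro i
    refine ⟨k i, ?_⟩
    rw [b.repr_sum_self]
  let θ : (ι → ℤ) →+ A := 
    { toFun := fun k => ⟨∑ i, (k i : ℚ) • b i, hmem k⟩
      map_zero' := by ext; simp
      map_add' := fun x y => by ext; simp [add_smul, Finset.sum_add_distrib] }
  have hθ : Function.Surjective θ := by
    rintro ⟨x, hx⟩
    choose m hm using (hA x).1 hx
    refine ⟨m, ?_⟩
    ext
    change ∑ i, (m i : ℚ) • b i = x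
    simp_rw [← hm]
    exact b.sum_repr x
  refine ⟨Fintype.card F, Fintype.card_ne_zero, fun N' hN' hd => ?_⟩
  have hk : ∀ x : F, N' • x = 0 := fun x => by
    obtain ⟨q, rfl⟩ := hd
    rw [mul_comm, mul_smul, card_nsmul_eq_zero, smul_zero]
  have e : (fun k : ι → ℤ => f (∑ i, (k i : ℚ) • b i)) = fun k => g ((φ.comp θ) k) := by
    ext k
    exact hf (θ k)
  rw [e]
  constructor
  · intro k k' hkk
    choose q hq using hkk
    have : k = k' + N' • q := by
      ext i
      have := hq i
      change k i = k' i + N' • q i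
      rw [nsmul_eq_mul]
      linarith
    simp only
    rw [this, map_add, map_nsmul, hk, add_zero]
  · exact avg_fin N' hN' hk (φ.comp θ) (hφ.comp hθ) g

lemma exists_basis (A : FractionalIdeal (𝓞 K)⁰ K) (hA : A ≠ 0) :
    ∃ b : Module.Basis (K →+* ℂ) ℚ K, ∀ x, x ∈ (A : Submodule (𝓞 K) K) ↔ ∀ i, ∃ m : ℤ, b.repr x i = m := by
  classical
  let I := Units.mk0 A hA
  let b0 := basisOfFractionalIdeal K I
  have hcard : Fintype.card (Module.Free.ChooseBasisIndex ℤ I) = Fintype.card (K →+* ℂ) := by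
    rw [← Module.finrank_eq_card_basis b0, NumberField.Embeddings.card]
  let e := Fintype.equivOfCardEq hcard
  have h0 : ∀ x, x ∈ (A : Submodule (𝓞 K) K) ↔ ∀ i, ∃ m : ℤ, b0.repr x i = m := by
    intro x
    have := mem_span_basisOfFractionalIdeal K (I := I) (x := x)
    rw [Module.Basis.mem_span_iff_repr_mem] at this
    refine Iff.trans ?_ (this.symm.trans ?_)
    · rfl
    · refine forall_congr' fun i => ?_
      simp only [Set.mem_range, algebraMap_int_eq, eq_intCast]
      exact ⟨fun ⟨m, h⟩ => ⟨m, h.symm⟩, fun ⟨m, h⟩ => ⟨m, h.symm⟩⟩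
  refine ⟨b0.reindex e, fun x => ?_⟩
  rw [h0]
  constructor
  · intro h i
    simpa using h (e.symm i)
  · intro h i
    simpa using h (e i)

lemma hasMean_unique (A : FractionalIdeal (𝓞 K)⁰ K) (hA : A ≠ 0) {f : K → ℂ} {μ μ' : ℂ}
    (h : HasMean (A : Submodule (𝓞 K) K) f μ) (h' : HasMean (A : Submodule (𝓞 K) K) f μ') : μ = μ' := by
  classical
  obtain ⟨b, hb⟩ := exists_basis A hA
  obtain ⟨N, hN, h1⟩ := avg_of_hasMean b _ hb h
  obtain ⟨N', hN', h2⟩ := avg_of_hasMean b _ hb h'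
  rw [← (h1 (N * N') (mul_ne_zero hN hN') (dvd_mul_right _ _)).2, (h2 (N * N') (mul_ne_zero hN hN') (dvd_mul_left _ _)).2]

/-- the standard additive character -/
noncomputable def psi (x : K) : ℂ := Complex.exp (2 * Real.pi * Complex.I * ((Algebra.trace ℚ K x : ℚ) : ℂ))

lemma psi_add (x y : K) : psi (x + y) = psi x * psi y := by
  simp only [psi, map_add, Rat.cast_add, mul_add, Complex.exp_add]

lemma psi_zero : psi (0 : K) = 1 := by simp [psi]

lemma psi_eq_one_iff (x : K) : psi x = 1 ↔ ∃ m : ℤ, Algebra.trace ℚ K x = m := by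
  rw [psi, Complex.exp_eq_one_iff]
  refine exists_congr fun m => ?_
  rw [mul_comm, mul_left_inj' Complex.two_pi_I_ne_zero]
  norm_cast

lemma psi_dual (A : FractionalIdeal (𝓞 K)⁰ K) (hA : A ≠ 0) (x : K) :
    x ∈ FractionalIdeal.dual ℤ ℚ A ↔ ∀ a ∈ A, psi (x * a) = 1 := by
  rw [FractionalIdeal.mem_dual hA]
  refine forall₂_congr fun a _ => ?_
  rw [psi_eq_one_iff]
  simp [Algebra.traceForm_apply, eq_comm]

lemma trace_eq (x : K) :
    ((Algebra.trace ℚ K x : ℚ) : ℝ) = ∑ v : K →+* ℂ, (v x).re := by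
  have h := trace_eq_sum_embeddings (K := ℚ) (L := K) ℂ (x := x)
  have h2 : ∑ σ : K →ₐ[ℚ] ℂ, σ x = ∑ v : K →+* ℂ, v x :=
    Fintype.sum_equiv (RingHom.equivRatAlgHom (R := K) (S := ℂ)).symm _ _ (fun σ => rfl)
  rw [h2] at h
  have h3 := congrArg Complex.re h
  rw [Complex.re_sum] at h3
  rw [← h3]
  simp


lemma real_emb (hK : ∀ φ : K →+* ℂ, ComplexEmbedding.IsReal φ) (v : K →+* ℂ) (x : K) :
    (((v x).re : ℝ) : ℂ) = v x := by
  have h := RingHom.congr_fun (ComplexEmbedding.isReal_iff.mp (hK v)) x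
  exact Complex.conj_eq_iff_re.mp h

theorem hecke_K (hK : ∀ φ : K →+* ℂ, ComplexEmbedding.IsReal φ) (c : K) (hc : c ≠ 0)
    (A : FractionalIdeal (𝓞 K)⁰ K) (hA : A ≠ 0) {μ μ' : ℂ}
    (h : HasMean (A : Submodule (𝓞 K) K) (fun x => psi (c * x ^ 2)) μ)
    (h' : HasMean (FractionalIdeal.dual ℤ ℚ A : Submodule (𝓞 K) K) (fun y => psi (-(y ^ 2 / (4 * c)))) μ') :
    ∃ q : ℝ, 0 < q ∧ μ = q * (∏ v : K →+* ℂ, ph (v c).re) * μ' := by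
  classical
  obtain ⟨b, hb⟩ := exists_basis A hA
  have hnd : (Algebra.traceForm ℚ K).Nondegenerate := traceForm_nondegenerate ℚ K
  let b' := (Algebra.traceForm ℚ K).dualBasis hnd b
  have hb' : ∀ x, x ∈ (FractionalIdeal.dual ℤ ℚ A : Submodule (𝓞 K) K) ↔ ∀ i, ∃ m : ℤ, b'.repr x i = m := by
    intro x
    have h1 : x ∈ (FractionalIdeal.dual ℤ ℚ A : Submodule (𝓞 K) K) ↔ x ∈ FractionalIdeal.dual ℤ ℚ A := Iff.rfl
    rw [h1, FractionalIdeal.mem_dual hA]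
    have h2 : ∀ i, b'.repr x i = Algebra.traceForm ℚ K x (b i) := fun i => by
      rw [LinearMap.BilinForm.dualBasis_repr_apply]
    constructor
    · intro hx i
      obtain ⟨m, hm⟩ := hx (b i) ((hb _).2 fun j => ⟨if i = j then 1 else 0, by
        rw [b.repr_self, Finsupp.single_apply]; split_ifs <;> simp⟩)
      exact ⟨m, by rw [h2, ← hm]; simp⟩
    · intro hx a ha
      choose m hm using hx
      choose k hk using (hb a).1 ha
      refine ⟨∑ i, k i * m i, ?_⟩
      conv_rhs => rw [← b.sum_repr a]
      rw [map_sum, map_sum]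
      refine Finset.sum_congr rfl fun i _ => ?_
      rw [LinearMap.map_smul, ← h2, hm, hk]
      simp
  obtain ⟨N, hN, h1⟩ := avg_of_hasMean b _ hb h
  obtain ⟨N', hN', h2⟩ := avg_of_hasMean b' _ hb' h'
  obtain ⟨h1, h1'⟩ := h1 N hN dvd_rfl
  obtain ⟨h2, h2'⟩ := h2 N' hN' dvd_rfl
  let M : Matrix (K →+* ℂ) (K →+* ℂ) ℝ := fun v i => (v (b i)).re
  let M' : Matrix (K →+* ℂ) (K →+* ℂ) ℝ := fun v i => (v (b' i)).re
  have hre : ∀ (v : K →+* ℂ) (x y : K), (v (x * y)).re = (v x).re * (v y).re := by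
    intro v x y
    rw [map_mul, ← real_emb hK v x, ← real_emb hK v y]
    simp
  have hMM : M.transpose * M' = 1 := by
    ext i j
    rw [Matrix.mul_apply, Matrix.one_apply]
    change ∑ v : K →+* ℂ, (v (b i)).re * (v (b' j)).re = _
    simp only [← hre]
    rw [← trace_eq]
    have := LinearMap.BilinForm.apply_dualBasis_right hnd (Algebra.traceForm_isSymm ℚ) b i j
    rw [Algebra.traceForm_apply] at this
    rw [this]
    split_ifs <;> simp
  have hdet : M.det ≠ 0 := by
    intro h0
    have := congrArg Matrix.det hMM
    rw [Matrix.det_mul, Matrix.det_transpose, h0] at this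
    simp at this
  have hM' : M⁻¹.transpose = M' := by
    rw [Matrix.transpose_nonsing_inv]
    exact Matrix.inv_eq_right_inv hMM
  have hmv : ∀ (β : Module.Basis (K →+* ℂ) ℚ K) (k : (K →+* ℂ) → ℤ) (v : K →+* ℂ),
      ((Matrix.mulVec (fun v i => (v (β i)).re : Matrix (K →+* ℂ) (K →+* ℂ) ℝ) (fun i => (k i : ℝ)) v : ℝ) : ℂ)
      = v (∑ i, (k i : ℚ) • β i) := by
    intro β k v
    rw [map_sum]
    simp only [Matrix.mulVec, dotProduct]
    push_cast
    refine Finset.sum_congr rfl fun i _ => ?_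
    rw [real_emb hK, Algebra.smul_def, map_mul]
    simp [mul_comm]
  have htr : ∀ x : K, ((Algebra.trace ℚ K x : ℚ) : ℂ) = ∑ v : K →+* ℂ, v x := by
    intro x
    have := congrArg (fun r : ℝ => (r : ℂ)) (trace_eq x)
    simp only [Complex.ofReal_sum, real_emb hK] at this
    simpa using this
  have e1 : (fun k : (K →+* ℂ) → ℤ => psi (c * (∑ i, (k i : ℚ) • b i) ^ 2)) =
      fun k => Complex.exp (2 * Real.pi * Complex.I * ∑ v : K →+* ℂ, (((v c).re : ℝ) : ℂ) * ((M.mulVec (fun i => (k i : ℝ)) v : ℝ) : ℂ)^2) := by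
    ext k
    rw [psi, htr]
    congr 2
    refine Finset.sum_congr rfl fun v _ => ?_
    rw [hmv b, real_emb hK, map_mul, map_pow]
  have e2 : (fun k : (K →+* ℂ) → ℤ => psi (-((∑ i, (k i : ℚ) • b' i) ^ 2 / (4 * c)))) =
      fun k => Complex.exp (-(2 * Real.pi * Complex.I * ∑ v : K →+* ℂ, ((M⁻¹.transpose.mulVec (fun i => (k i : ℝ)) v : ℝ) : ℂ)^2 / (4 * (((v c).re : ℝ) : ℂ)))) := by
    ext k
    rw [psi, htr, hM', ← mul_neg, ← Finset.sum_neg_distrib]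
    congr 2
    refine Finset.sum_congr rfl fun v _ => ?_
    rw [hmv b', real_emb hK, map_neg, map_div₀, map_mul, map_pow, map_ofNat]
  rw [e1] at h1 h1'
  rw [e2] at h2 h2'
  obtain ⟨q, hq, hh⟩ := hecke_abs M hdet (fun v : K →+* ℂ => (v c).re) (fun v h0 => by
    have := real_emb hK v c
    rw [h0] at this
    exact hc ((map_eq_zero v).1 (by simpa using this.symm))) N N' hN hN' h1 h2
  exact ⟨q, hq, by rw [← h1', ← h2']; exact hh⟩

end CN
end

section
open MeasureTheory Filter Topology
namespace CN
open NumberField nonZeroDivisors FractionalIdeal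

universe u
variable {K : Type u} [Field K] [NumberField K]

/-- the inverse different -/
noncomputable abbrev Dinv (K : Type u) [Field K] [NumberField K] : FractionalIdeal (𝓞 K)⁰ K := dual ℤ ℚ 1

lemma psi_of_mem {x : K} (hx : x ∈ Dinv K) : psi x = 1 := by
  have := (psi_dual (1 : FractionalIdeal (𝓞 K)⁰ K) one_ne_zero x).1 hx 1 (one_mem_one _)
  simpa using this

lemma mem_Dinv {x : K} (h : ∀ r : 𝓞 K, psi (x * r) = 1) : x ∈ Dinv K := by
  refine (psi_dual (1 : FractionalIdeal (𝓞 K)⁰ K) one_ne_zero x).2 fun a ha => ?_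
  obtain ⟨r, rfl⟩ := (mem_one_iff _).1 ha
  exact h r

lemma spanSingleton_mul_le {x : K} {I J : FractionalIdeal (𝓞 K)⁰ K} (h : spanSingleton (𝓞 K)⁰ x * I ≤ J) {y : K}
    (hy : y ∈ I) : x * y ∈ J :=
  h (mul_mem_mul (mem_spanSingleton_self _ _) hy)

lemma le_ideal {B : FractionalIdeal (𝓞 K)⁰ K} (hB0 : B ≠ 0) (n : Ideal (𝓞 K)) (r : 𝓞 K)
    (h : spanSingleton (𝓞 K)⁰ (r : K) * B ≤ (n : FractionalIdeal (𝓞 K)⁰ K) * B) : r ∈ n := by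
  have h1 : spanSingleton (𝓞 K)⁰ (r : K) ≤ (n : FractionalIdeal (𝓞 K)⁰ K) := by
    have := mul_le_mul_left h B⁻¹
    rwa [mul_assoc, mul_assoc, mul_inv_cancel₀ hB0, mul_one, mul_one] at this
  have h2 := (spanSingleton_le_iff_mem).1 h1
  obtain ⟨s, hs, hsr⟩ := (mem_coeIdeal _).1 h2
  rwa [← RingOfIntegers.ext hsr]

lemma mem_split {B C : FractionalIdeal (𝓞 K)⁰ K} {j : K} (h : B ≤ spanSingleton (𝓞 K)⁰ j + C) {x : K} (hx : x ∈ B) :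
    ∃ r : 𝓞 K, x - r * j ∈ C := by
  obtain ⟨a, ha, b, hb, rfl⟩ := (mem_add _ _ _).1 (h hx)
  obtain ⟨r, rfl⟩ := (mem_spanSingleton _).1 ha
  exact ⟨r, by rw [Algebra.smul_def]; simpa using hb⟩

lemma lemL (B : FractionalIdeal (𝓞 K)⁰ K) (hB0 : B ≠ 0) (n : Ideal (𝓞 K)) [Fintype (𝓞 K ⧸ n)] (j : K) (hj : j ∈ B)
    (hB : B ≤ spanSingleton (𝓞 K)⁰ j + n * B) (κ : K) (hκ : spanSingleton (𝓞 K)⁰ κ * (B * (n * B)) ≤ Dinv K) :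
    ∃ Ψ : AddChar (𝓞 K ⧸ n) ℂ, (∀ r : 𝓞 K, Ψ (Ideal.Quotient.mk n r) = psi (κ * j ^ 2 * r)) ∧
      HasMean (B : Submodule (𝓞 K) K) (fun x => psi (κ * x ^ 2)) ((Fintype.card (𝓞 K ⧸ n) : ℂ)⁻¹ * ∑ r, Ψ (r ^ 2)) := by
  have hnB : (n : FractionalIdeal (𝓞 K)⁰ K) * B ≤ B := by
    calc (n : FractionalIdeal (𝓞 K)⁰ K) * B ≤ 1 * B := mul_le_mul_left coeIdeal_le_one B
      _ = B := one_mul B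
  have hsm : ∀ (I : FractionalIdeal (𝓞 K)⁰ K) (r : 𝓞 K) (x : K), x ∈ I → (r : K) * x ∈ I := by
    intro I r x hx
    have := (I : Submodule (𝓞 K) K).smul_mem r hx
    rwa [Algebra.smul_def] at this
  have hone : ∀ x y : K, x ∈ B → y ∈ (n : FractionalIdeal (𝓞 K)⁰ K) * B → psi (κ * (x * y)) = 1 := fun x y hx hy =>
    psi_of_mem (spanSingleton_mul_le hκ (mul_mem_mul hx hy))
  have hwd : ∀ r s : 𝓞 K, Ideal.Quotient.mk n r = Ideal.Quotient.mk n s → psi (κ * j ^ 2 * r) = psi (κ * j ^ 2 * s) := by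
    intro r s hrs
    have h1 := Ideal.Quotient.eq.1 hrs
    have h2 : psi (κ * (j * (((r - s : 𝓞 K) : K) * j))) = 1 :=
      hone _ _ hj (mul_mem_mul (mem_coeIdeal_of_mem _ h1) hj)
    have h3 : κ * j ^ 2 * r = κ * j ^ 2 * s + κ * (j * (((r - s : 𝓞 K) : K) * j)) := by
      push_cast; ring
    rw [h3, psi_add, h2, mul_one]
  let Ψ : AddChar (𝓞 K ⧸ n) ℂ :=
    { toFun := fun q => psi (κ * j ^ 2 * (Quotient.out q : 𝓞 K))
      map_zero_eq_one' := by
        rw [hwd _ 0 (by rw [map_zero]; exact Quotient.out_eq _)]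
        simp [psi_zero]
      map_add_eq_mul' := fun q q' => by
        rw [← psi_add, ← mul_add]
        have := hwd (Quotient.out (q + q')) (Quotient.out q + Quotient.out q') (by
          rw [map_add]
          refine (Quotient.out_eq (q + q')).trans ?_
          congr 1
          · exact (Quotient.out_eq q).symm
          · exact (Quotient.out_eq q').symm)
        rw [this]
        push_cast
        rfl }
  have hΨ : ∀ r : 𝓞 K, Ψ (Ideal.Quotient.mk n r) = psi (κ * j ^ 2 * r) := fun r =>
    hwd _ _ (Quotient.out_eq _)
  refine ⟨Ψ, hΨ, ?_⟩
  have hex : ∀ x : (B : Submodule (𝓞 K) K), ∃ r : 𝓞 K, (x : K) - r * j ∈ (n : FractionalIdeal (𝓞 K)⁰ K) * B :=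
    fun x => mem_split hB x.2
  choose ρ hρ using hex
  have hker : ∀ r : 𝓞 K, (r : K) * j ∈ (n : FractionalIdeal (𝓞 K)⁰ K) * B → r ∈ n := by
    intro r hr
    refine le_ideal hB0 n r ?_
    rw [mul_le]
    rintro x hx y hy
    obtain ⟨t, rfl⟩ := (mem_spanSingleton _).1 hx
    obtain ⟨s, hs⟩ := mem_split hB hy
    have : t • (r : K) * y = (t : K) * ((s : K) * (r * j) + r * (y - s * j)) := by
      rw [Algebra.smul_def]; ring
    rw [this]
    refine hsm _ _ _ ?_
    exact (((n : FractionalIdeal (𝓞 K)⁰ K) * B : FractionalIdeal (𝓞 K)⁰ K) : Submodule (𝓞 K) K).add_mem (hsm _ _ _ hr) (hsm _ _ _ hs)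
  have hsub : ∀ x y : K, x ∈ (n : FractionalIdeal (𝓞 K)⁰ K) * B → y ∈ (n : FractionalIdeal (𝓞 K)⁰ K) * B → x - y ∈ (n : FractionalIdeal (𝓞 K)⁰ K) * B :=
    fun x y hx hy => (((n : FractionalIdeal (𝓞 K)⁰ K) * B : FractionalIdeal (𝓞 K)⁰ K) : Submodule (𝓞 K) K).sub_mem hx hy
  have huniq : ∀ (x : (B : Submodule (𝓞 K) K)) (r : 𝓞 K), (x : K) - r * j ∈ (n : FractionalIdeal (𝓞 K)⁰ K) * B →
      Ideal.Quotient.mk n (ρ x) = Ideal.Quotient.mk n r := by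
    intro x r hr
    rw [Ideal.Quotient.eq]
    apply hker
    have := hsub _ _ hr (hρ x)
    push_cast
    convert this using 1
    ring
  have hadd : ∀ x y : K, x ∈ (n : FractionalIdeal (𝓞 K)⁰ K) * B → y ∈ (n : FractionalIdeal (𝓞 K)⁰ K) * B → x + y ∈ (n : FractionalIdeal (𝓞 K)⁰ K) * B :=
    fun x y hx hy => (((n : FractionalIdeal (𝓞 K)⁰ K) * B : FractionalIdeal (𝓞 K)⁰ K) : Submodule (𝓞 K) K).add_mem hx hy
  have hzero : (0 : K) ∈ (n : FractionalIdeal (𝓞 K)⁰ K) * B := (((n : FractionalIdeal (𝓞 K)⁰ K) * B : FractionalIdeal (𝓞 K)⁰ K) : Submodule (𝓞 K) K).zero_mem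
  let φ : (B : Submodule (𝓞 K) K) →+ (𝓞 K ⧸ n) :=
    { toFun := fun x => Ideal.Quotient.mk n (ρ x)
      map_zero' := by
        rw [huniq 0 0 (by simpa using hzero), map_zero]
      map_add' := fun x y => by
        rw [huniq (x + y) (ρ x + ρ y) (by
          have := hadd _ _ (hρ x) (hρ y)
          push_cast
          convert this using 1
          ring), map_add] }
  refine ⟨𝓞 K ⧸ n, inferInstance, inferInstance, φ, fun r => Ψ (r ^ 2), ?_, ?_, rfl⟩
  · intro q
    obtain ⟨r, rfl⟩ := Ideal.Quotient.mk_surjective q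
    refine ⟨⟨r * j, hsm _ _ _ hj⟩, huniq _ _ ?_⟩
    simpa using hzero
  · intro x
    change _ = Ψ ((Ideal.Quotient.mk n (ρ x)) ^ 2)
    rw [← map_pow, hΨ]
    have hx := hρ x
    set t := (x : K) - ρ x * j with ht
    have h3 : κ * (x : K) ^ 2 = κ * j ^ 2 * ((ρ x ^ 2 : 𝓞 K) : K) + κ * ((ρ x * j + x) * t) := by
      push_cast; rw [ht]; ring
    change psi (κ * (x : K) ^ 2) = _
    rw [h3, psi_add, hone _ _ _ hx, mul_one]
    exact (B : Submodule (𝓞 K) K).add_mem (hsm _ _ _ hj) x.2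

lemma lemPrim (B : FractionalIdeal (𝓞 K)⁰ K) (hB0 : B ≠ 0) (n : Ideal (𝓞 K)) (j : K) (hj : j ∈ B)
    (hB : B ≤ spanSingleton (𝓞 K)⁰ j + n * B) (κ : K) (hκ0 : κ ≠ 0) (hκ : spanSingleton (𝓞 K)⁰ κ * (B * (n * B)) = Dinv K)
    (Ψ : AddChar (𝓞 K ⧸ n) ℂ) (hΨ : ∀ r : 𝓞 K, Ψ (Ideal.Quotient.mk n r) = psi (κ * j ^ 2 * r))
    (u : 𝓞 K ⧸ n) (hu : ∀ r, Ψ (u * r) = 1) : u = 0 := by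
  obtain ⟨s, rfl⟩ := Ideal.Quotient.mk_surjective u
  have hsm : ∀ (I : FractionalIdeal (𝓞 K)⁰ K) (r : 𝓞 K) (x : K), x ∈ I → (r : K) * x ∈ I := by
    intro I r x hx
    have := (I : Submodule (𝓞 K) K).smul_mem r hx
    rwa [Algebra.smul_def] at this
  have hnB : (n : FractionalIdeal (𝓞 K)⁰ K) * B ≤ B := by
    calc (n : FractionalIdeal (𝓞 K)⁰ K) * B ≤ 1 * B := mul_le_mul_left coeIdeal_le_one B
      _ = B := one_mul B
  have h1 : κ * j ^ 2 * s ∈ Dinv K := mem_Dinv fun r => by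
    have := hu (Ideal.Quotient.mk n r)
    rw [← map_mul, hΨ] at this
    rw [← this]
    push_cast
    ring_nf
  rw [Ideal.Quotient.eq_zero_iff_mem]
  have h2 : spanSingleton (𝓞 K)⁰ (s : K) * (spanSingleton (𝓞 K)⁰ κ * (B * B)) ≤ (n : FractionalIdeal (𝓞 K)⁰ K) * (spanSingleton (𝓞 K)⁰ κ * (B * B)) := by
    have e : (n : FractionalIdeal (𝓞 K)⁰ K) * (spanSingleton (𝓞 K)⁰ κ * (B * B)) = Dinv K := by
      rw [← hκ]; ring
    rw [e, ← mul_assoc, spanSingleton_mul_spanSingleton, mul_comm, mul_assoc, mul_le]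
    intro x hx y hy
    rw [mul_comm B] at hy
    obtain ⟨r, hr⟩ := mem_split hB hx
    have h3 : ∀ y ∈ spanSingleton (𝓞 K)⁰ ((s : K) * κ) * B, x * y ∈ Dinv K := by
      intro y hy
      obtain ⟨z, hz, rfl⟩ := mem_singleton_mul.1 hy
      obtain ⟨t, ht⟩ := mem_split hB hz
      have e2 : x * ((s : K) * κ * z) = ((r * t : 𝓞 K) : K) * (κ * j ^ 2 * s)
         + ((s : K) * (κ * ((r * j) * (z - t * j))) + (s : K) * (κ * (z * (x - r * j)))) := by
        push_cast; ring
      rw [e2]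
      have hD : ∀ p q, p ∈ B → q ∈ (n : FractionalIdeal (𝓞 K)⁰ K) * B → (s : K) * (κ * (p * q)) ∈ Dinv K := fun p q hp hq =>
        hsm _ _ _ (spanSingleton_mul_le hκ.le (mul_mem_mul hp hq))
      exact (Dinv K : Submodule (𝓞 K) K).add_mem (hsm _ _ _ h1) ((Dinv K : Submodule (𝓞 K) K).add_mem
        (hD _ _ (hsm _ _ _ hj) ht) (hD _ _ hz hr))
    exact h3 y hy
  exact le_ideal (mul_ne_zero (spanSingleton_ne_zero_iff.2 hκ0) (mul_ne_zero hB0 hB0)) n s h2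

lemma enlarge (A : FractionalIdeal (𝓞 K)⁰ K) (n s : Ideal (𝓞 K)) (hs : s ≠ ⊥) (hc : s ⊔ n = ⊤) (j : K) (hj : j ∈ A)
    (hA : A ≤ spanSingleton (𝓞 K)⁰ j + n * A) :
    j ∈ A * (s : FractionalIdeal (𝓞 K)⁰ K)⁻¹ ∧
      A * (s : FractionalIdeal (𝓞 K)⁰ K)⁻¹ ≤ spanSingleton (𝓞 K)⁰ j + n * (A * (s : FractionalIdeal (𝓞 K)⁰ K)⁻¹) := by
  have hs0 : (s : FractionalIdeal (𝓞 K)⁰ K) ≠ 0 := coeIdeal_ne_zero.2 hs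
  have h1 : A ≤ A * (s : FractionalIdeal (𝓞 K)⁰ K)⁻¹ := by
    calc A = A * ((s : FractionalIdeal (𝓞 K)⁰ K) * (s : FractionalIdeal (𝓞 K)⁰ K)⁻¹) := by rw [mul_inv_cancel₀ hs0, mul_one]
      _ ≤ A * (1 * (s : FractionalIdeal (𝓞 K)⁰ K)⁻¹) := by gcongr; exact coeIdeal_le_one
      _ = _ := by rw [one_mul]
  refine ⟨h1 hj, ?_⟩
  have h2 : (1 : FractionalIdeal (𝓞 K)⁰ K) = s + n := by
    rw [← coeIdeal_sup, hc, coeIdeal_top]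
  calc A * (s : FractionalIdeal (𝓞 K)⁰ K)⁻¹ = A * (s : FractionalIdeal (𝓞 K)⁰ K)⁻¹ * (s + n) := by rw [← h2, mul_one]
    _ = A + n * (A * (s : FractionalIdeal (𝓞 K)⁰ K)⁻¹) := by
      rw [mul_add, mul_assoc, inv_mul_cancel₀ hs0, mul_one, mul_comm (n : FractionalIdeal (𝓞 K)⁰ K)]
    _ ≤ (spanSingleton (𝓞 K)⁰ j + n * A) + n * (A * (s : FractionalIdeal (𝓞 K)⁰ K)⁻¹) := by gcongr
    _ ≤ (spanSingleton (𝓞 K)⁰ j + n * (A * (s : FractionalIdeal (𝓞 K)⁰ K)⁻¹)) + n * (A * (s : FractionalIdeal (𝓞 K)⁰ K)⁻¹) := by gcongr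
    _ ≤ _ := by
      rw [add_assoc, ← sup_eq_add ((n : FractionalIdeal (𝓞 K)⁰ K) * (A * (s : FractionalIdeal (𝓞 K)⁰ K)⁻¹)), sup_idem]

end CN
end

section
open MeasureTheory Filter Topology
namespace CN
open NumberField nonZeroDivisors FractionalIdeal

universe u
variable {K : Type u} [Field K] [NumberField K]

theorem lemHG (hK : ∀ φ : K →+* ℂ, ComplexEmbedding.IsReal φ) (c : K) (hc : c ≠ 0)
    (J : FractionalIdeal (𝓞 K)⁰ K) (hJ0 : J ≠ 0) (m : Ideal (𝓞 K)) (hm : m ≠ ⊥)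
    (hJ : spanSingleton (𝓞 K)⁰ c * (J * (m * J)) = Dinv K)
    (j0 : K) (hj0 : j0 ∈ m * J) (hj0' : m * J ≤ spanSingleton (𝓞 K)⁰ j0 + (Ideal.span {4} : Ideal (𝓞 K)) * (m * J))
    (p : Ideal (𝓞 K)) (hp : p ≠ ⊥)
    (j : K) (hj : j ∈ J * (p : FractionalIdeal (𝓞 K)⁰ K)⁻¹)
    (hj' : J * (p : FractionalIdeal (𝓞 K)⁰ K)⁻¹ ≤ spanSingleton (𝓞 K)⁰ j + (m * p : Ideal (𝓞 K)) * (J * (p : FractionalIdeal (𝓞 K)⁰ K)⁻¹))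
    (g : 𝓞 K) (s : Ideal (𝓞 K)) (hs : s ≠ ⊥) (hg : Ideal.span {g} = p * s ^ 2)
    (hs2 : s ⊔ Ideal.span {4} = ⊤) (hsm : s ⊔ m * p = ⊤)
    [Fintype (𝓞 K ⧸ m * p)] [Fintype (𝓞 K ⧸ (Ideal.span {4} : Ideal (𝓞 K)))] :
    ∃ (Ψ : AddChar (𝓞 K ⧸ m * p) ℂ) (χ : AddChar (𝓞 K ⧸ (Ideal.span {4} : Ideal (𝓞 K))) ℂ) (q : ℝ),
      0 < q ∧ (∀ r : 𝓞 K, Ψ (Ideal.Quotient.mk _ r) = psi (c * g * j ^ 2 * r)) ∧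
      (∀ u, (∀ r, Ψ (u * r) = 1) → u = 0) ∧
      (∀ r : 𝓞 K, χ (Ideal.Quotient.mk _ r) = psi (-(c * g * j0 ^ 2 * r / 4))) ∧
      ∑ r, Ψ (r ^ 2) = q * (∏ v : K →+* ℂ, ph (v (c * g)).re) * ∑ r, χ (r ^ 2) := by
  have hg0 : (g : K) ≠ 0 := by
    intro h
    have : g = 0 := RingOfIntegers.ext h
    have h5 : p * s ^ 2 = 0 := by rw [← hg, this]; simp
    rcases mul_eq_zero.1 h5 with h | h
    · exact hp h
    · exact hs ((pow_eq_zero_iff two_ne_zero).1 h)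
  have hm0 : (m : FractionalIdeal (𝓞 K)⁰ K) ≠ 0 := coeIdeal_ne_zero.2 hm
  have hp0 : (p : FractionalIdeal (𝓞 K)⁰ K) ≠ 0 := coeIdeal_ne_zero.2 hp
  have hs0 : (s : FractionalIdeal (𝓞 K)⁰ K) ≠ 0 := coeIdeal_ne_zero.2 hs
  set κ : K := c * g with hκ
  have hκ0 : κ ≠ 0 := mul_ne_zero hc hg0
  have hSg : spanSingleton (𝓞 K)⁰ (g : K) = p * s ^ 2 := by
    rw [← coeIdeal_pow, ← coeIdeal_mul, ← hg, coeIdeal_span_singleton]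
  have hSκ : spanSingleton (𝓞 K)⁰ κ = spanSingleton (𝓞 K)⁰ c * (p * s ^ 2) := by
    rw [hκ, ← spanSingleton_mul_spanSingleton, hSg]
  set A := J * (p : FractionalIdeal (𝓞 K)⁰ K)⁻¹ with hA
  have hA0 : A ≠ 0 := mul_ne_zero hJ0 (inv_ne_zero hp0)
  set B := A * (s : FractionalIdeal (𝓞 K)⁰ K)⁻¹ with hBdef
  have hB0 : B ≠ 0 := mul_ne_zero hA0 (inv_ne_zero hs0)
  obtain ⟨hjB, hB⟩ := enlarge A (m * p) s hs hsm j hj hj'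
  have hκB : spanSingleton (𝓞 K)⁰ κ * (B * ((m * p : Ideal (𝓞 K)) * B)) = Dinv K := by
    rw [← hJ, hSκ, coeIdeal_mul, hBdef, hA]
    field_simp
  obtain ⟨Ψ, hΨ, hmean⟩ := lemL B hB0 (m * p) j hjB hB κ hκB.le
  have hprim := lemPrim B hB0 (m * p) j hjB hB κ hκ0 hκB Ψ hΨ
  -- dual side
  set W := m * J with hW
  set W' := W * (s : FractionalIdeal (𝓞 K)⁰ K)⁻¹ with hW'
  have hW0 : W' ≠ 0 := mul_ne_zero (mul_ne_zero hm0 hJ0) (inv_ne_zero hs0)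
  obtain ⟨hj0W, hW4⟩ := enlarge W (Ideal.span {4}) s hs hs2 j0 hj0 hj0'
  have hdual : dual ℤ ℚ B = spanSingleton (𝓞 K)⁰ κ * W' := by
    rw [dual_eq_mul_inv]
    change Dinv K * B⁻¹ = _
    rw [← hJ, hSκ, hW', hBdef, hA, hW]
    field_simp
  have h4 : (4 : K) ≠ 0 := by norm_num
  have hS4 : ((Ideal.span {4} : Ideal (𝓞 K)) : FractionalIdeal (𝓞 K)⁰ K) = spanSingleton (𝓞 K)⁰ (4 : K) := by
    rw [coeIdeal_span_singleton, map_ofNat]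
  have hd0 : dual ℤ ℚ B ≠ 0 := by
    rw [hdual]; exact mul_ne_zero (spanSingleton_ne_zero_iff.2 hκ0) hW0
  have hjd : κ * j0 ∈ dual ℤ ℚ B := by
    rw [hdual]; exact mul_mem_mul (mem_spanSingleton_self _ _) hj0W
  have hsd : dual ℤ ℚ B ≤ spanSingleton (𝓞 K)⁰ (κ * j0) + (Ideal.span {4} : Ideal (𝓞 K)) * dual ℤ ℚ B := by
    rw [hdual]
    calc spanSingleton (𝓞 K)⁰ κ * W' ≤ spanSingleton (𝓞 K)⁰ κ * (spanSingleton (𝓞 K)⁰ j0 + (Ideal.span {4} : Ideal (𝓞 K)) * W') := by gcongr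
      _ = _ := by
        have e0 : spanSingleton (𝓞 K)⁰ (κ * j0) = spanSingleton (𝓞 K)⁰ κ * spanSingleton (𝓞 K)⁰ j0 :=
          (spanSingleton_mul_spanSingleton ..).symm
        rw [e0, mul_add, mul_left_comm]
  have hκd : spanSingleton (𝓞 K)⁰ (-(1 / (4 * κ))) * (dual ℤ ℚ B * ((Ideal.span {4} : Ideal (𝓞 K)) * dual ℤ ℚ B)) ≤ Dinv K := by
    have e1 : spanSingleton (𝓞 K)⁰ (-(1 / (4 * κ))) * (dual ℤ ℚ B * ((Ideal.span {4} : Ideal (𝓞 K)) * dual ℤ ℚ B))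
      = (spanSingleton (𝓞 K)⁰ (-(1 / (4 * κ))) * spanSingleton (𝓞 K)⁰ (4 : K) * spanSingleton (𝓞 K)⁰ κ) * (spanSingleton (𝓞 K)⁰ κ * (W' * W')) := by
      rw [hS4, hdual]; ring
    have e2 : spanSingleton (𝓞 K)⁰ (-(1 / (4 * κ))) * spanSingleton (𝓞 K)⁰ (4 : K) * spanSingleton (𝓞 K)⁰ κ = 1 := by
      rw [spanSingleton_mul_spanSingleton, spanSingleton_mul_spanSingleton]
      have : -(1 / (4 * κ)) * 4 * κ = -1 := by field_simp
      rw [this, ← spanSingleton_one]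
      apply le_antisymm
      · rw [spanSingleton_le_iff_mem, mem_spanSingleton]
        exact ⟨-1, by simp⟩
      · rw [spanSingleton_le_iff_mem, mem_spanSingleton]
        exact ⟨-1, by simp⟩
    have e3 : spanSingleton (𝓞 K)⁰ κ * (W' * W') = Dinv K * (p * m : Ideal (𝓞 K)) := by
      rw [← hJ, hSκ, hW', hW, coeIdeal_mul]
      field_simp
    rw [e1, e2, one_mul, e3]
    calc Dinv K * (p * m : Ideal (𝓞 K)) ≤ Dinv K * 1 := by gcongr; exact coeIdeal_le_one
      _ = _ := mul_one _
  obtain ⟨χ, hχ, hmean'⟩ := lemL (dual ℤ ℚ B) hd0 (Ideal.span {4}) (κ * j0) hjd hsd _ hκd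
  have hfun : (fun x : K => psi (-(1 / (4 * κ)) * x ^ 2)) = fun y => psi (-(y ^ 2 / (4 * κ))) := by
    ext y; congr 1; ring
  rw [hfun] at hmean'
  obtain ⟨q, hq, hh⟩ := hecke_K hK κ hκ0 B hB0 hmean hmean'
  refine ⟨Ψ, χ, q * ((Fintype.card (𝓞 K ⧸ (Ideal.span {4} : Ideal (𝓞 K))) : ℝ))⁻¹ * Fintype.card (𝓞 K ⧸ m * p), ?_, hΨ, hprim, ?_, ?_⟩
  · have : (0 : ℝ) < Fintype.card (𝓞 K ⧸ m * p) := by exact_mod_cast Fintype.card_pos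
    have : (0 : ℝ) < Fintype.card (𝓞 K ⧸ (Ideal.span {4} : Ideal (𝓞 K))) := by exact_mod_cast Fintype.card_pos
    positivity
  · intro r
    rw [hχ]
    congr 1
    field_simp
  · have h1 : (Fintype.card (𝓞 K ⧸ m * p) : ℂ) ≠ 0 := by exact_mod_cast Fintype.card_ne_zero
    rw [inv_mul_eq_iff_eq_mul₀ h1] at hh
    rw [hh]
    push_cast
    ring

end CN
end

section
open MeasureTheory Filter Topology
namespace CN
open NumberField nonZeroDivisors FractionalIdeal

universe u
variable {K : Type u} [Field K] [NumberField K]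

lemma exists_gen (B : FractionalIdeal (𝓞 K)⁰ K) (hB : B ≠ 0) (n : Ideal (𝓞 K)) (hn : n ≠ ⊥) :
    ∃ j ∈ B, B ≤ spanSingleton (𝓞 K)⁰ j + n * B := by
  have hn0 : (n : FractionalIdeal (𝓞 K)⁰ K) ≠ 0 := coeIdeal_ne_zero.2 hn
  have hle : n * B ≤ B := by
    calc n * B ≤ 1 * B := by gcongr; exact coeIdeal_le_one
      _ = B := one_mul _
  obtain ⟨x, hx⟩ := IsDedekindDomain.exists_add_spanSingleton_mul_eq hle (mul_ne_zero hn0 hB)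
    (one_ne_zero : (1 : FractionalIdeal (𝓞 K)⁰ K) ≠ 0)
  rw [mul_one] at hx
  refine ⟨x, ?_, ?_⟩
  · rw [← spanSingleton_le_iff_mem, ← hx]
    exact le_add_of_nonneg_left (by simp)
  · rw [add_comm, hx]

/-- moving lemma -/
lemma moving {R : Type*} [CommRing R] [IsDedekindDomain R] (I b : Ideal R) (hI : I ≠ ⊥) (hb : b ≠ ⊥) :
    ∃ (A : Ideal R) (x y : R), A ≠ ⊥ ∧ A ⊔ b = ⊤ ∧ x ≠ 0 ∧ y ≠ 0 ∧ Ideal.span {x} * A = Ideal.span {y} * I := by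
  obtain ⟨y, hyI, hy0⟩ := Submodule.exists_mem_ne_zero_of_ne_bot hI
  obtain ⟨H, hH⟩ : I ∣ Ideal.span {y} := Ideal.dvd_iff_le.2 ((Ideal.span_singleton_le_iff_mem _).2 hyI)
  have hy' : Ideal.span {y} ≠ ⊥ := by simpa using hy0
  have hH0 : H ≠ ⊥ := by rintro rfl; exact hy' (by rw [hH]; simp)
  obtain ⟨h, hh⟩ := IsDedekindDomain.exists_sup_span_eq (I := H * b) (J := H) Ideal.mul_le_left (mul_ne_zero hH0 hb)
  obtain ⟨A, hA⟩ : H ∣ Ideal.span {h} := Ideal.dvd_iff_le.2 (by rw [← hh]; exact le_sup_right)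
  have hAb : A ⊔ b = ⊤ := by
    rw [hA, ← Ideal.mul_sup, sup_comm] at hh
    exact mul_left_cancel₀ (a := H) (show H ≠ 0 from hH0) (by rw [hh]; simp)
  -- maybe h = 0 only if A = bot, b = top
  by_cases hh0 : h = 0
  · have hA0 : A = ⊥ := by
      rw [hh0] at hA
      have : H * A = 0 := by rw [← hA]; simp
      exact (mul_eq_zero.1 this).resolve_left hH0
    rw [hA0] at hAb
    refine ⟨I, 1, 1, hI, ?_, ?_, ?_, rfl⟩
    · rw [show b = ⊤ by simpa using hAb]; simp
    · rintro h1
      exact hI ((eq_bot_iff).2 fun t _ => by rw [← mul_one t, h1, mul_zero]; simp)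
    · rintro h1
      exact hI ((eq_bot_iff).2 fun t _ => by rw [← mul_one t, h1, mul_zero]; simp)
  · refine ⟨A, y, h, ?_, hAb, hy0, hh0, ?_⟩
    · rintro rfl; apply hh0; simpa using hA
    · rw [hH, hA]; ring

lemma squarefree_part {R : Type*} [CommRing R] [IsDedekindDomain R] (A : Ideal R) (hA : A ≠ ⊥) :
    ∃ (S : Finset (Ideal R)) (J : Ideal R), (∀ P ∈ S, Prime P ∧ A ≤ P) ∧ J ≠ ⊥ ∧ A = (∏ P ∈ S, P) * J ^ 2 := by
  classical
  revert hA
  refine UniqueFactorizationMonoid.induction_on_prime A ?_ ?_ ?_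
  · intro h; exact absurd rfl h
  · intro x hx _
    refine ⟨∅, ⊤, by simp, ?_, ?_⟩
    · rintro h
      apply not_isUnit_zero (M₀ := Ideal R)
      rw [Ideal.zero_eq_bot, ← h, ← Ideal.one_eq_top]
      exact isUnit_one
    · have := Ideal.isUnit_iff.1 hx
      rw [this]; simp [Ideal.top_pow]
  · intro A P hA hP ih _
    obtain ⟨S, J, hS, hJ, h⟩ := ih hA
    by_cases hPS : P ∈ S
    · refine ⟨S.erase P, J * P, ?_, mul_ne_zero hJ hP.ne_zero, ?_⟩
      · intro Q hQ
        have := hS Q (Finset.mem_of_mem_erase hQ)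
        exact ⟨this.1, Ideal.mul_le_right.trans this.2⟩
      · conv_lhs => rw [h, ← Finset.mul_prod_erase _ _ hPS]
        ring
    · refine ⟨insert P S, J, ?_, hJ, ?_⟩
      · intro Q hQ
        rcases Finset.mem_insert.1 hQ with rfl | hQ
        · exact ⟨hP, Ideal.mul_le_left⟩
        · exact ⟨(hS Q hQ).1, Ideal.mul_le_right.trans (hS Q hQ).2⟩
      · rw [Finset.prod_insert hPS]
        conv_lhs => rw [h]
        ring

open Classical in
noncomputable def chi (P : Ideal (𝓞 K)) (a : 𝓞 K) : ℂ := if IsSquare (Ideal.Quotient.mk P a) then 1 else -1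

lemma chi_sq (P : Ideal (𝓞 K)) (a : 𝓞 K) : chi P a * chi P a = 1 := by
  unfold chi; split_ifs <;> norm_num

lemma gauss_ideal (S : Finset (Ideal (𝓞 K))) (hS : ∀ P ∈ S, Prime P ∧ (2 : 𝓞 K) ∉ P) (M : Ideal (𝓞 K))
    (hM : M = ∏ P ∈ S, P) [Fintype (𝓞 K ⧸ M)] (ψ : AddChar (𝓞 K ⧸ M) ℂ)
    (hψ : ∀ u, (∀ r, ψ (u * r) = 1) → u = 0) :
    (∑ x, ψ (x ^ 2) ≠ 0) ∧ ∀ a : 𝓞 K, (∀ P ∈ S, a ∉ P) →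
      ∑ x, ψ (Ideal.Quotient.mk M a * x ^ 2) = (∏ P ∈ S, chi P a) * ∑ x, ψ (x ^ 2) := by
  classical
  have hmax : ∀ P : S, (P : Ideal (𝓞 K)).IsMaximal := fun P =>
    (Ideal.isPrime_of_prime (hS P P.2).1).isMaximal (hS P P.2).1.ne_zero
  letI hF : ∀ P : S, Field (𝓞 K ⧸ (P : Ideal (𝓞 K))) := fun P =>
    haveI := hmax P
    Ideal.Quotient.field (P : Ideal (𝓞 K))
  haveI hfin : ∀ P : S, Finite (𝓞 K ⧸ (P : Ideal (𝓞 K))) := fun P =>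
    Ideal.finiteQuotientOfFreeOfNeBot _ (hS P P.2).1.ne_zero
  letI : ∀ P : S, Fintype (𝓞 K ⧸ (P : Ideal (𝓞 K))) := fun P => Fintype.ofFinite _
  have hle : ∀ P : S, M ≤ P := fun P => by
    rw [hM]; exact Ideal.prod_le_inf.trans (Finset.inf_le P.2)
  let e : (𝓞 K ⧸ M) →+* ∀ P : S, 𝓞 K ⧸ (P : Ideal (𝓞 K)) := Pi.ringHom fun P => Ideal.Quotient.factor (hle P)
  have hcop : ∀ P Q : S, P ≠ Q → IsCoprime (P : Ideal (𝓞 K)) (Q : Ideal (𝓞 K)) := fun P Q h =>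
    Ideal.isCoprime_iff_sup_eq.2 ((hmax P).coprime_of_ne (hmax Q) (fun h' => h (Subtype.ext h')))
  have hinf : M = ⨅ P : S, (P : Ideal (𝓞 K)) := by
    rw [hM, ← Finset.prod_coe_sort, Ideal.prod_eq_iInf_of_pairwise_isCoprime]
    · simp
    · intro P _ Q _ h; exact hcop P Q h
  have he : Function.Bijective e := by
    constructor
    · rw [injective_iff_map_eq_zero]
      intro x
      obtain ⟨x, rfl⟩ := Ideal.Quotient.mk_surjective x
      intro h
      rw [Ideal.Quotient.eq_zero_iff_mem, hinf, Ideal.mem_iInf]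
      intro P
      have := congrFun h P
      rw [← Ideal.Quotient.eq_zero_iff_mem]
      exact this
    · intro y
      obtain ⟨x, hx⟩ := Ideal.pi_quotient_surjective (fun P Q h => hcop P Q h) y
      exact ⟨Ideal.Quotient.mk M x, funext hx⟩
  have hk : ∀ P : S, ringChar (𝓞 K ⧸ (P : Ideal (𝓞 K))) ≠ 2 := by
    intro P h
    apply (hS P P.2).2
    rw [← Ideal.Quotient.eq_zero_iff_mem, map_ofNat]
    have := ringChar.Nat.cast_ringChar (R := 𝓞 K ⧸ (P : Ideal (𝓞 K)))
    rw [h] at this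
    exact_mod_cast this
  obtain ⟨h1, h2⟩ := gauss_ring e he hk ψ hψ
  refine ⟨h1, fun a ha => ?_⟩
  have hne : ∀ P : S, e (Ideal.Quotient.mk M a) P ≠ 0 := fun P h => ha P P.2 (Ideal.Quotient.eq_zero_iff_mem.1 h)
  rw [h2 _ hne, ← Finset.prod_coe_sort S]
  congr 1
  refine Finset.prod_congr rfl fun P _ => ?_
  unfold chi
  split_ifs with h
  · rw [(quadraticChar_one_iff_isSquare (hne P)).2 h]; simp
  · have h' : ¬ IsSquare (e (Ideal.Quotient.mk M a) P) := h
    rw [quadraticChar_neg_one_iff_not_isSquare.2 h']; simp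

end CN
end

section
open MeasureTheory Filter Topology
namespace CN
open NumberField nonZeroDivisors FractionalIdeal

universe u
variable {K : Type u} [Field K] [NumberField K]

lemma exists_cJm (b : Ideal (𝓞 K)) (hb : b ≠ ⊥) :
    ∃ (c : K) (J : FractionalIdeal (𝓞 K)⁰ K) (S : Finset (Ideal (𝓞 K))),
      c ≠ 0 ∧ J ≠ 0 ∧ (∀ P ∈ S, Prime P ∧ P ⊔ b = ⊤) ∧
      spanSingleton (𝓞 K)⁰ c * (J * ((∏ P ∈ S, P : Ideal (𝓞 K)) * J)) = Dinv K := by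
  have hD : Dinv K ≠ 0 := dual_ne_zero ℤ ℚ one_ne_zero
  obtain ⟨e, I, he, hI⟩ := exists_eq_spanSingleton_mul (Dinv K)
  have he' : (e : K) ≠ 0 := by simpa using he
  have hI0 : I ≠ ⊥ := by
    rintro rfl; apply hD; rw [hI]; simp
  obtain ⟨A, x, y, hA, hAb, hx, hy, hxy⟩ := moving I b hI0 hb
  obtain ⟨S, J, hS, hJ, h⟩ := squarefree_part A hA
  have hx' : (x : K) ≠ 0 := by simpa using hx
  have hy' : (y : K) ≠ 0 := by simpa using hy
  refine ⟨(e : K)⁻¹ * (y : K)⁻¹ * x, J, S, ?_, coeIdeal_ne_zero.2 hJ, ?_, ?_⟩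
  · exact mul_ne_zero (mul_ne_zero (inv_ne_zero he') (inv_ne_zero hy')) hx'
  · intro P hP
    refine ⟨(hS P hP).1, ?_⟩
    rw [eq_top_iff, ← hAb]
    exact sup_le_sup_right (hS P hP).2 _
  · have h1 : (J : FractionalIdeal (𝓞 K)⁰ K) * ((∏ P ∈ S, P : Ideal (𝓞 K)) * J) = A := by
      rw [h, coeIdeal_mul, coeIdeal_pow]; ring
    have h2 : spanSingleton (𝓞 K)⁰ (x : K) * A = spanSingleton (𝓞 K)⁰ (y : K) * I := by
      have := congrArg (fun I : Ideal (𝓞 K) => (I : FractionalIdeal (𝓞 K)⁰ K)) hxy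
      simpa [coeIdeal_mul, coeIdeal_span_singleton] using this
    rw [h1, ← spanSingleton_mul_spanSingleton, mul_assoc, h2, ← mul_assoc, spanSingleton_mul_spanSingleton, hI]
    congr 2
    field_simp

/-- sums over the modulus 4 -/
lemma sum_sq_unit {R : Type*} [CommRing R] [Fintype R] (χ : R → ℂ) (s : R) (hs : IsUnit s) (b : R) :
    ∑ r, χ (s ^ 2 * b * r ^ 2) = ∑ r, χ (b * r ^ 2) := by
  obtain ⟨s, rfl⟩ := hs
  refine Fintype.sum_equiv (Units.mulLeft s) _ _ fun r => ?_
  congr 1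
  simp [Units.mulLeft]
  ring

lemma alg_aux (qz qa qb q1 : ℝ) (hb : qb ≠ 0) (h1 : q1 ≠ 0) (f1 fa fz fb r1 ra rz rb : ℂ)
    (hr : r1 * rb = ra * rz) (hf : f1 * fb = fa * fz) :
    ((qz * qa * ((qb * q1)⁻¹) : ℝ) : ℂ) * ((qb * fb * rb) * (q1 * f1 * r1)) = (qz * fz * rz) * (qa * fa * ra) := by
  have hb0 : (qb : ℂ) ≠ 0 := by exact_mod_cast hb
  have h10 : (q1 : ℂ) ≠ 0 := by exact_mod_cast h1
  push_cast
  field_simp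
  linear_combination (qz * qa : ℂ) * f1 * fb * hr + (qz * qa : ℂ) * ra * rz * hf

theorem lemR (hK : ∀ φ : K →+* ℂ, ComplexEmbedding.IsReal φ) (a z : 𝓞 K) (ha : a ≠ 0) (hz : z ≠ 0)
    (p : Ideal (𝓞 K)) (hp : Prime p) (hp2 : (2 : 𝓞 K) ∉ p) (C R : Ideal (𝓞 K))
    (hC : Ideal.span {a} = C ^ 2) (hR : Ideal.span {z} = p * R ^ 2)
    (hC2 : C ⊔ Ideal.span {2} = ⊤) (hR2 : R ⊔ Ideal.span {2} = ⊤) (hCp : C ⊔ p = ⊤) (hRp : R ⊔ p = ⊤)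
    (h4 : (∃ s, a - s ^ 2 ∈ Ideal.span {(4 : 𝓞 K)}) ∨ (∃ s, z - s ^ 2 ∈ Ideal.span {(4 : 𝓞 K)}))
    (hsgn : ∀ v : K →+* ℂ, 0 < (v a).re ∨ 0 < (v z).re) : IsSquare (Ideal.Quotient.mk p a) := by
  classical
  have hmaxp : p.IsMaximal := (Ideal.isPrime_of_prime hp).isMaximal hp.ne_zero
  obtain ⟨c, J, S, hc, hJ0, hS, hJ⟩ := exists_cJm (K := K) (Ideal.span {2 * a * z}) (by simp [ha, hz])
  set m : Ideal (𝓞 K) := ∏ P ∈ S, P with hm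
  have hm0 : m ≠ ⊥ := Finset.prod_ne_zero_iff.2 fun P hP => (hS P hP).1.ne_zero
  have hS' : ∀ P ∈ S, ∀ t : 𝓞 K, t ∣ 2 * a * z → t ∉ P := by
    intro P hP t ht htP
    have h := (hS P hP).2
    rw [sup_eq_left.2 ((Ideal.span_singleton_le_iff_mem _).2 (P.mem_of_dvd ht htP))] at h
    exact (Ideal.isPrime_of_prime (hS P hP).1).ne_top h
  have hS2 : ∀ P ∈ S, (2 : 𝓞 K) ∉ P := fun P hP => hS' P hP 2 ⟨a * z, by ring⟩
  have hSa : ∀ P ∈ S, a ∉ P := fun P hP => hS' P hP a ⟨2 * z, by ring⟩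
  have hSz : ∀ P ∈ S, z ∉ P := fun P hP => hS' P hP z ⟨2 * a, by ring⟩
  have hpS : p ∉ S := fun h => hSz p h (by
    rw [← Ideal.span_singleton_le_iff_mem, hR]; exact Ideal.mul_le_left (I := p) (J := R ^ 2))
  have hcopm : ∀ T : Ideal (𝓞 K), Ideal.span {2 * a * z} ≤ T → T ⊔ m = ⊤ := by
    intro T hT
    rw [← Ideal.isCoprime_iff_sup_eq]
    refine IsCoprime.prod_right fun P hP => ?_
    rw [Ideal.isCoprime_iff_sup_eq, eq_top_iff, ← (hS P hP).2, sup_comm]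
    exact sup_le_sup_right hT _
  have hspan : Ideal.span {2 * a * z} = Ideal.span {2} * C ^ 2 * (p * R ^ 2) := by
    rw [← hC, ← hR, Ideal.span_singleton_mul_span_singleton, Ideal.span_singleton_mul_span_singleton]
  have hCm : C ⊔ m = ⊤ := hcopm C (Ideal.dvd_iff_le.1 (by rw [hspan]; exact ⟨Ideal.span {2} * C * (p * R ^ 2), by ring⟩))
  have hRm : R ⊔ m = ⊤ := hcopm R (Ideal.dvd_iff_le.1 (by rw [hspan]; exact ⟨Ideal.span {2} * C ^ 2 * (p * R), by ring⟩))
  have hp2' : p ⊔ Ideal.span {2} = ⊤ := (Ideal.isMaximal_def.1 hmaxp).2 _ (left_lt_sup.2 fun h => hp2 ((Ideal.span_singleton_le_iff_mem _).1 h))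
  have e4 : (Ideal.span {4} : Ideal (𝓞 K)) = Ideal.span {2} * Ideal.span {2} := by
    rw [Ideal.span_singleton_mul_span_singleton]; norm_num
  simp only [← Ideal.isCoprime_iff_sup_eq] at hC2 hR2 hCp hRp hCm hRm hp2'
  have hC4 : IsCoprime C (Ideal.span {4}) := by rw [e4]; exact hC2.mul_right hC2
  have hR4 : IsCoprime R (Ideal.span {4}) := by rw [e4]; exact hR2.mul_right hR2
  have hp4 : IsCoprime p (Ideal.span {4}) := by rw [e4]; exact hp2'.mul_right hp2'
  have hC0 : C ≠ ⊥ := by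
    rintro rfl; apply ha; rw [← Ideal.span_singleton_eq_bot, hC]; simp
  have hR0 : R ≠ ⊥ := by
    rintro rfl; apply hz; rw [← Ideal.span_singleton_eq_bot, hR]; simp
  have htop : (⊤ : Ideal (𝓞 K)) ≠ ⊥ := top_ne_bot
  have hmJ0 : (m : FractionalIdeal (𝓞 K)⁰ K) * J ≠ 0 := mul_ne_zero (coeIdeal_ne_zero.2 hm0) hJ0
  have h40 : (Ideal.span {4} : Ideal (𝓞 K)) ≠ ⊥ := by simp
  obtain ⟨j0, hj0, hj0'⟩ := exists_gen _ hmJ0 _ h40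
  have hA1 : J * ((⊤ : Ideal (𝓞 K)) : FractionalIdeal (𝓞 K)⁰ K)⁻¹ ≠ 0 := mul_ne_zero hJ0 (inv_ne_zero (coeIdeal_ne_zero.2 htop))
  have hAp : J * (p : FractionalIdeal (𝓞 K)⁰ K)⁻¹ ≠ 0 := mul_ne_zero hJ0 (inv_ne_zero (coeIdeal_ne_zero.2 hp.ne_zero))
  have hmt0 : m * ⊤ ≠ ⊥ := mul_ne_zero hm0 htop
  have hmp0 : m * p ≠ ⊥ := mul_ne_zero hm0 hp.ne_zero
  obtain ⟨j1, hj1, hj1'⟩ := exists_gen _ hA1 _ hmt0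
  obtain ⟨jp, hjp, hjp'⟩ := exists_gen _ hAp _ hmp0
  have := Ideal.finiteQuotientOfFreeOfNeBot (m * ⊤) hmt0
  have := Ideal.finiteQuotientOfFreeOfNeBot (m * p) hmp0
  have := Ideal.finiteQuotientOfFreeOfNeBot _ h40
  let _ := Fintype.ofFinite (𝓞 K ⧸ m * ⊤)
  let _ := Fintype.ofFinite (𝓞 K ⧸ m * p)
  let _ := Fintype.ofFinite (𝓞 K ⧸ (Ideal.span {4} : Ideal (𝓞 K)))
  obtain ⟨Ψ1, χ1, q1, hq1, hΨ1, hpr1, hχ1, H1⟩ := lemHG hK c hc J hJ0 m hm0 hJ j0 hj0 hj0' ⊤ htop j1 hj1 hj1' 1 ⊤ htop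
    (by simp [Ideal.top_pow]) (by simp) (by simp)
  obtain ⟨Ψa, χa, qa, hqa, hΨa, hpra, hχa, Ha⟩ := lemHG hK c hc J hJ0 m hm0 hJ j0 hj0 hj0' ⊤ htop j1 hj1 hj1' a C hC0
    (by simp [hC]) (Ideal.isCoprime_iff_sup_eq.1 hC4) (by rw [Ideal.mul_top]; exact Ideal.isCoprime_iff_sup_eq.1 hCm)
  obtain ⟨Ψz, χz, qz, hqz, hΨz, hprz, hχz, Hz⟩ := lemHG hK c hc J hJ0 m hm0 hJ j0 hj0 hj0' p hp.ne_zero jp hjp hjp' z R hR0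
    hR (Ideal.isCoprime_iff_sup_eq.1 hR4) (Ideal.isCoprime_iff_sup_eq.1 (hRm.mul_right hRp))
  obtain ⟨Ψb, χb, qb, hqb, hΨb, hprb, hχb, Hb⟩ := lemHG hK c hc J hJ0 m hm0 hJ j0 hj0 hj0' p hp.ne_zero jp hjp hjp' (a * z) (C * R)
    (mul_ne_zero hC0 hR0) (by rw [← Ideal.span_singleton_mul_span_singleton, hC, hR]; ring)
    (Ideal.isCoprime_iff_sup_eq.1 (hC4.mul_left hR4)) (Ideal.isCoprime_iff_sup_eq.1 ((hCm.mul_right hCp).mul_left (hRm.mul_right hRp)))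
  have hap : a ∉ p := by
    intro h
    have h1 : C ≤ p := by
      have : C ^ 2 ≤ p := by rw [← hC]; exact (Ideal.span_singleton_le_iff_mem _).2 h
      exact (Ideal.isPrime_of_prime hp).le_of_pow_le this
    have h2 := Ideal.isCoprime_iff_sup_eq.1 hCp
    rw [sup_eq_right.2 h1] at h2
    exact hmaxp.ne_top h2
  obtain ⟨g1, g1'⟩ := gauss_ideal S (fun P hP => ⟨(hS P hP).1, hS2 P hP⟩) (m * ⊤) (by simp [hm]) Ψ1 hpr1
  obtain ⟨gz, gz'⟩ := gauss_ideal (insert p S) (by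
      intro P hP
      rcases Finset.mem_insert.1 hP with rfl | hP
      · exact ⟨hp, hp2⟩
      · exact ⟨(hS P hP).1, hS2 P hP⟩) (m * p) (by rw [Finset.prod_insert hpS, mul_comm]) Ψz hprz
  have Ga : ∑ r, Ψa (r ^ 2) = (∏ P ∈ S, chi P a) * ∑ r, Ψ1 (r ^ 2) := by
    rw [← g1' a hSa]
    refine Finset.sum_congr rfl fun r _ => ?_
    obtain ⟨r, rfl⟩ := Ideal.Quotient.mk_surjective r
    rw [← map_pow, ← map_mul, hΨa, hΨ1]
    congr 1; push_cast; ring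
  have Gb : ∑ r, Ψb (r ^ 2) = (chi p a * ∏ P ∈ S, chi P a) * ∑ r, Ψz (r ^ 2) := by
    rw [← Finset.prod_insert (f := fun P => chi P a) hpS, ← gz' a (by
      intro P hP
      rcases Finset.mem_insert.1 hP with rfl | hP
      · exact hap
      · exact hSa P hP)]
    refine Finset.sum_congr rfl fun r _ => ?_
    obtain ⟨r, rfl⟩ := Ideal.Quotient.mk_surjective r
    rw [← map_pow, ← map_mul, hΨb, hΨz]
    congr 1; push_cast; ring
  have hχ : ∀ (g : 𝓞 K) (χ : AddChar (𝓞 K ⧸ (Ideal.span {4} : Ideal (𝓞 K))) ℂ),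
      (∀ r : 𝓞 K, χ (Ideal.Quotient.mk _ r) = psi (-(c * g * j0 ^ 2 * r / 4))) →
      ∑ r, χ (r ^ 2) = ∑ r, χ1 (Ideal.Quotient.mk _ g * r ^ 2) := by
    intro g χ h
    refine Finset.sum_congr rfl fun r _ => ?_
    obtain ⟨r, rfl⟩ := Ideal.Quotient.mk_surjective r
    rw [← map_pow, ← map_mul, h, hχ1]
    congr 1; push_cast; ring
  have hR1 := hχ 1 χ1 hχ1
  have hRa := hχ a χa hχa
  have hRz := hχ z χz hχz
  have hRb := hχ (a * z) χb hχb
  have hunit : ∀ t : 𝓞 K, IsCoprime (Ideal.span {t}) (Ideal.span {(4 : 𝓞 K)}) → ∀ s, t - s ^ 2 ∈ Ideal.span {(4 : 𝓞 K)} →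
      Ideal.Quotient.mk (Ideal.span {(4 : 𝓞 K)}) t = (Ideal.Quotient.mk _ s) ^ 2 ∧ IsUnit (Ideal.Quotient.mk (Ideal.span {(4 : 𝓞 K)}) s) := by
    intro t ht s hs
    have h1 : Ideal.Quotient.mk (Ideal.span {(4 : 𝓞 K)}) t = (Ideal.Quotient.mk _ s) ^ 2 := by
      rw [← map_pow, Ideal.Quotient.eq]; exact hs
    refine ⟨h1, ?_⟩
    rw [← isUnit_pow_iff two_ne_zero, ← h1]
    obtain ⟨u, v, huv⟩ := (Ideal.isCoprime_span_singleton_iff _ _).1 ht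
    refine IsUnit.of_mul_eq_one (Ideal.Quotient.mk _ u) ?_
    rw [← map_mul, ← map_one (Ideal.Quotient.mk _), Ideal.Quotient.eq, Ideal.mem_span_singleton]
    exact ⟨-v, by linear_combination huv⟩
  have hRR : (∑ r, χ1 (r ^ 2)) * ∑ r, χb (r ^ 2) = (∑ r, χa (r ^ 2)) * ∑ r, χz (r ^ 2) := by
    rw [hR1, hRa, hRz, hRb]
    simp only [map_mul, map_one]
    rcases h4 with ⟨s, hs⟩ | ⟨s, hs⟩
    · obtain ⟨h5, h6⟩ := hunit a (by rw [hC]; exact hC4.pow_left) s hs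
      rw [h5, sum_sq_unit χ1 _ h6]
      congr 1
      have := sum_sq_unit χ1 _ h6 1
      simp only [mul_one] at this
      rw [this]
    · obtain ⟨h5, h6⟩ := hunit z (by rw [hR]; exact hp4.mul_left hR4.pow_left) s hs
      rw [mul_comm (Ideal.Quotient.mk (Ideal.span {(4 : 𝓞 K)}) a) (Ideal.Quotient.mk (Ideal.span {(4 : 𝓞 K)}) z)]
      rw [h5, sum_sq_unit χ1 _ h6, mul_comm]
      congr 1
      have := sum_sq_unit χ1 _ h6 1
      simp only [mul_one] at this
      rw [this]
  have hre : ∀ (v : K →+* ℂ) (x y : K), (v (x * y)).re = (v x).re * (v y).re := by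
    intro v x y
    have hx := real_emb hK v x
    have hy := real_emb hK v y
    rw [map_mul, ← hx, ← hy, ← Complex.ofReal_mul]
    simp
  have hphi : (∏ v : K →+* ℂ, ph (v (c * (1 : 𝓞 K))).re) * (∏ v : K →+* ℂ, ph (v (c * (a * z : 𝓞 K))).re)
      = (∏ v : K →+* ℂ, ph (v (c * a)).re) * (∏ v : K →+* ℂ, ph (v (c * z)).re) := by
    rw [← Finset.prod_mul_distrib, ← Finset.prod_mul_distrib]
    refine Finset.prod_congr rfl fun v _ => ?_
    push_cast
    simp only [hre, map_one, Complex.one_re, mul_one]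
    rcases hsgn v with h | h
    · congr 1
      · apply ph_congr; rw [mul_pos_iff_of_pos_right h]
      · apply ph_congr
        rw [show (v c).re * ((v a).re * (v z).re) = (v a).re * ((v c).re * (v z).re) by ring, mul_pos_iff_of_pos_left h]
    · rw [mul_comm]
      congr 1
      · apply ph_congr
        rw [← mul_assoc, mul_pos_iff_of_pos_right h]
      · apply ph_congr; rw [mul_pos_iff_of_pos_right h]
  -- conclusion
  have hX1 : (∏ v : K →+* ℂ, ph (v (c * (1 : 𝓞 K))).re) ≠ 0 := Finset.prod_ne_zero_iff.2 fun v _ => ph_ne _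
  have hne : (∑ r, Ψz (r ^ 2)) * ∑ r, Ψa (r ^ 2) ≠ 0 := by
    refine mul_ne_zero gz ?_
    rw [Ga]
    refine mul_ne_zero (Finset.prod_ne_zero_iff.2 fun P _ => ?_) g1
    intro h; have := chi_sq P a; rw [h] at this; simp at this
  have hkey : (∑ r, Ψb (r ^ 2)) * ∑ r, Ψ1 (r ^ 2) = chi p a * ((∑ r, Ψz (r ^ 2)) * ∑ r, Ψa (r ^ 2)) := by
    rw [Ga, Gb]; ring
  by_contra hns
  have hch : chi p a = -1 := by unfold chi; rw [if_neg hns]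
  rw [hch] at hkey
  have h7 : ((qz * qa * ((qb * q1)⁻¹) : ℝ) : ℂ) * ((∑ r, Ψb (r ^ 2)) * ∑ r, Ψ1 (r ^ 2)) = ((∑ r, Ψz (r ^ 2)) * ∑ r, Ψa (r ^ 2)) := by
    have hb0 : (qb : ℂ) ≠ 0 := by exact_mod_cast hqb.ne'
    have h10 : (q1 : ℂ) ≠ 0 := by exact_mod_cast hq1.ne'
    rw [Hb, H1, Hz, Ha]
    exact alg_aux _ _ _ _ hqb.ne' hq1.ne' _ _ _ _ _ _ _ _ hRR hphi
  rw [hkey] at h7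
  have h8 : (((qz * qa * ((qb * q1)⁻¹) : ℝ) : ℂ) + 1) * ((∑ r, Ψz (r ^ 2)) * ∑ r, Ψa (r ^ 2)) = 0 := by
    linear_combination -h7
  rcases mul_eq_zero.1 h8 with h | h
  · have : (qz * qa * ((qb * q1)⁻¹) : ℝ) + 1 = 0 := by exact_mod_cast h
    have : 0 < qz * qa * ((qb * q1)⁻¹) := by positivity
    linarith
  · exact hne h

end CN
end

section
open MeasureTheory Filter Topology
namespace CN
open NumberField nonZeroDivisors

universe u
variable {F : Type u} [Field F] [NumberField F]

/-- zeta sum over a set of ideals -/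
noncomputable def ZS (S : Set (Ideal (𝓞 F))) (s : ℝ) : ENNReal := ∑' I : S, (Ideal.absNorm I.1 : ENNReal) ^ (-s)

/-- nonzero ideals not contained in any of the primes in `T` -/
def Gd (T : Set (Ideal (𝓞 F))) : Set (Ideal (𝓞 F)) := {I | I ≠ ⊥ ∧ ∀ P ∈ T, ¬ I ≤ P}

lemma npow_mul (a b : ℕ) (s : ℝ) : ((a * b : ℕ) : ENNReal) ^ (-s) = (a : ENNReal) ^ (-s) * (b : ENNReal) ^ (-s) := by
  rw [Nat.cast_mul, ENNReal.mul_rpow_of_ne_top (ENNReal.natCast_ne_top _) (ENNReal.natCast_ne_top _)]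

lemma ZS_insert (T : Set (Ideal (𝓞 F))) (P : Ideal (𝓞 F)) (hP : Prime P) (s : ℝ) (hs : 1 ≤ s) (hfin : ZS (Gd T) s ≠ ⊤) :
    ZS (Gd T) s ≤ 2 * ZS (Gd (insert P T)) s := by
  have h1 : ZS (Gd T) s ≤ ZS (Gd (insert P T)) s + ZS (Gd T ∩ {I | I ≤ P}) s := by
    have : Gd T ⊆ Gd (insert P T) ∪ (Gd T ∩ {I | I ≤ P}) := by
      intro I hI
      by_cases h : I ≤ P
      · exact Or.inr ⟨hI, h⟩
      · left
        refine ⟨hI.1, fun Q hQ => ?_⟩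
        rcases Set.mem_insert_iff.1 hQ with rfl | hQ
        · exact h
        · exact hI.2 Q hQ
    refine (ENNReal.tsum_mono_subtype (fun I : Ideal (𝓞 F) => (Ideal.absNorm I : ENNReal) ^ (-s)) this).trans ?_
    exact ENNReal.tsum_union_le (fun I : Ideal (𝓞 F) => (Ideal.absNorm I : ENNReal) ^ (-s)) _ _
  have hN : 2 ≤ Ideal.absNorm P := by
    have h0 : Ideal.absNorm P ≠ 0 := by rw [Ne, Ideal.absNorm_eq_zero_iff]; exact hP.ne_zero
    have h1 : Ideal.absNorm P ≠ 1 := by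
      rw [Ne, Ideal.absNorm_eq_one_iff]; exact (Ideal.isPrime_of_prime hP).ne_top
    omega
  have hN' : (Ideal.absNorm P : ENNReal) ^ (-s) ≤ 2⁻¹ := by
    rw [ENNReal.rpow_neg, ENNReal.inv_le_inv]
    calc (2 : ENNReal) ≤ (Ideal.absNorm P : ENNReal) := by exact_mod_cast hN
      _ = (Ideal.absNorm P : ENNReal) ^ (1 : ℝ) := by simp
      _ ≤ _ := ENNReal.rpow_le_rpow_of_exponent_le (by exact_mod_cast (by omega : 1 ≤ Ideal.absNorm P)) hs
  have h2 : ZS (Gd T ∩ {I | I ≤ P}) s ≤ 2⁻¹ * ZS (Gd T) s := by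
    have hdv : ∀ I : (Gd T ∩ {I | I ≤ P} : Set (Ideal (𝓞 F))), ∃ I' : Gd T, I.1 = P * I'.1 := by
      rintro ⟨I, hI, hIP⟩
      obtain ⟨I', rfl⟩ := Ideal.dvd_iff_le.2 hIP
      refine ⟨⟨I', ?_, ?_⟩, rfl⟩
      · rintro rfl; exact hI.1 (by simp)
      · intro Q hQ h; exact hI.2 Q hQ (Ideal.mul_le_right.trans h)
    choose f hf using hdv
    have hinj : Function.Injective f := by
      intro I J h
      apply Subtype.ext
      rw [hf, hf, h]
    calc ZS (Gd T ∩ {I | I ≤ P}) s = ∑' I, (fun J : Gd T => (Ideal.absNorm P : ENNReal) ^ (-s) * (Ideal.absNorm J.1 : ENNReal) ^ (-s)) (f I) := by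
          unfold ZS
          congr 1; ext I
          rw [hf I, map_mul, npow_mul]
      _ ≤ ∑' J : Gd T, (Ideal.absNorm P : ENNReal) ^ (-s) * (Ideal.absNorm J.1 : ENNReal) ^ (-s) :=
          ENNReal.tsum_comp_le_tsum_of_injective hinj _
      _ = (Ideal.absNorm P : ENNReal) ^ (-s) * ZS (Gd T) s := by rw [ENNReal.tsum_mul_left]; rfl
      _ ≤ _ := by gcongr
  set A := ZS (Gd T) s
  set B := ZS (Gd (insert P T)) s
  have h3 : A ≤ B + 2⁻¹ * A := h1.trans (by gcongr)
  have h4 : A = 2⁻¹ * A + 2⁻¹ * A := by rw [← add_mul, ENNReal.inv_two_add_inv_two, one_mul]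
  have h5 : 2⁻¹ * A + 2⁻¹ * A ≤ B + 2⁻¹ * A := by rw [← h4]; exact h3
  have h6 : 2⁻¹ * A ≤ B := (ENNReal.add_le_add_iff_right (ENNReal.mul_ne_top (by simp) hfin)).1 h5
  calc A = 2 * (2⁻¹ * A) := by rw [← mul_assoc, ENNReal.mul_inv_cancel (by simp) (by simp), one_mul]
    _ ≤ _ := by gcongr

lemma ZS_good (T : Finset (Ideal (𝓞 F))) (hT : ∀ P ∈ T, Prime P) (s : ℝ) (hs : 1 ≤ s) (hfin : ZS (Gd (F := F) ∅) s ≠ ⊤) :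
    ZS (Gd (F := F) ∅) s ≤ 2 ^ T.card * ZS (Gd (T : Set (Ideal (𝓞 F)))) s := by
  classical
  induction T using Finset.induction_on with
  | empty => simp
  | insert P T hPT ih =>
    rw [Finset.card_insert_of_notMem hPT, Finset.coe_insert]
    refine (ih fun Q hQ => hT Q (Finset.mem_insert_of_mem hQ)).trans ?_
    rw [pow_succ, mul_assoc]
    gcongr
    refine ZS_insert _ P (hT P (Finset.mem_insert_self _ _)) s hs (ne_top_of_le_ne_top hfin ?_)
    refine ENNReal.tsum_mono_subtype (fun I : Ideal (𝓞 F) => (Ideal.absNorm I : ENNReal) ^ (-s)) ?_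
    intro I hI
    exact ⟨hI.1, by simp⟩

lemma ZS_eq (s : ℝ) (hs : 1 < s) (h : dedekindZeta F s ≠ 0) :
    ZS (Gd (F := F) ∅) s = ENNReal.ofReal (dedekindZeta F s).re ∧ 0 ≤ (dedekindZeta F s).re := by
  set f : ℕ → ℝ := fun n => Nat.card {I : Ideal (𝓞 F) // Ideal.absNorm I = n} with hf
  set t : ℕ → ℝ := fun n => if n = 0 then 0 else f n * (n : ℝ) ^ (-s) with ht
  have ht0 : ∀ n, 0 ≤ t n := by
    intro n; simp only [ht]; split_ifs
    · exact le_rfl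
    · exact mul_nonneg (Nat.cast_nonneg _) (by positivity)
  have hterm : ∀ n, LSeries.term (fun n => (Nat.card {I : Ideal (𝓞 F) // Ideal.absNorm I = n} : ℂ)) s n = (t n : ℂ) := by
    intro n
    rw [LSeries.term_def]
    simp only [ht]
    split_ifs
    · simp
    · push_cast
      rw [Complex.ofReal_cpow (by positivity), div_eq_mul_inv]
      simp [hf, Complex.cpow_neg]
  have hz : dedekindZeta F s = ∑' n, (t n : ℂ) := by
    unfold dedekindZeta LSeries
    exact tsum_congr hterm
  have hsum : Summable t := by
    rw [← Complex.summable_ofReal]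
    by_contra hn
    exact h (by rw [hz, tsum_eq_zero_of_not_summable hn])
  have hz' : (dedekindZeta F s).re = ∑' n, t n := by
    rw [hz, ← Complex.ofReal_tsum, Complex.ofReal_re]
  refine ⟨?_, by rw [hz']; exact tsum_nonneg ht0⟩
  rw [hz', ENNReal.ofReal_tsum_of_nonneg ht0 hsum]
  unfold ZS
  rw [← (Equiv.sigmaFiberEquiv (fun I : Gd (F := F) ∅ => Ideal.absNorm I.1)).tsum_eq, ENNReal.tsum_sigma']
  refine tsum_congr fun n => ?_
  have e1 : ∀ I : {I : Gd (F := F) ∅ // Ideal.absNorm I.1 = n}, (Ideal.absNorm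
    ((Equiv.sigmaFiberEquiv (fun I : Gd (F := F) ∅ => Ideal.absNorm I.1)) ⟨n, I⟩).1 : ENNReal) ^ (-s) = (n : ENNReal) ^ (-s) := by
    rintro ⟨I, rfl⟩; rfl
  rw [tsum_congr e1, ENNReal.tsum_const]
  simp only [ht]
  split_ifs with hn
  · have : IsEmpty {I : Gd (F := F) ∅ // Ideal.absNorm I.1 = n} := by
      refine ⟨fun I => ?_⟩
      have h0 := I.2.trans hn
      rw [Ideal.absNorm_eq_zero_iff] at h0
      exact I.1.2.1 h0
    have e0 : ENat.card {I : Gd (F := F) ∅ // Ideal.absNorm I.1 = n} = 0 := ENat.card_eq_zero_iff_empty _ |>.2 this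
    rw [e0]; simp
  · have e : {I : Gd (F := F) ∅ // Ideal.absNorm I.1 = n} ≃ {I : Ideal (𝓞 F) // Ideal.absNorm I = n} :=
      { toFun := fun I => ⟨I.1.1, I.2⟩
        invFun := fun I => ⟨⟨I.1, by
          refine ⟨fun h0 => hn ?_, by simp⟩
          rw [← I.2, h0]; simp⟩, I.2⟩
        left_inv := fun I => rfl
        right_inv := fun I => rfl }
    have hfin : Finite {I : Ideal (𝓞 F) // Ideal.absNorm I = n} := Ideal.finite_setOfPred_absNorm_eq n
    rw [ENat.card_congr e, ENat.card_eq_coe_natCard, ENNReal.ofReal_mul (Nat.cast_nonneg _)]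
    congr 1
    · simp [hf]
    · rw [← ENNReal.ofReal_rpow_of_pos (by positivity)]
      simp

lemma ZS_final (L M : Type*) [Field L] [NumberField L] [Field M] [NumberField M] (C : ℕ)
    (h : ∀ s : ℝ, 1 < s → ZS (Gd (F := L) ∅) s ≠ ⊤ → (ZS (Gd (F := L) ∅) s) ^ 2 ≤ C * ZS (Gd (F := M) ∅) s) : False := by
  have hL := tendsto_sub_one_mul_dedekindZeta_nhdsGT L
  have hM := tendsto_sub_one_mul_dedekindZeta_nhdsGT M
  have hL0 := dedekindZeta_residue_pos L
  have eL : ∀ᶠ s : ℝ in 𝓝[>] 1, ((s : ℂ) - 1) * dedekindZeta L s ≠ 0 := hL.eventually_ne (by exact_mod_cast dedekindZeta_residue_ne_zero L)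
  have eM : ∀ᶠ s : ℝ in 𝓝[>] 1, ((s : ℂ) - 1) * dedekindZeta M s ≠ 0 := hM.eventually_ne (by exact_mod_cast dedekindZeta_residue_ne_zero M)
  have hre : ∀ (s : ℝ) (z : ℂ), (((s : ℂ) - 1) * z).re = (s - 1) * z.re := by
    intro s z; rw [← Complex.ofReal_one, ← Complex.ofReal_sub, Complex.re_ofReal_mul]
  have hL' : Tendsto (fun s : ℝ => (s - 1) * (dedekindZeta L s).re) (𝓝[>] 1) (𝓝 (dedekindZeta_residue L)) := by
    have := (Complex.continuous_re.tendsto _).comp hL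
    simpa only [Function.comp_def, hre, Complex.ofReal_re] using this
  have hM' : Tendsto (fun s : ℝ => (s - 1) * (dedekindZeta M s).re) (𝓝[>] 1) (𝓝 (dedekindZeta_residue M)) := by
    have := (Complex.continuous_re.tendsto _).comp hM
    simpa only [Function.comp_def, hre, Complex.ofReal_re] using this
  have hs0 : Tendsto (fun s : ℝ => s - 1) (𝓝[>] 1) (𝓝 0) := by
    have : Tendsto (fun s : ℝ => s - 1) (𝓝 1) (𝓝 (1 - 1)) := (continuous_id.sub continuous_const).tendsto 1
    rw [sub_self] at this
    exact this.mono_left nhdsWithin_le_nhds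
  have key : ∀ᶠ s : ℝ in 𝓝[>] 1, ((s - 1) * (dedekindZeta L s).re) ^ 2 ≤ C * ((s - 1) * ((s - 1) * (dedekindZeta M s).re)) := by
    filter_upwards [eL, eM, self_mem_nhdsWithin] with s h1 h2 (hs : 1 < s)
    obtain ⟨a1, a2⟩ := ZS_eq s hs (right_ne_zero_of_mul h1)
    obtain ⟨b1, b2⟩ := ZS_eq s hs (right_ne_zero_of_mul h2)
    have := h s hs (by rw [a1]; exact ENNReal.ofReal_ne_top)
    rw [a1, b1, ← ENNReal.ofReal_pow a2, ← ENNReal.ofReal_natCast, ← ENNReal.ofReal_mul (by positivity),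
      ENNReal.ofReal_le_ofReal_iff (by positivity)] at this
    calc ((s - 1) * (dedekindZeta L s).re) ^ 2 = (s - 1) ^ 2 * (dedekindZeta L s).re ^ 2 := by ring
      _ ≤ (s - 1) ^ 2 * (C * (dedekindZeta M s).re) := by gcongr
      _ = _ := by ring
  have := le_of_tendsto_of_tendsto (hL'.pow 2) ((hs0.mul hM').const_mul (C : ℝ)) key
  simp at this
  exact hL0.ne' this

end CN
end

section
open MeasureTheory Filter Topology
namespace CN
open NumberField nonZeroDivisors UniqueFactorizationMonoid

lemma ZS_pairs (L M : Type*) [Field L] [NumberField L] [Field M] [NumberField M] (T : Set (Ideal (𝓞 L)))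
    (g1 g2 : Ideal (𝓞 L) → Ideal (𝓞 M)) (k : Ideal (𝓞 M) → Ideal (𝓞 L))
    (hg : ∀ P, Prime P → P ∉ T → Prime (g1 P) ∧ Prime (g2 P) ∧ Ideal.absNorm (g1 P) = Ideal.absNorm P ∧
      Ideal.absNorm (g2 P) = Ideal.absNorm P ∧ k (g1 P) = P ∧ k (g2 P) = P ∧ g1 P ≠ g2 P) (s : ℝ) :
    (ZS (Gd T) s) ^ 2 ≤ ZS (Gd (F := M) ∅) s := by
  classical
  have hgood : ∀ I : Gd T, ∀ P ∈ normalizedFactors I.1, Prime P ∧ P ∉ T := by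
    intro I P hP
    refine ⟨prime_of_normalized_factor P hP, fun hT => I.2.2 P hT (Ideal.dvd_iff_le.1 (dvd_of_mem_normalizedFactors hP))⟩
  have hprod : ∀ I : Gd T, (normalizedFactors I.1).prod = I.1 := fun I =>
    Ideal.prod_normalizedFactors_eq_self I.2.1
  let f : Gd T × Gd T → Ideal (𝓞 M) := fun x =>
    ((normalizedFactors x.1.1).map g1 + (normalizedFactors x.2.1).map g2).prod
  have hmem : ∀ x : Gd T × Gd T, ∀ Q ∈ (normalizedFactors x.1.1).map g1 + (normalizedFactors x.2.1).map g2, Prime Q := by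
    intro x Q hQ
    rcases Multiset.mem_add.1 hQ with h | h
    · obtain ⟨P, hP, rfl⟩ := Multiset.mem_map.1 h
      exact (hg P (hgood _ P hP).1 (hgood _ P hP).2).1
    · obtain ⟨P, hP, rfl⟩ := Multiset.mem_map.1 h
      exact (hg P (hgood _ P hP).1 (hgood _ P hP).2).2.1
  have hf0 : ∀ x, f x ∈ Gd (F := M) ∅ := by
    intro x
    refine ⟨?_, by simp⟩
    exact Multiset.prod_ne_zero fun h => (hmem x _ h).ne_zero rfl
  have hfac : ∀ x, normalizedFactors (f x) = (normalizedFactors x.1.1).map g1 + (normalizedFactors x.2.1).map g2 :=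
    fun x => normalizedFactors_prod_of_prime (hmem x)
  have hfilt1 : ∀ x : Gd T × Gd T, (Multiset.filter (fun Q => Q = g1 (k Q)) (normalizedFactors (f x))).map k = normalizedFactors x.1.1 := by
    intro x
    rw [hfac, Multiset.filter_add, Multiset.filter_eq_self.2, Multiset.filter_eq_nil.2, add_zero, Multiset.map_map]
    · conv_rhs => rw [← Multiset.map_id (normalizedFactors x.1.1)]
      refine Multiset.map_congr rfl fun P hP => ?_
      exact (hg P (hgood _ P hP).1 (hgood _ P hP).2).2.2.2.2.1
    · intro Q hQ h
      obtain ⟨P, hP, rfl⟩ := Multiset.mem_map.1 hQ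
      obtain ⟨_, _, _, _, h1, h2, h3⟩ := hg P (hgood _ P hP).1 (hgood _ P hP).2
      rw [h2] at h
      exact h3 h.symm
    · intro Q hQ
      obtain ⟨P, hP, rfl⟩ := Multiset.mem_map.1 hQ
      rw [(hg P (hgood _ P hP).1 (hgood _ P hP).2).2.2.2.2.1]
  have hfilt2 : ∀ x : Gd T × Gd T, (Multiset.filter (fun Q => Q = g2 (k Q)) (normalizedFactors (f x))).map k = normalizedFactors x.2.1 := by
    intro x
    rw [hfac, add_comm, Multiset.filter_add, Multiset.filter_eq_self.2, Multiset.filter_eq_nil.2, add_zero, Multiset.map_map]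
    · conv_rhs => rw [← Multiset.map_id (normalizedFactors x.2.1)]
      refine Multiset.map_congr rfl fun P hP => ?_
      exact (hg P (hgood _ P hP).1 (hgood _ P hP).2).2.2.2.2.2.1
    · intro Q hQ h
      obtain ⟨P, hP, rfl⟩ := Multiset.mem_map.1 hQ
      obtain ⟨_, _, _, _, h1, h2, h3⟩ := hg P (hgood _ P hP).1 (hgood _ P hP).2
      rw [h1] at h
      exact h3 h
    · intro Q hQ
      obtain ⟨P, hP, rfl⟩ := Multiset.mem_map.1 hQ
      rw [(hg P (hgood _ P hP).1 (hgood _ P hP).2).2.2.2.2.2.1]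
  have hinj : Function.Injective (fun x => (⟨f x, hf0 x⟩ : Gd (F := M) ∅)) := by
    intro x y h
    have h : f x = f y := congrArg Subtype.val h
    refine Prod.ext (Subtype.ext ?_) (Subtype.ext ?_)
    · rw [← hprod x.1, ← hprod y.1, ← hfilt1, ← hfilt1, h]
    · rw [← hprod x.2, ← hprod y.2, ← hfilt2, ← hfilt2, h]
  have hnorm : ∀ x, Ideal.absNorm (f x) = Ideal.absNorm x.1.1 * Ideal.absNorm x.2.1 := by
    intro x
    simp only [f]
    rw [Multiset.prod_add, map_mul, map_multiset_prod, map_multiset_prod, Multiset.map_map, Multiset.map_map]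
    conv_rhs => rw [← hprod x.1, ← hprod x.2, map_multiset_prod, map_multiset_prod]
    congr 2
    · refine Multiset.map_congr rfl fun P hP => ?_
      exact (hg P (hgood _ P hP).1 (hgood _ P hP).2).2.2.1
    · refine Multiset.map_congr rfl fun P hP => ?_
      exact (hg P (hgood _ P hP).1 (hgood _ P hP).2).2.2.2.1
  calc (ZS (Gd T) s) ^ 2 = ∑' x : Gd T × Gd T, (Ideal.absNorm x.1.1 : ENNReal) ^ (-s) * (Ideal.absNorm x.2.1 : ENNReal) ^ (-s) := by
        rw [ENNReal.tsum_prod', sq]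
        unfold ZS
        rw [← ENNReal.tsum_mul_right]
        refine tsum_congr fun I => ?_
        rw [← ENNReal.tsum_mul_left]
    _ = ∑' x, (fun I : Gd (F := M) ∅ => (Ideal.absNorm I.1 : ENNReal) ^ (-s)) ⟨f x, hf0 x⟩ := by
        refine tsum_congr fun x => ?_
        rw [← npow_mul]
        simp only [hnorm]
    _ ≤ _ := ENNReal.tsum_comp_le_tsum_of_injective hinj _

end CN
end

section
open MeasureTheory Filter Topology
namespace CN
open NumberField nonZeroDivisors UniqueFactorizationMonoid

lemma split_pair {L M : Type*} [Field L] [NumberField L] [Field M] [NumberField M] [Algebra L M]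
    (h2 : Module.finrank L M = 2) (b : 𝓞 L) (β : 𝓞 M) (hβ : β ^ 2 = algebraMap (𝓞 L) (𝓞 M) b)
    (σ : 𝓞 M ≃ₐ[𝓞 L] 𝓞 M) (hσ : σ β = -β) (P : Ideal (𝓞 L)) (hP : Prime P) (hP2 : (2 : 𝓞 L) ∉ P) (hPb : b ∉ P)
    (hsq : IsSquare (Ideal.Quotient.mk P b)) :
    ∃ Q1 Q2 : Ideal (𝓞 M), Prime Q1 ∧ Prime Q2 ∧ Ideal.absNorm Q1 = Ideal.absNorm P ∧ Ideal.absNorm Q2 = Ideal.absNorm P ∧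
      Q1.comap (algebraMap (𝓞 L) (𝓞 M)) = P ∧ Q2.comap (algebraMap (𝓞 L) (𝓞 M)) = P ∧ Q1 ≠ Q2 := by
  have hPp : P.IsPrime := Ideal.isPrime_of_prime hP
  obtain ⟨t, ht⟩ := hsq
  obtain ⟨t, rfl⟩ := Ideal.Quotient.mk_surjective t
  rw [← map_mul, Ideal.Quotient.eq] at ht
  have htP : t ∉ P := fun h => hPb (by
    have : b = (b - t * t) + t * t := by ring
    rw [this]; exact P.add_mem ht (P.mul_mem_left _ h))
  obtain ⟨Q, -, hQ, hQP⟩ := Ideal.exists_ideal_over_prime_of_isIntegral (S := 𝓞 M) P ⊥ (by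
    rw [← RingHom.ker_eq_comap_bot, (RingHom.injective_iff_ker_eq_bot _).1 (FaithfulSMul.algebraMap_injective (𝓞 L) (𝓞 M))]
    exact bot_le)
  have hmem : ∀ x : 𝓞 L, algebraMap (𝓞 L) (𝓞 M) x ∈ Q ↔ x ∈ P := fun x => by rw [← hQP]; rfl
  set Q' : Ideal (𝓞 M) := Q.comap (σ : 𝓞 M →+* 𝓞 M) with hQ'
  have hQ'p : Q'.IsPrime := Ideal.comap_isPrime _ _
  have hmem' : ∀ x : 𝓞 L, algebraMap (𝓞 L) (𝓞 M) x ∈ Q' ↔ x ∈ P := fun x => by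
    rw [← hmem, hQ', Ideal.mem_comap]
    simp
  have hQ0 : Q ≠ ⊥ := by
    rintro rfl
    obtain ⟨x, hx, hx0⟩ := Submodule.exists_mem_ne_zero_of_ne_bot (hP.ne_zero : P ≠ ⊥)
    have := (hmem x).2 hx
    rw [Ideal.mem_bot, map_eq_zero_iff _ (FaithfulSMul.algebraMap_injective (𝓞 L) (𝓞 M))] at this
    exact hx0 this
  have hQ'0 : Q' ≠ ⊥ := by
    intro h
    obtain ⟨x, hx, hx0⟩ := Submodule.exists_mem_ne_zero_of_ne_bot (hP.ne_zero : P ≠ ⊥)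
    have := (hmem' x).2 hx
    rw [h, Ideal.mem_bot, map_eq_zero_iff _ (FaithfulSMul.algebraMap_injective (𝓞 L) (𝓞 M))] at this
    exact hx0 this
  set t' := algebraMap (𝓞 L) (𝓞 M) t
  have hprod : (β - t') * (β + t') ∈ Q := by
    have : (β - t') * (β + t') = algebraMap (𝓞 L) (𝓞 M) (b - t * t) := by
      rw [map_sub, map_mul, ← hβ]; ring
    rw [this, hmem]; exact ht
  have h2t : ¬ (β - t' ∈ Q ∧ β + t' ∈ Q) := by
    rintro ⟨h1, h2⟩
    have h3 : (β + t') - (β - t') = algebraMap (𝓞 L) (𝓞 M) (2 * t) := by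
      rw [map_mul, map_ofNat]; ring
    have := Q.sub_mem h2 h1
    rw [h3, hmem] at this
    rcases hPp.mem_or_mem this with h | h
    · exact hP2 h
    · exact htP h
  have hσt : σ t' = t' := σ.commutes t
  have hm1 : ∀ x, x ∈ Q' ↔ σ x ∈ Q := fun x => Iff.rfl
  have hne : Q ≠ Q' := by
    intro h
    apply h2t
    rcases hQ.mem_or_mem hprod with h1 | h1
    · refine ⟨h1, ?_⟩
      rw [h, hm1, map_sub, hσ, hσt] at h1
      rw [← neg_mem_iff]; convert h1 using 1; ring
    · refine ⟨?_, h1⟩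
      rw [h, hm1, map_add, hσ, hσt] at h1
      rw [← neg_mem_iff]; convert h1 using 1; ring
  have hQpr : Prime Q := Ideal.prime_of_isPrime hQ0 hQ
  have hQ'pr : Prime Q' := Ideal.prime_of_isPrime hQ'0 hQ'p
  have hcom' : Q'.comap (algebraMap (𝓞 L) (𝓞 M)) = P := by ext x; exact hmem' x
  have hcop : IsCoprime Q Q' := by
    rw [Ideal.isCoprime_iff_sup_eq]
    exact (hQ.isMaximal hQ0).coprime_of_ne (hQ'p.isMaximal hQ'0) hne
  have hdvd : Q * Q' ∣ P.map (algebraMap (𝓞 L) (𝓞 M)) := by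
    refine hcop.mul_dvd ?_ ?_
    · rw [Ideal.dvd_iff_le, Ideal.map_le_iff_le_comap, hQP]
    · rw [Ideal.dvd_iff_le, Ideal.map_le_iff_le_comap, hcom']
  have hn1 : P ∣ Ideal.relNorm (𝓞 L) Q := Ideal.dvd_iff_le.2 (by rw [← hQP]; exact Ideal.relNorm_le_comap _ _)
  have hn2 : P ∣ Ideal.relNorm (𝓞 L) Q' := Ideal.dvd_iff_le.2 (by rw [← hcom']; exact Ideal.relNorm_le_comap _ _)
  obtain ⟨A, hA⟩ := hn1
  obtain ⟨B, hB⟩ := hn2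
  have hd2 := map_dvd (Ideal.relNorm (𝓞 L)) hdvd
  rw [map_mul, hA, hB, Ideal.relNorm_algebraMap (𝓞 M)] at hd2
  have hAB : A * B ∣ 1 := by
    have hfr : Module.finrank (𝓞 L) (𝓞 M) = 2 := by
      rw [← h2]; exact (Algebra.IsAlgebraic.finrank_of_isFractionRing (𝓞 L) L (𝓞 M) M).symm
    rw [hfr] at hd2
    have : P ^ 2 * (A * B) ∣ P ^ 2 * 1 := by
      convert hd2 using 1 <;> ring
    exact (mul_dvd_mul_iff_left (pow_ne_zero 2 hP.ne_zero)).1 this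
  have hAu : A = 1 := by
    have : A ∣ 1 := (dvd_mul_right A B).trans hAB
    rwa [← isUnit_iff_dvd_one, Ideal.isUnit_iff, ← Ideal.one_eq_top] at this
  have hBu : B = 1 := by
    have : B ∣ 1 := (dvd_mul_left B A).trans hAB
    rwa [← isUnit_iff_dvd_one, Ideal.isUnit_iff, ← Ideal.one_eq_top] at this
  refine ⟨Q, Q', hQpr, hQ'pr, ?_, ?_, hQP, hcom', hne⟩
  · rw [← Ideal.absNorm_relNorm (𝓞 M) (R := 𝓞 L) Q, hA, hAu, mul_one]
  · rw [← Ideal.absNorm_relNorm (𝓞 M) (R := 𝓞 L) Q', hB, hBu, mul_one]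

/-- existence of primes modulo which a given nonsquare is a nonsquare -/
theorem nonresidue {L : Type*} [Field L] [NumberField L] (b : 𝓞 L) (hb : ¬ IsSquare (b : L))
    (n : Ideal (𝓞 L)) (hn : n ≠ ⊥) :
    ∃ P : Ideal (𝓞 L), Prime P ∧ ¬ n ≤ P ∧ (2 : 𝓞 L) ∉ P ∧ b ∉ P ∧ ¬ IsSquare (Ideal.Quotient.mk P b) := by
  classical
  by_contra! hcon
  set f : Polynomial L := Polynomial.X ^ 2 - Polynomial.C (b : L) with hf
  have hdeg : f.natDegree = 2 := by rw [hf]; compute_degree!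
  have hirr : Irreducible f := by
    rw [hf]
    refine X_pow_sub_C_irreducible_of_prime Nat.prime_two (fun c hc => hb ⟨c, by rw [← hc]; ring⟩)
  haveI : Fact (Irreducible f) := ⟨hirr⟩
  let M := AdjoinRoot f
  have hf0 : f ≠ 0 := hirr.ne_zero
  haveI : Module.Finite L M := (AdjoinRoot.powerBasis hf0).finite
  haveI : NumberField M := NumberField.of_module_finite L M
  have h2 : Module.finrank L M = 2 := by
    rw [(AdjoinRoot.powerBasis hf0).finrank, AdjoinRoot.powerBasis_dim, hdeg]
  let β0 : M := AdjoinRoot.root f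
  have hβ0 : β0 ^ 2 = algebraMap L M (b : L) := by
    have := AdjoinRoot.eval₂_root f
    rw [hf] at this
    simp only [Polynomial.eval₂_sub, Polynomial.eval₂_pow, Polynomial.eval₂_X, Polynomial.eval₂_C] at this
    exact sub_eq_zero.1 this
  let σ0 : M →ₐ[L] M := AdjoinRoot.liftAlgHom f (Algebra.ofId L M) (-β0) (by
    simp only [hf, Polynomial.eval₂_sub, Polynomial.eval₂_pow, Polynomial.eval₂_X, Polynomial.eval₂_C, neg_sq]
    rw [hβ0, sub_eq_zero]; rfl)
  let σ1 : M ≃ₐ[L] M := AlgEquiv.ofBijective σ0 (AlgHom.bijective σ0)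
  have hIntg : IsIntegral ℤ β0 := by
    refine IsIntegral.of_pow (n := 2) (by norm_num) ?_
    rw [hβ0]
    exact (b.isIntegral_coe).map ((algebraMap L M).toIntAlgHom)
  let β : 𝓞 M := ⟨β0, hIntg⟩
  have hβ : β ^ 2 = algebraMap (𝓞 L) (𝓞 M) b := by
    apply RingOfIntegers.ext
    exact hβ0
  let σ : 𝓞 M ≃ₐ[𝓞 L] 𝓞 M := RingOfIntegers.mapAlgEquiv σ1
  have hσ : σ β = -β := by
    apply RingOfIntegers.ext
    change σ0 β0 = - β0
    exact AdjoinRoot.liftAlgHom_root _ _ _ _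
  have hb0 : b ≠ 0 := by rintro rfl; exact hb ⟨0, by simp⟩
  set N : Ideal (𝓞 L) := n * Ideal.span {2 * b} with hN
  have hN0 : N ≠ 0 := by
    rw [hN]
    refine mul_ne_zero hn ?_
    rw [Ne, Ideal.zero_eq_bot, Ideal.span_singleton_eq_bot]
    exact mul_ne_zero two_ne_zero hb0
  set T : Finset (Ideal (𝓞 L)) := (normalizedFactors N).toFinset with hT
  have hTm : ∀ P, Prime P → P ∉ T → ¬ N ≤ P := by
    intro P hP hPT hle
    apply hPT
    rw [hT, Multiset.mem_toFinset, mem_normalizedFactors_iff' hN0]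
    exact ⟨hP.irreducible, normalize_eq P, Ideal.dvd_iff_le.2 hle⟩
  have key : ∀ P : Ideal (𝓞 L), ∃ Q : Ideal (𝓞 M) × Ideal (𝓞 M), Prime P → P ∉ T → Prime Q.1 ∧ Prime Q.2 ∧
      Ideal.absNorm Q.1 = Ideal.absNorm P ∧ Ideal.absNorm Q.2 = Ideal.absNorm P ∧
      Q.1.comap (algebraMap (𝓞 L) (𝓞 M)) = P ∧ Q.2.comap (algebraMap (𝓞 L) (𝓞 M)) = P ∧ Q.1 ≠ Q.2 := by
    intro P
    by_cases h : Prime P ∧ P ∉ T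
    · have h1 := hTm P h.1 h.2
      have hn1 : ¬ n ≤ P := fun h => h1 (Ideal.mul_le_left.trans h)
      have hb1 : 2 * b ∉ P := fun h => h1 (Ideal.mul_le_right.trans ((Ideal.span_singleton_le_iff_mem _).2 h))
      have h21 : (2 : 𝓞 L) ∉ P := fun h => hb1 (P.mul_mem_right _ h)
      have hb2 : b ∉ P := fun h => hb1 (P.mul_mem_left _ h)
      obtain ⟨Q1, Q2, hQ⟩ := split_pair h2 b β hβ σ hσ P h.1 h21 hb2 (hcon P h.1 hn1 h21 hb2)
      exact ⟨(Q1, Q2), fun _ _ => hQ⟩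
    · exact ⟨(⊥, ⊥), fun h1 h2 => absurd ⟨h1, h2⟩ h⟩
  choose g hg using key
  refine ZS_final L M ((2 ^ T.card) ^ 2) fun s hs hfin => ?_
  have e1 := ZS_pairs L M (T : Set _) (fun P => (g P).1) (fun P => (g P).2)
    (fun Q => Q.comap (algebraMap (𝓞 L) (𝓞 M))) (fun P hP hPT => hg P hP (by simpa using hPT)) s
  have e2 := ZS_good T (fun P hP => prime_of_normalized_factor P (by rw [hT, Multiset.mem_toFinset] at hP; exact hP)) s hs.le hfin
  calc (ZS (Gd (F := L) ∅) s) ^ 2 ≤ (2 ^ T.card * ZS (Gd (T : Set (Ideal (𝓞 L)))) s) ^ 2 := by gcongr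
    _ = (2 ^ T.card) ^ 2 * (ZS (Gd (T : Set (Ideal (𝓞 L)))) s) ^ 2 := mul_pow _ _ _
    _ ≤ (2 ^ T.card) ^ 2 * ZS (Gd (F := M) ∅) s := by gcongr
    _ = _ := by push_cast; rfl

end CN
end

section
open MeasureTheory Filter Topology
namespace CN
open NumberField nonZeroDivisors

lemma W_index {K : Type*} [Field K] [NumberField K] :
    (powMonoidHom 2 : (𝓞 K ⧸ Ideal.span {(4 : 𝓞 K)})ˣ →* _).range.index ≤ 2 ^ Module.finrank ℚ K := by
  classical
  have h40 : Ideal.span {(4 : 𝓞 K)} ≠ ⊥ := by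
    rw [Ne, Ideal.span_singleton_eq_bot]; norm_num
  have h20 : Ideal.span {(2 : 𝓞 K)} ≠ ⊥ := by
    rw [Ne, Ideal.span_singleton_eq_bot]; norm_num
  haveI : Finite (𝓞 K ⧸ Ideal.span {(4 : 𝓞 K)}) := Ideal.finiteQuotientOfFreeOfNeBot _ h40
  haveI : Finite (𝓞 K ⧸ Ideal.span {(2 : 𝓞 K)}) := Ideal.finiteQuotientOfFreeOfNeBot _ h20
  set f : (𝓞 K ⧸ Ideal.span {(4 : 𝓞 K)})ˣ →* (𝓞 K ⧸ Ideal.span {(4 : 𝓞 K)})ˣ := powMonoidHom 2 with hf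
  have e1 : Nat.card f.range * f.range.index = Nat.card f.ker * f.ker.index := by
    rw [Subgroup.card_mul_index, Subgroup.card_mul_index]
  rw [Subgroup.index_ker, mul_comm] at e1
  have e2 : f.range.index = Nat.card f.ker := Nat.eq_of_mul_eq_mul_right (Nat.card_pos) e1
  rw [e2]
  have hc2 : Nat.card (𝓞 K ⧸ Ideal.span {(2 : 𝓞 K)}) = 2 ^ Module.finrank ℚ K := by
    have h := Ideal.absNorm_span_singleton (2 : 𝓞 K)
    have h' : Algebra.norm ℤ (2 : 𝓞 K) = 2 ^ Module.finrank ℤ (𝓞 K) := by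
      have := Algebra.norm_algebraMap (S := 𝓞 K) (2 : ℤ)
      simpa using this
    rw [h', RingOfIntegers.rank] at h
    rw [← Submodule.cardQuot_apply, ← Ideal.absNorm_apply, h]
    simp [Int.natAbs_pow]
  rw [← hc2]
  have key : ∀ g : f.ker, ∃ y : 𝓞 K, (g.1.1 : 𝓞 K ⧸ Ideal.span {(4 : 𝓞 K)}) = Ideal.Quotient.mk _ (1 + 2 * y) := by
    rintro ⟨g, hg⟩
    obtain ⟨x, hx⟩ := Ideal.Quotient.mk_surjective (g : 𝓞 K ⧸ Ideal.span {(4 : 𝓞 K)})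
    have hg2 : (g : 𝓞 K ⧸ Ideal.span {(4 : 𝓞 K)}) ^ 2 = 1 := by
      have : g ^ 2 = 1 := hg
      rw [← Units.val_pow_eq_pow_val, this]; rfl
    rw [← hx, ← map_pow, ← map_one (Ideal.Quotient.mk _), Ideal.Quotient.eq, Ideal.mem_span_singleton] at hg2
    obtain ⟨w, hw⟩ := hg2
    have hIntg : IsIntegral (𝓞 K) (((x : K) - 1) / 2) := by
      refine ⟨Polynomial.X ^ 2 + Polynomial.X - Polynomial.C w, ?_, ?_⟩
      · monicity!
      · have hwK : (x : K) ^ 2 - 1 = 4 * w := by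
          have := congrArg (algebraMap (𝓞 K) K) hw
          have h4 : algebraMap (𝓞 K) K 4 = 4 := map_ofNat _ 4
          rw [map_sub, map_pow, map_one, map_mul, h4] at this
          exact this
        simp only [Polynomial.eval₂_sub, Polynomial.eval₂_add, Polynomial.eval₂_pow, Polynomial.eval₂_X, Polynomial.eval₂_C]
        linear_combination hwK / 4
    obtain ⟨y, hy⟩ := IsIntegrallyClosed.isIntegral_iff.1 hIntg
    refine ⟨y, ?_⟩
    change (g : 𝓞 K ⧸ Ideal.span {(4 : 𝓞 K)}) = _
    rw [← hx]
    congr 1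
    apply RingOfIntegers.ext
    have h4 : algebraMap (𝓞 K) K 2 = 2 := map_ofNat _ 2
    change (x : K) = algebraMap (𝓞 K) K (1 + 2 * y)
    rw [map_add, map_mul, map_one, h4, hy]; ring
  choose y hy using key
  refine Nat.card_le_card_of_injective (fun g => Ideal.Quotient.mk (Ideal.span {(2 : 𝓞 K)}) (y g)) ?_
  intro g1 g2 h
  apply Subtype.ext
  apply Units.ext
  rw [hy, hy, Ideal.Quotient.eq]
  rw [Ideal.Quotient.eq, Ideal.mem_span_singleton] at h
  obtain ⟨c, hc⟩ := h
  rw [Ideal.mem_span_singleton]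
  exact ⟨c, by linear_combination 2 * hc⟩

section
variable {K : Type*} [Field K] [NumberField K]

lemma not_neg_sq (hK : ∀ φ : K →+* ℂ, ComplexEmbedding.IsReal φ) (x : K) : x ^ 2 ≠ -1 := by
  intro h
  obtain ⟨v⟩ : Nonempty (K →+* ℂ) := inferInstance
  have h1 := congrArg v h
  rw [map_pow, ← real_emb hK v x, map_neg, map_one] at h1
  have h2 : ((v x).re) ^ 2 = -1 := by exact_mod_cast h1
  nlinarith [sq_nonneg (v x).re]

noncomputable def unitv (i : Bool × (Fin (Units.rank K) → Bool)) : (𝓞 K)ˣ :=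
  (-1) ^ i.1.toNat * ∏ k, (Units.fundSystem K k) ^ ((i.2 k).toNat)

lemma unitv_inj (hK : ∀ φ : K →+* ℂ, ComplexEmbedding.IsReal φ) (i j : Bool × (Fin (Units.rank K) → Bool))
    (c : (𝓞 K)ˣ) (h : unitv i * unitv j = c ^ 2) : i = j := by
  obtain ⟨⟨ζ, g⟩, hc, -⟩ := Units.exist_unique_eq_mul_prod K c
  have h1 := Units.fun_eq_repr (K := K) (x := c ^ 2) (ζ := ζ ^ 2) (f := fun k => 2 * g k) (pow_mem ζ.2 2) (by
    rw [hc, mul_pow, ← Finset.prod_pow]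
    congr 1
    refine Finset.prod_congr rfl fun k _ => ?_
    rw [mul_comm, zpow_mul]; norm_cast)
  have hm1 : ∀ n : ℕ, ((-1 : (𝓞 K)ˣ)) ^ n ∈ Units.torsion K := fun n => pow_mem (by
    rw [Units.mem_torsion]; intro w; simp; exact (w.1.map_neg 1).trans (map_one _)) n
  have h2 := Units.fun_eq_repr (K := K) (x := c ^ 2) (ζ := (-1) ^ (i.1.toNat + j.1.toNat))
    (f := fun k => (((i.2 k).toNat + (j.2 k).toNat : ℕ) : ℤ)) (hm1 _) (by
    rw [← h, unitv, unitv, pow_add]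
    have : ∏ k, Units.fundSystem K k ^ (((i.2 k).toNat + (j.2 k).toNat : ℕ) : ℤ) =
        (∏ k, Units.fundSystem K k ^ (i.2 k).toNat) * ∏ k, Units.fundSystem K k ^ (j.2 k).toNat := by
      rw [← Finset.prod_mul_distrib]
      refine Finset.prod_congr rfl fun k _ => ?_
      rw [zpow_natCast, pow_add]
    rw [this]
    exact mul_mul_mul_comm _ _ _ _)
  have h3 : i.2 = j.2 := by
    funext k
    have := congrFun (h1.trans h2.symm) k
    cases h5 : i.2 k <;> cases h6 : j.2 k <;> simp [h5, h6] at this ⊢ <;> omega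
  refine Prod.ext ?_ h3
  rw [unitv, unitv, ← h3] at h
  set p := ∏ k, Units.fundSystem K k ^ (i.2 k).toNat
  by_contra hne
  have hneg : (c * p⁻¹) ^ 2 = -1 := by
    have : (c * p⁻¹) ^ 2 = c ^ 2 * (p⁻¹) ^ 2 := mul_pow _ _ _
    rw [this, ← h]
    have e : ((-1 : (𝓞 K)ˣ)) ^ i.1.toNat * p * ((-1) ^ j.1.toNat * p) * p⁻¹ ^ 2 = (-1) ^ i.1.toNat * (-1) ^ j.1.toNat := by
      rw [mul_mul_mul_comm, mul_assoc]
      have : p * p * p⁻¹ ^ 2 = 1 := by rw [← sq, ← mul_pow, mul_inv_cancel, one_pow]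
      rw [this, mul_one]
    rw [e]
    cases h5 : i.1 <;> cases h6 : j.1 <;> simp [h5, h6] at hne ⊢
  apply not_neg_sq hK (((c * p⁻¹ : (𝓞 K)ˣ) : 𝓞 K) : K)
  have := congrArg (fun w : (𝓞 K)ˣ => ((w : 𝓞 K) : K)) hneg
  simpa using this

end
end CN
end

section
open MeasureTheory Filter Topology
namespace CN
open NumberField nonZeroDivisors
section
variable {K : Type*} [Field K] [NumberField K]

lemma unit4 {R : Type*} [CommRing R] (x : R) (hx : Ideal.span {x} ⊔ Ideal.span {(2 : R)} = ⊤) :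
    IsUnit (Ideal.Quotient.mk (Ideal.span {(4 : R)}) x) := by
  have h1 : (1 : R) ∈ Ideal.span {x} ⊔ Ideal.span {(2 : R)} := by rw [hx]; trivial
  obtain ⟨y, hy, z, hz, h⟩ := Submodule.mem_sup.1 h1
  obtain ⟨a, rfl⟩ := Ideal.mem_span_singleton.1 hy
  obtain ⟨b, rfl⟩ := Ideal.mem_span_singleton.1 hz
  refine isUnit_iff_exists_inv.2 ⟨Ideal.Quotient.mk _ (2 * a - x * a ^ 2), ?_⟩
  rw [← map_mul, ← map_one (Ideal.Quotient.mk _), Ideal.Quotient.eq, Ideal.mem_span_singleton]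
  refine ⟨-b ^ 2, ?_⟩
  have : x * a = 1 - 2 * b := by linear_combination h
  linear_combination (1 - x * a + 2 * b) * this

lemma fiber_rel {G : Type*} [CommGroup G] (a b : G)
    (h : (QuotientGroup.mk a : G ⧸ (powMonoidHom 2 : G →* G).range) = QuotientGroup.mk b) : ∃ w, a * b = w ^ 2 := by
  rw [QuotientGroup.eq] at h
  obtain ⟨w, hw⟩ := h
  refine ⟨w * a, ?_⟩
  have hw' : w ^ 2 = a⁻¹ * b := hw
  rw [mul_pow, hw', sq, mul_comm a⁻¹ b, mul_assoc, inv_mul_cancel_left, mul_comm]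

theorem surjV (hK : ∀ φ : K →+* ℂ, ComplexEmbedding.IsReal φ) (u : 𝓞 K) (hu : u ≠ 0) (A : Ideal (𝓞 K))
    (hA : Ideal.span {u} = A ^ 2) (hAn : ¬ A.IsPrincipal) (hA2 : A ⊔ Ideal.span {2} = ⊤)
    (P : K → Prop) (hP : ∀ a b : K, P a → P b → ¬ IsSquare a → ¬ IsSquare b → IsSquare (a * b))
    (hV : ∀ (ε : (𝓞 K)ˣ) (j : ℕ) (s : 𝓞 K), (ε : 𝓞 K) * u ^ j - s ^ 2 ∈ Ideal.span {(4 : 𝓞 K)} →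
      P (((ε : 𝓞 K) * u ^ j : 𝓞 K) : K))
    (x : 𝓞 K) (hx : Ideal.span {x} ⊔ Ideal.span {2} = ⊤) :
    ∃ (ε : (𝓞 K)ˣ) (j : ℕ) (s : 𝓞 K), x * ((ε : 𝓞 K) * u ^ j) - s ^ 2 ∈ Ideal.span {(4 : 𝓞 K)} := by
  classical
  have h40 : Ideal.span {(4 : 𝓞 K)} ≠ ⊥ := by
    rw [Ne, Ideal.span_singleton_eq_bot]; norm_num
  have : Finite (𝓞 K ⧸ Ideal.span {(4 : 𝓞 K)}) := Ideal.finiteQuotientOfFreeOfNeBot _ h40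
  have hu2 : Ideal.span {u} ⊔ Ideal.span {2} = ⊤ := by
    rw [hA, ← Ideal.isCoprime_iff_sup_eq]
    exact (Ideal.isCoprime_iff_sup_eq.2 hA2).pow_left
  obtain ⟨U, hU⟩ := unit4 u hu2
  obtain ⟨X, hX⟩ := unit4 x hx
  let I := (Bool × (Fin (Units.rank K) → Bool)) × Bool
  let val : I → 𝓞 K := fun i => (unitv i.1 : 𝓞 K) * u ^ i.2.toNat
  let valU : I → (𝓞 K ⧸ Ideal.span {(4 : 𝓞 K)})ˣ := fun i =>
    Units.map (Ideal.Quotient.mk (Ideal.span {(4 : 𝓞 K)})).toMonoidHom (unitv i.1) * U ^ i.2.toNat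
  have hvalU : ∀ i, ((valU i : (𝓞 K ⧸ Ideal.span {(4 : 𝓞 K)})ˣ) : 𝓞 K ⧸ Ideal.span {(4 : 𝓞 K)}) =
      Ideal.Quotient.mk _ (val i) := by
    intro i
    simp only [valU, val, Units.val_mul, Units.val_pow_eq_pow_val, hU, map_mul, map_pow]
    rfl
  have hval0 : ∀ i, ((val i : 𝓞 K) : K) ≠ 0 := fun i => by
    rw [Ne, RingOfIntegers.coe_eq_zero_iff]
    exact mul_ne_zero (unitv i.1).ne_zero (pow_ne_zero _ hu)
  have hprod : ∀ i k, val i * val k = ((unitv i.1 * unitv k.1 : (𝓞 K)ˣ) : 𝓞 K) * u ^ (i.2.toNat + k.2.toNat) := by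
    intro i k
    simp only [val, Units.val_mul, pow_add]; ring
  have hinj : ∀ i k, IsSquare ((val i * val k : 𝓞 K) : K) → i = k := by
    rintro i k ⟨c, hc⟩
    have hcint : IsIntegral (𝓞 K) c := by
      refine IsIntegral.of_pow (n := 2) (by norm_num) ?_
      rw [sq, ← hc]; exact isIntegral_algebraMap
    obtain ⟨c, rfl⟩ := IsIntegrallyClosed.isIntegral_iff.1 hcint
    have hc' : val i * val k = c ^ 2 := by
      apply RingOfIntegers.ext
      rw [hc, sq]
      exact (map_mul _ _ _).symm
    rw [hprod] at hc'
    set η := unitv i.1 * unitv k.1 with hη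
    have hj : i.2 = k.2 := by
      by_contra hne
      have h1 : i.2.toNat + k.2.toNat = 1 := by
        cases h5 : i.2 <;> cases h6 : k.2 <;> simp [h5, h6] at hne ⊢
      rw [h1, pow_one] at hc'
      apply hAn
      have h3 : A ^ 2 = Ideal.span {c} ^ 2 := by
        rw [← hA, Ideal.span_singleton_pow, ← hc', Ideal.span_singleton_mul_left_unit η.isUnit]
      have h4 : A = Ideal.span {c} := by
        have := pow_left_injective (M := Ideal (𝓞 K)) (n := 2) (by norm_num)
        exact this h3
      rw [h4]
      exact ⟨⟨c, rfl⟩⟩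
    refine Prod.ext ?_ hj
    have hdv : ∃ e : 𝓞 K, (η : 𝓞 K) = e ^ 2 := by
      rw [← hj] at hc'
      rcases h5 : i.2 with _ | _
      · rw [h5] at hc'
        exact ⟨c, by simpa using hc'⟩
      · rw [h5] at hc'
        have h6 : (η : 𝓞 K) * u ^ 2 = c ^ 2 := by simpa using hc'
        have : u ∣ c := by
          have : u ^ 2 ∣ c ^ 2 := ⟨η, by rw [← h6]; ring⟩
          exact (IsIntegrallyClosed.pow_dvd_pow_iff two_ne_zero).1 this
        obtain ⟨e, rfl⟩ := this
        refine ⟨e, mul_right_cancel₀ (pow_ne_zero 2 hu) ?_⟩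
        rw [h6]; ring
    obtain ⟨e, he⟩ := hdv
    have heu : IsUnit e := by
      have : IsUnit (e ^ 2) := by rw [← he]; exact η.isUnit
      exact (isUnit_pow_iff two_ne_zero).1 this
    refine unitv_inj hK i.1 k.1 heu.unit ?_
    apply Units.ext
    rw [← hη, he]; rfl
  let S := (powMonoidHom 2 : (𝓞 K ⧸ Ideal.span {(4 : 𝓞 K)})ˣ →* (𝓞 K ⧸ Ideal.span {(4 : 𝓞 K)})ˣ).range
  let F : I → (𝓞 K ⧸ Ideal.span {(4 : 𝓞 K)})ˣ ⧸ S := fun i => QuotientGroup.mk (valU i)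
  have hlift : ∀ (y : 𝓞 K) (Y w : (𝓞 K ⧸ Ideal.span {(4 : 𝓞 K)})ˣ), (Y : 𝓞 K ⧸ Ideal.span {(4 : 𝓞 K)}) = Ideal.Quotient.mk _ y →
      Y = w ^ 2 → ∃ s, y - s ^ 2 ∈ Ideal.span {(4 : 𝓞 K)} := by
    intro y Y w hY hw
    obtain ⟨s, hs⟩ := Ideal.Quotient.mk_surjective (w : 𝓞 K ⧸ Ideal.span {(4 : 𝓞 K)})
    refine ⟨s, ?_⟩
    rw [← Ideal.Quotient.eq, ← hY, map_pow, hs, hw]; rfl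
  have hF : ∀ i k, F i = F k → P ((val i * val k : 𝓞 K) : K) := by
    intro i k h
    obtain ⟨w, hw⟩ := fiber_rel _ _ h
    obtain ⟨s, hs⟩ := hlift (val i * val k) (valU i * valU k) w (by rw [Units.val_mul, hvalU, hvalU]; exact (map_mul _ _ _).symm) hw
    rw [hprod] at hs ⊢
    exact hV _ _ s hs
  have hnsq : ∀ i k, i ≠ k → ¬ IsSquare ((val i * val k : 𝓞 K) : K) := fun i k hne h => hne (hinj i k h)
  letI : Fintype ((𝓞 K ⧸ Ideal.span {(4 : 𝓞 K)})ˣ ⧸ S) := Fintype.ofFinite _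
  have hcard := Finset.card_le_mul_card_image (f := F) Finset.univ 2 (by
    intro q _
    by_contra! hlt
    obtain ⟨a, ha, b, hb, c, hc, hab, hac, hbc⟩ := Finset.two_lt_card.1 hlt
    simp only [Finset.mem_filter, Finset.mem_univ, true_and] at ha hb hc
    have hsq := hP _ _ (hF a b (ha.trans hb.symm)) (hF a c (ha.trans hc.symm)) (hnsq a b hab) (hnsq a c hac)
    apply hnsq b c hbc
    obtain ⟨r, hr⟩ := hsq
    refine ⟨r / val a, ?_⟩
    have h0 := hval0 a
    rw [div_mul_div_comm, ← hr, eq_div_iff (mul_ne_zero h0 h0)]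
    push_cast
    ring)
  have hn : Units.rank K + 1 = Module.finrank ℚ K := by
    have : IsTotallyReal K := ⟨fun w => by
      rw [← InfinitePlace.mk_embedding w, InfinitePlace.isReal_mk_iff]
      exact hK _⟩
    rw [IsTotallyReal.finrank, Units.rank]
    have h0 := IsTotallyReal.nrComplexPlaces_eq_zero K
    have h1 := InfinitePlace.card_eq_nrRealPlaces_add_nrComplexPlaces K
    have h2 : 0 < Fintype.card (InfinitePlace K) := Fintype.card_pos
    omega
  have hI : (Finset.univ : Finset I).card = 2 ^ (Module.finrank ℚ K) * 2 := by
    rw [← hn]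
    simp [I, pow_succ]; ring
  have hW : Fintype.card ((𝓞 K ⧸ Ideal.span {(4 : 𝓞 K)})ˣ ⧸ S) ≤ 2 ^ Module.finrank ℚ K := by
    rw [← Nat.card_eq_fintype_card]
    exact W_index
  have himg : Finset.univ.image F = Finset.univ := by
    apply Finset.eq_univ_of_card
    refine le_antisymm (Finset.card_le_univ _) ?_
    rw [hI] at hcard
    omega
  have hXm : (QuotientGroup.mk X : (𝓞 K ⧸ Ideal.span {(4 : 𝓞 K)})ˣ ⧸ S) ∈ Finset.univ.image F := by
    rw [himg]; exact Finset.mem_univ _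
  obtain ⟨i, -, hi⟩ := Finset.mem_image.1 hXm
  obtain ⟨w, hw⟩ := fiber_rel _ _ hi
  obtain ⟨s, hs⟩ := hlift (x * val i) (valU i * X) w (by rw [Units.val_mul, hvalU, hX, mul_comm]; exact (map_mul _ _ _).symm) hw
  exact ⟨unitv i.1, i.2.toNat, s, hs⟩

end
end CN
end

section
open MeasureTheory Filter Topology
namespace CN
open NumberField nonZeroDivisors
section
variable {K L : Type*} [Field K] [NumberField K] [Field L] [NumberField L] [Algebra K L]

lemma span2 (h2 : Module.finrank K L = 2) (γ : L) (hγ : ∀ y : K, algebraMap K L y ≠ γ) (δ : L) :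
    ∃ p q : K, δ = algebraMap K L p + algebraMap K L q * γ := by
  have hli : LinearIndependent K ![(1 : L), γ] := by
    rw [LinearIndependent.pair_iff]
    intro s t hst
    have ht : t = 0 := by
      by_contra ht
      apply hγ (-s / t)
      have ht' : algebraMap K L t ≠ 0 := by simpa using ht
      rw [Algebra.smul_def, Algebra.smul_def] at hst
      rw [map_div₀, map_neg, div_eq_iff ht']
      linear_combination -hst
    subst ht
    simp at hst
    exact ⟨hst, rfl⟩
  have hsp := hli.span_eq_top_of_card_eq_finrank (by simp [h2])
  have hδ : δ ∈ Submodule.span K (Set.range ![(1 : L), γ]) := by rw [hsp]; trivial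
  rw [Matrix.range_cons, Matrix.range_cons, Matrix.range_empty, Set.union_empty, Set.singleton_union,
    Submodule.mem_span_pair] at hδ
  obtain ⟨p, q, h⟩ := hδ
  refine ⟨p, q, ?_⟩
  rw [← h, Algebra.smul_def, Algebra.smul_def, mul_one]

lemma sqL_mul (h2 : Module.finrank K L = 2) (a b : K) (ha : IsSquare (algebraMap K L a)) (hb : IsSquare (algebraMap K L b))
    (ha' : ¬ IsSquare a) (hb' : ¬ IsSquare b) : IsSquare (a * b) := by
  obtain ⟨γ, hγ⟩ := ha
  obtain ⟨δ, hδ⟩ := hb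
  have hinj := (algebraMap K L).injective
  have hγK : ∀ y : K, algebraMap K L y ≠ γ := by
    rintro y rfl
    exact ha' ⟨y, hinj (by rw [hγ, map_mul])⟩
  obtain ⟨p, q, hpq⟩ := span2 h2 γ hγK δ
  have h3 : 2 * p * q = 0 := by
    by_contra hne
    apply hγK ((b - p ^ 2 - q ^ 2 * a) / (2 * p * q))
    have hne' : algebraMap K L (2 * p * q) ≠ 0 := by simpa using hne
    rw [map_div₀, div_eq_iff hne']
    simp only [map_sub, map_mul, map_pow, map_ofNat]
    rw [hδ, hγ, hpq]; ring
  rcases mul_eq_zero.1 h3 with h | h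
  · have hp : p = 0 := by simpa using h
    refine ⟨q * a, hinj ?_⟩
    simp only [map_mul]
    rw [hδ, hpq, hp, hγ]; simp; ring
  · exfalso
    apply hb'
    refine ⟨p, hinj ?_⟩
    rw [hδ, hpq, h]; simp

lemma exists_ext (v : K →+* ℂ) : ∃ φ : L →+* ℂ, φ.comp (algebraMap K L) = v := by
  letI := v.toAlgebra
  let φ : L →ₐ[K] ℂ := IsAlgClosed.lift
  exact ⟨φ.toRingHom, φ.comp_algebraMap⟩

lemma not_sqL_of_pos (hK : ∀ φ : K →+* ℂ, ComplexEmbedding.IsReal φ) (hL : ∀ φ : L →+* ℂ, ¬ ComplexEmbedding.IsReal φ)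
    (h2 : Module.finrank K L = 2) (u : K) (hu : ∀ v : K →+* ℂ, 0 < (v u).re) (hsq : ¬ IsSquare u) :
    ¬ IsSquare (algebraMap K L u) := by
  rintro ⟨γ, hγ⟩
  have hγK : ∀ y : K, algebraMap K L y ≠ γ := by
    rintro y rfl
    exact hsq ⟨y, (algebraMap K L).injective (by rw [hγ, map_mul])⟩
  obtain ⟨v⟩ : Nonempty (K →+* ℂ) := inferInstance
  obtain ⟨φ, hφ⟩ := exists_ext (L := L) v
  apply hL φ
  have hφK : ∀ y : K, φ (algebraMap K L y) = v y := fun y => by rw [← hφ]; rfl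
  have hre : (starRingEnd ℂ) (φ γ) = φ γ := by
    have h1 : φ γ * φ γ = (((v u).re : ℝ) : ℂ) := by rw [← map_mul, ← hγ, hφK, real_emb hK]
    have h3 := hu v
    have hr := congrArg Complex.re h1
    have hi := congrArg Complex.im h1
    simp at hr hi
    rw [Complex.conj_eq_iff_im]
    have : (φ γ).re = 0 ∨ (φ γ).im = 0 := by
      rcases mul_eq_zero.1 (show (φ γ).re * (φ γ).im = 0 by linarith) with h | h
      · exact Or.inl h
      · exact Or.inr h
    rcases this with h | h
    · rw [h] at hr; nlinarith [sq_nonneg (φ γ).im]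
    · exact h
  ext δ
  obtain ⟨p, q, rfl⟩ := span2 h2 γ hγK δ
  simp only [ComplexEmbedding.conjugate_coe_eq, map_add, map_mul, hφK, hre]
  rw [← real_emb hK v p, ← real_emb hK v q, Complex.conj_ofReal, Complex.conj_ofReal]

lemma norm_pos (hK : ∀ φ : K →+* ℂ, ComplexEmbedding.IsReal φ) (hL : ∀ φ : L →+* ℂ, ¬ ComplexEmbedding.IsReal φ)
    (h2 : Module.finrank K L = 2) (x : L) (hx : x ≠ 0) (v : K →+* ℂ) : 0 < (v (Algebra.norm K x)).re := by
  classical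
  letI := v.toAlgebra
  have hn := Algebra.norm_eq_prod_embeddings K ℂ x
  let φ : L →ₐ[K] ℂ := IsAlgClosed.lift
  let ψ : L →ₐ[K] ℂ := { ComplexEmbedding.conjugate φ.toRingHom with
    commutes' := fun r => by
      have h1 : φ (algebraMap K L r) = algebraMap K ℂ r := φ.commutes r
      have h3 : (starRingEnd ℂ) (φ (algebraMap K L r)) = algebraMap K ℂ r := by
        rw [h1]
        exact RingHom.congr_fun (hK v) r
      exact h3 }
  have hne : φ ≠ ψ := by
    intro h
    apply hL φ.toRingHom
    ext y
    exact (AlgHom.congr_fun h y).symm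
  have hcard : Fintype.card (L →ₐ[K] ℂ) = 2 := by rw [AlgHom.card, h2]
  have huniv : (Finset.univ : Finset (L →ₐ[K] ℂ)) = {φ, ψ} := by
    symm
    apply Finset.eq_univ_of_card
    rw [Finset.card_pair hne, hcard]
  rw [huniv, Finset.prod_pair hne] at hn
  have h3 : v (Algebra.norm K x) = ((‖φ x‖ ^ 2 : ℝ) : ℂ) := by
    change algebraMap K ℂ (Algebra.norm K x) = _
    rw [hn]
    change φ x * (starRingEnd ℂ) (φ x) = _
    rw [Complex.mul_conj']; norm_cast
  rw [h3, Complex.ofReal_re]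
  have : φ x ≠ 0 := by simpa using hx
  positivity

lemma intNorm_pos (hK : ∀ φ : K →+* ℂ, ComplexEmbedding.IsReal φ) (hL : ∀ φ : L →+* ℂ, ¬ ComplexEmbedding.IsReal φ)
    (h2 : Module.finrank K L = 2) (x : 𝓞 L) (hx : x ≠ 0) (v : K →+* ℂ) :
    0 < (v (Algebra.intNorm (𝓞 K) (𝓞 L) x : 𝓞 K)).re := by
  have h := Algebra.algebraMap_intNorm (A := 𝓞 K) (K := K) (L := L) (B := 𝓞 L) x
  have h3 : ((Algebra.intNorm (𝓞 K) (𝓞 L) x : 𝓞 K) : K) = Algebra.norm K (x : L) := h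
  rw [h3]
  exact norm_pos hK hL h2 _ (by simpa using hx) v

end
end CN
end

section
open MeasureTheory Filter Topology
namespace CN
open NumberField nonZeroDivisors
section
variable {K L : Type*} [Field K] [NumberField K] [Field L] [NumberField L] [Algebra K L]

lemma relNorm_map2 (h2 : Module.finrank K L = 2) (B : Ideal (𝓞 K)) :
    Ideal.relNorm (𝓞 K) (B.map (algebraMap (𝓞 K) (𝓞 L))) = B ^ 2 := by
  have hfr : Module.finrank (𝓞 K) (𝓞 L) = 2 := by
    rw [← h2]; exact (Algebra.IsAlgebraic.finrank_of_isFractionRing (𝓞 K) K (𝓞 L) L).symm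
  rw [Ideal.relNorm_algebraMap (𝓞 L), hfr]

lemma ringChar_ne_two {k : Type*} [Field k] (h : (2 : k) ≠ 0) : ringChar k ≠ 2 := by
  intro hk
  apply h
  have := ringChar.Nat.cast_ringChar (R := k)
  rw [hk] at this
  exact_mod_cast this

lemma degree_one (h2 : Module.finrank K L = 2) (P : Ideal (𝓞 L)) (hP : Prime P) (hP2 : (2 : 𝓞 L) ∉ P) (b : 𝓞 K)
    (hb : algebraMap (𝓞 K) (𝓞 L) b ∉ P) (hns : ¬ IsSquare (Ideal.Quotient.mk P (algebraMap (𝓞 K) (𝓞 L) b))) :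
    ∃ p : Ideal (𝓞 K), Prime p ∧ Ideal.relNorm (𝓞 K) P = p ∧ (2 : 𝓞 K) ∉ p ∧ b ∉ p ∧
      ¬ IsSquare (Ideal.Quotient.mk p b) := by
  classical
  have hPp : P.IsPrime := Ideal.isPrime_of_prime hP
  set p := P.comap (algebraMap (𝓞 K) (𝓞 L)) with hp
  have hpp : p.IsPrime := Ideal.comap_isPrime _ _
  have hp0 : p ≠ ⊥ := by
    intro h
    have h1 : Ideal.relNorm (𝓞 K) P ≤ p := Ideal.relNorm_le_comap _ _
    rw [h, le_bot_iff, Ideal.relNorm_eq_bot_iff] at h1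
    exact hP.ne_zero h1
  have hmem : ∀ x : 𝓞 K, x ∈ p ↔ algebraMap (𝓞 K) (𝓞 L) x ∈ P := fun x => Iff.rfl
  have hppr : Prime p := Ideal.prime_of_isPrime hp0 hpp
  have hbp : b ∉ p := fun h => hb ((hmem b).1 h)
  have h2p : (2 : 𝓞 K) ∉ p := fun h => hP2 (by
    have := (hmem 2).1 h
    rwa [map_ofNat] at this)
  have hPL : P.LiesOver p := ⟨rfl⟩
  obtain ⟨s, hs⟩ := Ideal.exists_relNorm_eq_pow_of_isPrime (R := 𝓞 K) P p
  have hs2 : s ≤ 2 := by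
    have hd : P ∣ p.map (algebraMap (𝓞 K) (𝓞 L)) := by
      rw [Ideal.dvd_iff_le, Ideal.map_le_iff_le_comap]
    have := map_dvd (Ideal.relNorm (𝓞 K)) hd
    rw [hs, relNorm_map2 h2] at this
    exact (pow_dvd_pow_iff hppr.ne_zero hppr.not_unit).1 this
  have hs0 : s ≠ 0 := by
    rintro rfl
    have h1 : Ideal.relNorm (𝓞 K) P ≤ p := Ideal.relNorm_le_comap _ _
    rw [hs, pow_zero, Ideal.one_eq_top, top_le_iff] at h1
    exact hpp.ne_top h1
  have hs2' : s ≠ 2 := by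
    rintro rfl
    apply hns
    have hc : Ideal.absNorm P = Ideal.absNorm p ^ 2 := by
      rw [← Ideal.absNorm_relNorm (𝓞 L) (R := 𝓞 K) P, hs, map_pow]
    have : P.IsMaximal := hPp.isMaximal hP.ne_zero
    have : p.IsMaximal := hpp.isMaximal hp0
    letI : Field (𝓞 L ⧸ P) := Ideal.Quotient.field P
    letI : Field (𝓞 K ⧸ p) := Ideal.Quotient.field p
    have : Finite (𝓞 L ⧸ P) := Ideal.finiteQuotientOfFreeOfNeBot _ hP.ne_zero
    have : Finite (𝓞 K ⧸ p) := Ideal.finiteQuotientOfFreeOfNeBot _ hp0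
    letI : Fintype (𝓞 L ⧸ P) := Fintype.ofFinite _
    letI : Fintype (𝓞 K ⧸ p) := Fintype.ofFinite _
    have hcP : Fintype.card (𝓞 L ⧸ P) = Ideal.absNorm p ^ 2 := by
      rw [← hc, Ideal.absNorm_apply, Submodule.cardQuot_apply, Nat.card_eq_fintype_card]
    have hcp : Fintype.card (𝓞 K ⧸ p) = Ideal.absNorm p := by
      rw [Ideal.absNorm_apply, Submodule.cardQuot_apply, Nat.card_eq_fintype_card]
    set q := Ideal.absNorm p with hq
    have h2P' : (2 : 𝓞 L ⧸ P) ≠ 0 := by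
      have : (2 : 𝓞 L ⧸ P) = Ideal.Quotient.mk P 2 := (map_ofNat _ 2).symm
      rw [this, Ne, Ideal.Quotient.eq_zero_iff_mem]; exact hP2
    have h2p' : (2 : 𝓞 K ⧸ p) ≠ 0 := by
      have : (2 : 𝓞 K ⧸ p) = Ideal.Quotient.mk p 2 := (map_ofNat _ 2).symm
      rw [this, Ne, Ideal.Quotient.eq_zero_iff_mem]; exact h2p
    have hodd : q % 2 = 1 := by
      rw [← hcp]
      exact FiniteField.odd_card_of_char_ne_two (ringChar_ne_two h2p')
    have hb0 : Ideal.Quotient.mk P (algebraMap (𝓞 K) (𝓞 L) b) ≠ 0 := by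
      rw [Ne, Ideal.Quotient.eq_zero_iff_mem]; exact hb
    rw [FiniteField.isSquare_iff (ringChar_ne_two h2P') hb0, hcP]
    have hq1 : 1 ≤ q := by omega
    obtain ⟨t, ht⟩ : ∃ t, q = 2 * t + 1 := ⟨q / 2, by omega⟩
    have hexp : q ^ 2 / 2 = (q - 1) * (t + 1) := by
      rw [ht]
      have : (2 * t + 1) ^ 2 = 2 * ((2 * t + 1 - 1) * (t + 1)) + 1 := by
        rw [Nat.add_sub_cancel]; ring
      omega
    have hfl : (Ideal.Quotient.mk p b) ^ (q - 1) = 1 := by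
      rw [← hcp]
      exact FiniteField.pow_card_sub_one_eq_one _ (by rw [Ne, Ideal.Quotient.eq_zero_iff_mem]; exact hbp)
    have hfl2 : (Ideal.Quotient.mk P (algebraMap (𝓞 K) (𝓞 L) b)) ^ (q - 1) = 1 := by
      rw [← map_pow, ← map_one (Ideal.Quotient.mk p), Ideal.Quotient.eq, hmem, map_sub, map_pow, map_one] at hfl
      rw [← map_pow, ← map_one (Ideal.Quotient.mk P), Ideal.Quotient.eq]
      exact hfl
    rw [hexp, pow_mul, hfl2, one_pow]
  have hs1 : s = 1 := by omega
  refine ⟨p, hppr, by rw [hs, hs1, pow_one], h2p, hbp, ?_⟩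
  rintro ⟨t, ht⟩
  obtain ⟨t, rfl⟩ := Ideal.Quotient.mk_surjective t
  rw [← map_mul, Ideal.Quotient.eq, hmem, map_sub, map_mul] at ht
  exact hns ⟨Ideal.Quotient.mk P (algebraMap (𝓞 K) (𝓞 L) t), by rw [← map_mul, Ideal.Quotient.eq]; exact ht⟩

lemma step2 (hK : ∀ φ : K →+* ℂ, ComplexEmbedding.IsReal φ) (hL : ∀ φ : L →+* ℂ, ¬ ComplexEmbedding.IsReal φ)
    (h2 : Module.finrank K L = 2) (P : Ideal (𝓞 L)) (p : Ideal (𝓞 K)) (hp : Prime p) (hN : Ideal.relNorm (𝓞 K) P = p)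
    (k : ℕ) (B : Ideal (𝓞 K)) (hB : B ≠ ⊥) (x y : 𝓞 L) (hx : x ≠ 0) (hy : y ≠ 0)
    (hxy : Ideal.span {x} * P ^ (2 * k + 1) = Ideal.span {y} * B.map (algebraMap (𝓞 K) (𝓞 L)))
    (n : Ideal (𝓞 K)) (hn : n ≠ ⊥) :
    ∃ (z : 𝓞 K) (R : Ideal (𝓞 K)), z ≠ 0 ∧ Ideal.span {z} = p * R ^ 2 ∧ R ⊔ n = ⊤ ∧ ∀ v : K →+* ℂ, 0 < (v z).re := by
  have h1 := congrArg (Ideal.relNorm (𝓞 K)) hxy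
  rw [map_mul, map_mul, map_pow, Ideal.relNorm_singleton, Ideal.relNorm_singleton, hN, relNorm_map2 h2] at h1
  set X := Algebra.intNorm (𝓞 K) (𝓞 L) x with hX
  set Y := Algebra.intNorm (𝓞 K) (𝓞 L) y with hY
  have hXp := intNorm_pos hK hL h2 x hx
  have hYp := intNorm_pos hK hL h2 y hy
  have hY0 : Y ≠ 0 := Algebra.intNorm_ne_zero.2 hy
  obtain ⟨δ, hδ, hδ0⟩ := Submodule.exists_mem_ne_zero_of_ne_bot (pow_ne_zero (k + 1) hp.ne_zero : p ^ (k + 1) ≠ ⊥)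
  obtain ⟨D', hD'⟩ := Ideal.dvd_iff_le.2 ((Ideal.span_singleton_le_iff_mem _).2 hδ)
  have hD'0 : D' ≠ ⊥ := by
    rintro rfl
    rw [Ideal.mul_bot, Ideal.span_singleton_eq_bot] at hD'
    exact hδ0 hD'
  set I := Ideal.span {Y} * B * D' with hI
  have hI0 : I ≠ ⊥ := by
    refine mul_ne_zero (mul_ne_zero ?_ hB) hD'0
    rwa [Ne, Ideal.zero_eq_bot, Ideal.span_singleton_eq_bot]
  obtain ⟨A, r, t, hA0, hAn, hr, ht, hrt⟩ := moving I n hI0 hn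
  have key : Ideal.span {X * Y * δ ^ 2 * t ^ 2} = Ideal.span {r} ^ 2 * (p * A ^ 2) := by
    have e1 : Ideal.span {X * Y * δ ^ 2 * t ^ 2} = Ideal.span {X} * Ideal.span {Y} * Ideal.span {δ} ^ 2 * Ideal.span {t} ^ 2 := by
      simp only [Ideal.span_singleton_mul_span_singleton, Ideal.span_singleton_pow]
    rw [e1, hD']
    calc Ideal.span {X} * Ideal.span {Y} * (p ^ (k + 1) * D') ^ 2 * Ideal.span {t} ^ 2
        = (Ideal.span {X} * p ^ (2 * k + 1)) * Ideal.span {Y} * p * D' ^ 2 * Ideal.span {t} ^ 2 := by ring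
      _ = p * (Ideal.span {t} * I) ^ 2 := by rw [h1, hI]; ring
      _ = Ideal.span {r} ^ 2 * (p * A ^ 2) := by rw [← hrt]; ring
  have hdv : r ^ 2 ∣ X * Y * δ ^ 2 * t ^ 2 := by
    rw [← Ideal.span_singleton_le_span_singleton, key, Ideal.span_singleton_pow]
    exact Ideal.mul_le_left
  obtain ⟨z, hz⟩ := hdv
  have hX0 : X ≠ 0 := Algebra.intNorm_ne_zero.2 hx
  have hz0 : z ≠ 0 := by
    rintro rfl
    rw [mul_zero] at hz
    exact mul_ne_zero (mul_ne_zero (mul_ne_zero hX0 hY0) (pow_ne_zero 2 hδ0)) (pow_ne_zero 2 ht) hz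
  refine ⟨z, A, hz0, ?_, hAn, ?_⟩
  · rw [hz, ← Ideal.span_singleton_mul_span_singleton, ← Ideal.span_singleton_pow] at key
    refine mul_left_cancel₀ (pow_ne_zero 2 ?_) key
    rwa [Ne, Ideal.zero_eq_bot, Ideal.span_singleton_eq_bot]
  · intro v
    have hv := congrArg (fun w : 𝓞 K => v (w : K)) hz
    simp only [map_mul, map_pow] at hv
    rw [← real_emb hK v X, ← real_emb hK v Y, ← real_emb hK v δ, ← real_emb hK v t, ← real_emb hK v r,
      ← real_emb hK v z] at hv
    have hv' : (v X).re * (v Y).re * (v δ).re ^ 2 * (v t).re ^ 2 = (v r).re ^ 2 * (v z).re := by exact_mod_cast hv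
    have hne : ∀ w : 𝓞 K, w ≠ 0 → 0 < (v w).re ^ 2 := by
      intro w hw
      have : v w ≠ 0 := by simpa using hw
      have : (v w).re ≠ 0 := fun h => this (by rw [← real_emb hK v w, h]; simp)
      positivity
    have h3 : 0 < (v r).re ^ 2 * (v z).re := by
      rw [← hv']
      exact mul_pos (mul_pos (mul_pos (hXp v) (hYp v)) (hne δ hδ0)) (hne t ht)
    exact (pos_iff_pos_of_mul_pos h3).1 (hne r hr)

end
end CN
end

section
open MeasureTheory Filter Topology
namespace CN
open NumberField nonZeroDivisors
section
variable {K L : Type*} [Field K] [NumberField K] [Field L] [NumberField L] [Algebra K L]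

lemma coreHelper (hK : ∀ φ : K →+* ℂ, ComplexEmbedding.IsReal φ) (hL : ∀ φ : L →+* ℂ, ¬ ComplexEmbedding.IsReal φ)
    (h2 : Module.finrank K L = 2) (u : 𝓞 K) (hu : u ≠ 0) (A : Ideal (𝓞 K))
    (hA : Ideal.span {u} = A ^ 2) (hA2 : A ⊔ Ideal.span {2} = ⊤)
    (hodd : ∀ P : Ideal (𝓞 L), P ≠ ⊥ → ∃ (k : ℕ) (B : Ideal (𝓞 K)) (x y : 𝓞 L), B ≠ ⊥ ∧ x ≠ 0 ∧ y ≠ 0 ∧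
      Ideal.span {x} * P ^ (2 * k + 1) = Ideal.span {y} * B.map (algebraMap (𝓞 K) (𝓞 L)))
    (ε : (𝓞 K)ˣ) (j : ℕ) (hns : ¬ IsSquare (algebraMap K L (((ε : 𝓞 K) * u ^ j : 𝓞 K) : K)))
    (hH : ∀ x : 𝓞 K, (∀ v : K →+* ℂ, 0 < (v x).re) → Ideal.span {x} ⊔ Ideal.span {2} = ⊤ →
      ∃ (ε' : (𝓞 K)ˣ) (j' : ℕ), ((∃ s, (ε : 𝓞 K) * u ^ j - s ^ 2 ∈ Ideal.span {(4 : 𝓞 K)}) ∨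
        (∃ s, x * ((ε' : 𝓞 K) * u ^ j') - s ^ 2 ∈ Ideal.span {(4 : 𝓞 K)})) ∧
        ∀ v : K →+* ℂ, 0 < (v (((ε : 𝓞 K) * u ^ j : 𝓞 K) : K)).re ∨ 0 < (v ((x * ((ε' : 𝓞 K) * u ^ j') : 𝓞 K) : K)).re) :
    False := by
  have hinj := FaithfulSMul.algebraMap_injective (𝓞 K) (𝓞 L)
  set a : 𝓞 K := (ε : 𝓞 K) * u ^ j with ha
  have ha0 : a ≠ 0 := mul_ne_zero ε.ne_zero (pow_ne_zero _ hu)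
  have hu' : Ideal.span {algebraMap (𝓞 K) (𝓞 L) u} ≠ ⊥ := by
    rw [Ne, Ideal.span_singleton_eq_bot, map_eq_zero_iff _ hinj]; exact hu
  obtain ⟨P, hP, hPu, hP2, hPa, hPns⟩ := nonresidue (algebraMap (𝓞 K) (𝓞 L) a) hns _ hu'
  rw [Ideal.span_singleton_le_iff_mem] at hPu
  obtain ⟨p, hp, hNp, hp2, hap, hpns⟩ := degree_one h2 P hP hP2 a hPa hPns
  have hup : u ∉ p := fun h => hPu (by
    rw [← hNp] at h
    have hle : Ideal.relNorm (𝓞 K) P ≤ P.comap (algebraMap (𝓞 K) (𝓞 L)) := Ideal.relNorm_le_comap _ _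
    exact hle h)
  have hpp : p.IsPrime := Ideal.isPrime_of_prime hp
  have hpm : p.IsMaximal := hpp.isMaximal hp.ne_zero
  have hAp : IsCoprime A p := by
    rw [Ideal.isCoprime_iff_sup_eq, sup_comm]
    refine hpm.1.2 _ (lt_of_le_of_ne le_sup_left fun h => hup ?_)
    have h1 : A ≤ p := by rw [h]; exact le_sup_right
    refine h1 (Ideal.pow_le_self two_ne_zero ?_)
    rw [← hA]; exact Ideal.mem_span_singleton_self u
  have h2p : IsCoprime p (Ideal.span {(2 : 𝓞 K)}) := by
    rw [Ideal.isCoprime_iff_sup_eq]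
    refine hpm.1.2 _ (lt_of_le_of_ne le_sup_left fun h => hp2 ?_)
    rw [h]; exact Ideal.mem_sup_right (Ideal.mem_span_singleton_self _)
  have hA2' : IsCoprime A (Ideal.span {(2 : 𝓞 K)}) := Ideal.isCoprime_iff_sup_eq.2 hA2
  obtain ⟨k, B, x, y, hB, hx, hy, hxy⟩ := hodd P hP.ne_zero
  have hn0 : Ideal.span {(2 : 𝓞 K)} * p ≠ ⊥ := by
    refine mul_ne_zero ?_ hp.ne_zero
    rw [Ne, Ideal.zero_eq_bot, Ideal.span_singleton_eq_bot]; norm_num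
  obtain ⟨z, R, hz0, hzR, hRn, hzpos⟩ := step2 hK hL h2 P p hp hNp k B hB x y hx hy hxy _ hn0
  rw [← Ideal.isCoprime_iff_sup_eq] at hRn
  have hR2 : IsCoprime R (Ideal.span {(2 : 𝓞 K)}) := hRn.of_mul_right_left
  have hRp : IsCoprime R p := hRn.of_mul_right_right
  obtain ⟨ε', j', h4, hsgn⟩ := hH z hzpos (by
    rw [← Ideal.isCoprime_iff_sup_eq, hzR]
    exact h2p.mul_left hR2.pow_left)
  have hspan : ∀ (η : (𝓞 K)ˣ) (i : ℕ), Ideal.span {(η : 𝓞 K) * u ^ i} = (A ^ i) ^ 2 := by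
    intro η i
    rw [Ideal.span_singleton_mul_left_unit η.isUnit, ← Ideal.span_singleton_pow, hA]; ring
  apply hpns
  refine lemR hK a (z * ((ε' : 𝓞 K) * u ^ j')) ha0 (mul_ne_zero hz0 (mul_ne_zero ε'.ne_zero (pow_ne_zero _ hu))) p hp hp2
    (A ^ j) (R * A ^ j') (hspan ε j) ?_ ?_ ?_ ?_ ?_ h4 hsgn
  · rw [← Ideal.span_singleton_mul_span_singleton, hspan, hzR]; ring
  · rw [← Ideal.isCoprime_iff_sup_eq]; exact hA2'.pow_left
  · rw [← Ideal.isCoprime_iff_sup_eq]; exact hR2.mul_left hA2'.pow_left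
  · rw [← Ideal.isCoprime_iff_sup_eq]; exact hAp.pow_left
  · rw [← Ideal.isCoprime_iff_sup_eq]; exact hRp.mul_left hAp.pow_left

theorem core (hK : ∀ φ : K →+* ℂ, ComplexEmbedding.IsReal φ) (hL : ∀ φ : L →+* ℂ, ¬ ComplexEmbedding.IsReal φ)
    (h2 : Module.finrank K L = 2) (u : 𝓞 K) (hu : u ≠ 0) (hupos : ∀ v : K →+* ℂ, 0 < (v u).re) (A : Ideal (𝓞 K))
    (hA : Ideal.span {u} = A ^ 2) (hA2 : A ⊔ Ideal.span {2} = ⊤) (hAn : ¬ A.IsPrincipal)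
    (hodd : ∀ P : Ideal (𝓞 L), P ≠ ⊥ → ∃ (k : ℕ) (B : Ideal (𝓞 K)) (x y : 𝓞 L), B ≠ ⊥ ∧ x ≠ 0 ∧ y ≠ 0 ∧
      Ideal.span {x} * P ^ (2 * k + 1) = Ideal.span {y} * B.map (algebraMap (𝓞 K) (𝓞 L))) : False := by
  by_cases hc : ∃ (ε : (𝓞 K)ˣ) (j : ℕ) (s : 𝓞 K), (ε : 𝓞 K) * u ^ j - s ^ 2 ∈ Ideal.span {(4 : 𝓞 K)} ∧
      ¬ IsSquare (algebraMap K L (((ε : 𝓞 K) * u ^ j : 𝓞 K) : K))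
  · obtain ⟨ε, j, s, hs, hns⟩ := hc
    refine coreHelper hK hL h2 u hu A hA hA2 hodd ε j hns fun x hx _ => ⟨1, 0, Or.inl ⟨s, hs⟩, fun v => Or.inr ?_⟩
    simpa using hx v
  · push Not at hc
    have hnsq : ¬ IsSquare (u : K) := by
      rintro ⟨c, hc⟩
      have hcint : IsIntegral (𝓞 K) c := by
        refine IsIntegral.of_pow (n := 2) (by norm_num) ?_
        rw [sq, ← hc]; exact isIntegral_algebraMap
      obtain ⟨c, rfl⟩ := IsIntegrallyClosed.isIntegral_iff.1 hcint
      have hc' : u = c ^ 2 := by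
        apply RingOfIntegers.ext
        rw [hc, sq]
        exact (map_mul _ _ _).symm
      apply hAn
      have h3 : A ^ 2 = Ideal.span {c} ^ 2 := by
        rw [← hA, Ideal.span_singleton_pow, ← hc']
      have h4 : A = Ideal.span {c} := by
        have := pow_left_injective (M := Ideal (𝓞 K)) (n := 2) (by norm_num)
        exact this h3
      rw [h4]
      exact ⟨⟨c, rfl⟩⟩
    refine coreHelper hK hL h2 u hu A hA hA2 hodd 1 1 ?_ fun x hx hx2 => ?_
    · simpa using not_sqL_of_pos hK hL h2 (u : K) hupos hnsq
    · obtain ⟨ε, j, s, hs⟩ := surjV hK u hu A hA hAn hA2 (fun a => IsSquare (algebraMap K L a))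
        (fun a b ha hb ha' hb' => sqL_mul h2 a b ha hb ha' hb') hc x hx2
      exact ⟨ε, j, Or.inr ⟨s, hs⟩, fun v => Or.inl (by simpa using hupos v)⟩

end
end CN
end

section
open MeasureTheory Filter Topology
namespace CN
open NumberField nonZeroDivisors
section
variable {K L : Type*} [Field K] [NumberField K] [Field L] [NumberField L] [Algebra K L]

lemma cm_data (hK : ∀ φ : K →+* ℂ, ComplexEmbedding.IsReal φ) (hL : ∀ φ : L →+* ℂ, ¬ ComplexEmbedding.IsReal φ)
    (h2 : Module.finrank K L = 2) : ∃ σ : 𝓞 L ≃+* 𝓞 L,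
    (∀ x : 𝓞 K, σ (algebraMap (𝓞 K) (𝓞 L) x) = algebraMap (𝓞 K) (𝓞 L) x) ∧
    (∀ x : 𝓞 L, σ x = x → ∃ b : 𝓞 K, algebraMap (𝓞 K) (𝓞 L) b = x) ∧
    ∀ (a b : 𝓞 L) (v w : (𝓞 L)ˣ), a ≠ 0 → b ≠ 0 → v * σ a = a → w * σ b = b →
      ∃ t : (𝓞 L)ˣ, (v * σ t = t ∨ w * σ t = t ∨ v * w * σ t = t) := by
  haveI : IsTotallyReal K := ⟨fun w => by
    rw [← InfinitePlace.mk_embedding w, InfinitePlace.isReal_mk_iff]; exact hK _⟩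
  haveI : IsTotallyComplex L := ⟨fun w => by
    rw [← InfinitePlace.mk_embedding w, InfinitePlace.isComplex_mk_iff]; exact hL _⟩
  haveI : Algebra.IsQuadraticExtension K L := ⟨h2⟩
  haveI : IsCMField L := IsCMField.ofCMExtension K L
  have hfix : ∀ x : K, IsCMField.complexConj L (algebraMap K L x) = algebraMap K L x := fun x => by
    rw [← CMExtension.equivMaximalRealSubfield_apply K L x]
    exact IsCMField.complexConj_apply_eq_self L _
  have htors : ∀ (a : 𝓞 L) (v : (𝓞 L)ˣ), a ≠ 0 → v * IsCMField.ringOfIntegersComplexConj L a = a →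
      v ∈ Units.torsion L := by
    intro a v ha h
    rw [Units.mem_torsion]
    intro w
    have h1 := congrArg (fun x : 𝓞 L => w (x : L)) h
    simp only [map_mul, IsCMField.coe_ringOfIntegersComplexConj,
      IsCMField.infinitePlace_complexConj] at h1
    have h3 : w (a : L) ≠ 0 := by
      rw [Ne, map_eq_zero]; exact RingOfIntegers.coe_ne_zero_iff.2 ha
    exact mul_right_cancel₀ h3 (by rw [h1, one_mul])
  have hrange : ∀ v : Units.torsion L, v ∈ (IsCMField.unitsMulComplexConjInv L).range →
      ∃ t : (𝓞 L)ˣ, (v : (𝓞 L)ˣ) * IsCMField.ringOfIntegersComplexConj L t = (t : 𝓞 L) := by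
    rintro v ⟨t, rfl⟩
    refine ⟨t, ?_⟩
    rw [IsCMField.unitsMulComplexConjInv_apply]
    have h : IsCMField.ringOfIntegersComplexConj L (t : 𝓞 L) = (IsCMField.unitsComplexConj L t : (𝓞 L)ˣ) := rfl
    rw [h, ← Units.val_mul, inv_mul_cancel_right]
  refine ⟨(IsCMField.ringOfIntegersComplexConj L).toRingEquiv, fun x => ?_, fun x hx => ?_, ?_⟩
  · apply RingOfIntegers.ext
    exact hfix x
  · have h1 : IsCMField.complexConj L (x : L) = x := congrArg (fun x : 𝓞 L => (x : L)) hx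
    rw [IsCMField.complexConj_eq_self_iff] at h1
    have h3 := CMExtension.algebraMap_equivMaximalRealSubfield_symm_apply K L ⟨x, h1⟩
    set b := (CMExtension.equivMaximalRealSubfield K L).symm ⟨x, h1⟩
    have h4 : algebraMap K L b = x := h3
    have hb : IsIntegral ℤ b := by
      rw [← isIntegral_algebraMap_iff (FaithfulSMul.algebraMap_injective K L), h4]
      exact x.isIntegral_coe
    exact ⟨⟨b, hb⟩, RingOfIntegers.ext h4⟩
  · intro a b v w ha hb hv hw
    have hv' := htors a v ha hv
    have hw' := htors b w hb hw
    have hdvd := IsCMField.index_unitsMulComplexConjInv_range_dvd L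
    by_cases h1 : (⟨v, hv'⟩ : Units.torsion L) ∈ (IsCMField.unitsMulComplexConjInv L).range
    · obtain ⟨t, ht⟩ := hrange _ h1; exact ⟨t, Or.inl ht⟩
    by_cases h2 : (⟨w, hw'⟩ : Units.torsion L) ∈ (IsCMField.unitsMulComplexConjInv L).range
    · obtain ⟨t, ht⟩ := hrange _ h2; exact ⟨t, Or.inr (Or.inl ht)⟩
    rcases (Nat.dvd_prime Nat.prime_two).1 hdvd with h | h
    · rw [Subgroup.index_eq_one] at h
      exact absurd (h ▸ Subgroup.mem_top _) h1
    · have := (Subgroup.mul_mem_iff_of_index_two h (a := ⟨v, hv'⟩) (b := ⟨w, hw'⟩)).2 (by tauto)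
      obtain ⟨t, ht⟩ := hrange _ this
      exact ⟨t, Or.inr (Or.inr ht)⟩

lemma map_principal (h2 : Module.finrank K L = 2) (A : Ideal (𝓞 K)) (b : 𝓞 K)
    (h : A.map (algebraMap (𝓞 K) (𝓞 L)) = Ideal.span {algebraMap (𝓞 K) (𝓞 L) b}) : A.IsPrincipal := by
  have h1 : A ^ 2 = (Ideal.span {b}) ^ 2 := by
    rw [← relNorm_map2 (L := L) h2, ← relNorm_map2 (L := L) h2, h, Ideal.map_span, Set.image_singleton]
  have h3 : A ∣ Ideal.span {b} := (UniqueFactorizationMonoid.pow_dvd_pow_iff_dvd two_ne_zero).1 h1.dvd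
  have h4 : Ideal.span {b} ∣ A := (UniqueFactorizationMonoid.pow_dvd_pow_iff_dvd two_ne_zero).1 h1.symm.dvd
  exact ⟨b, dvd_antisymm h3 h4⟩

lemma ker_le_two (hK : ∀ φ : K →+* ℂ, ComplexEmbedding.IsReal φ) (hL : ∀ φ : L →+* ℂ, ¬ ComplexEmbedding.IsReal φ)
    (h2 : Module.finrank K L = 2) (A B : Ideal (𝓞 K)) (hA : A ≠ ⊥) (hB : B ≠ ⊥)
    (hA1 : (A.map (algebraMap (𝓞 K) (𝓞 L))).IsPrincipal) (hB1 : (B.map (algebraMap (𝓞 K) (𝓞 L))).IsPrincipal) :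
    A.IsPrincipal ∨ B.IsPrincipal ∨ (A * B).IsPrincipal := by
  obtain ⟨σ, hσ, hσ2, hσ3⟩ := cm_data hK hL h2
  have hinj := FaithfulSMul.algebraMap_injective (𝓞 K) (𝓞 L)
  have key : ∀ A : Ideal (𝓞 K), A ≠ ⊥ → (A.map (algebraMap (𝓞 K) (𝓞 L))).IsPrincipal →
      ∃ (a : 𝓞 L) (v : (𝓞 L)ˣ), a ≠ 0 ∧ v * σ a = a ∧ A.map (algebraMap (𝓞 K) (𝓞 L)) = Ideal.span {a} := by
    rintro A hA ⟨a, ha⟩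
    have ha' : A.map (algebraMap (𝓞 K) (𝓞 L)) = Ideal.span {a} := ha
    have h0 : a ≠ 0 := by
      rintro rfl
      rw [Ideal.span_singleton_eq_bot.2 rfl, Ideal.map_eq_bot_iff_of_injective hinj] at ha'
      exact hA ha'
    have hst : Ideal.map (σ : 𝓞 L →+* 𝓞 L) (A.map (algebraMap (𝓞 K) (𝓞 L))) = A.map (algebraMap (𝓞 K) (𝓞 L)) := by
      rw [Ideal.map_map]
      congr 1
      ext x
      exact congrArg _ (hσ x)
    rw [ha', Ideal.map_span, Set.image_singleton] at hst
    obtain ⟨v, hv⟩ := (Ideal.span_singleton_eq_span_singleton.1 hst)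
    exact ⟨a, v, h0, by rw [mul_comm]; exact hv, ha'⟩
  have fin : ∀ (A : Ideal (𝓞 K)) (a : 𝓞 L) (v t : (𝓞 L)ˣ), A.map (algebraMap (𝓞 K) (𝓞 L)) = Ideal.span {a} →
      v * σ a = a → v * σ t = t → A.IsPrincipal := by
    intro A a v t h1 h3 h4
    have h5 : σ (a * ↑t⁻¹) = a * ↑t⁻¹ := by
      have e1 : σ (↑t⁻¹ : 𝓞 L) * σ t = 1 := by rw [← map_mul, Units.inv_mul, map_one]
      have e2 : (↑t⁻¹ : 𝓞 L) * t = 1 := Units.inv_mul t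
      have e3 : (v : 𝓞 L) * ↑v⁻¹ = 1 := Units.mul_inv v
      have e4 : σ (↑t⁻¹ : 𝓞 L) = v * ↑t⁻¹ := by
        calc σ (↑t⁻¹ : 𝓞 L) = σ (↑t⁻¹ : 𝓞 L) * (↑t⁻¹ * (v * σ t)) := by rw [h4, e2, mul_one]
          _ = (σ (↑t⁻¹ : 𝓞 L) * σ t) * (v * ↑t⁻¹) := by ring
          _ = _ := by rw [e1, one_mul]
      rw [map_mul, e4]
      linear_combination (↑t⁻¹ : 𝓞 L) * h3
    obtain ⟨b, hb⟩ := hσ2 _ h5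
    refine map_principal (L := L) h2 A b ?_
    rw [h1, hb, Ideal.span_singleton_eq_span_singleton]
    exact ⟨t⁻¹, rfl⟩
  obtain ⟨a, v, ha, hv, hAa⟩ := key A hA hA1
  obtain ⟨b, w, hb, hw, hBb⟩ := key B hB hB1
  obtain ⟨t, h | h | h⟩ := hσ3 a b v w ha hb hv hw
  · exact Or.inl (fin A a v t hAa hv h)
  · exact Or.inr (Or.inl (fin B b w t hBb hw h))
  · refine Or.inr (Or.inr (fin (A * B) (a * b) (v * w) t ?_ ?_ ?_))
    · rw [Ideal.map_mul, hAa, hBb, Ideal.span_singleton_mul_span_singleton]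
    · rw [map_mul, Units.val_mul]
      linear_combination (w * σ b) * hv + a * hw
    · rw [Units.val_mul]; exact h

lemma relNorm_sq (h2 : Module.finrank K L = 2) (A : Ideal (𝓞 K)) (a : 𝓞 L)
    (h : A.map (algebraMap (𝓞 K) (𝓞 L)) = Ideal.span {a}) :
    Ideal.span {Algebra.intNorm (𝓞 K) (𝓞 L) a} = A ^ 2 := by
  rw [← relNorm_map2 (L := L) h2, h, Ideal.relNorm_singleton]

theorem final (hK : ∀ φ : K →+* ℂ, ComplexEmbedding.IsReal φ) (hL : ∀ φ : L →+* ℂ, ¬ ComplexEmbedding.IsReal φ)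
    (h2 : Module.finrank K L = 2) : classNumber K ∣ classNumber L := by
  have hinj := FaithfulSMul.algebraMap_injective (𝓞 K) (𝓞 L)
  rw [classNumber, classNumber, ← Nat.card_eq_fintype_card, ← Nat.card_eq_fintype_card]
  set i := ClassGroup.extendedHom (𝓞 K) (𝓞 L) with hi
  by_cases hin : Function.Injective i
  · exact Subgroup.card_dvd_of_injective i hin
  rw [injective_iff_map_eq_one] at hin
  push Not at hin
  obtain ⟨c, hc, hc1⟩ := hin
  have hrep : ∀ d, i d = 1 → ∃ A : Ideal (𝓞 K), ∃ hA : A ≠ ⊥, (A.map (algebraMap (𝓞 K) (𝓞 L))).IsPrincipal ∧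
      d = ClassGroup.mk0 ⟨A, mem_nonZeroDivisors_iff_ne_zero.2 hA⟩ := by
    intro d hd
    obtain ⟨⟨A, hA⟩, rfl⟩ := ClassGroup.mk0_surjective d
    refine ⟨A, mem_nonZeroDivisors_iff_ne_zero.1 hA, ?_, rfl⟩
    rw [hi, ClassGroup.extendedHom_mk0, ClassGroup.mk0_eq_one_iff] at hd
    exact hd
  have hsq : ∀ d, i d = 1 → d * d = 1 := by
    intro d hd
    obtain ⟨A, hA, ⟨a, ha⟩, rfl⟩ := hrep d hd
    rw [← map_mul]
    refine (ClassGroup.mk0_eq_one_iff (I := A * A) (mul_mem (mem_nonZeroDivisors_iff_ne_zero.2 hA) (mem_nonZeroDivisors_iff_ne_zero.2 hA))).2 ?_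
    rw [← sq, ← relNorm_sq (L := L) h2 A a ha]
    exact ⟨_, rfl⟩
  have huniq : ∀ d, i d = 1 → d ≠ 1 → d = c := by
    intro d hd hd1
    have hdd := hsq d hd
    obtain ⟨A, hA, hA1, rfl⟩ := hrep d hd
    obtain ⟨B, hB, hB1, rfl⟩ := hrep c hc
    rcases ker_le_two hK hL h2 A B hA hB hA1 hB1 with h | h | h
    · exact absurd ((ClassGroup.mk0_eq_one_iff _).2 h) hd1
    · exact absurd ((ClassGroup.mk0_eq_one_iff _).2 h) hc1
    · have h3 := (ClassGroup.mk0_eq_one_iff (I := A * B) (mul_mem (mem_nonZeroDivisors_iff_ne_zero.2 hA) (mem_nonZeroDivisors_iff_ne_zero.2 hB))).2 h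
      have h4 : ClassGroup.mk0 ⟨A, mem_nonZeroDivisors_iff_ne_zero.2 hA⟩ * ClassGroup.mk0 ⟨B, mem_nonZeroDivisors_iff_ne_zero.2 hB⟩ = 1 := by
        rw [← map_mul]; exact h3
      exact mul_left_cancel (hdd.trans h4.symm)
  have hker : Nat.card i.ker = 2 := by
    rw [Nat.card_eq_two_iff' 1]
    refine ⟨⟨c, hc⟩, fun h => hc1 (congrArg Subtype.val h), ?_⟩
    rintro ⟨d, hd⟩ hd1
    exact Subtype.ext (huniq d hd fun h => hd1 (Subtype.ext h))
  have e1 : 2 * Nat.card i.range = Nat.card (ClassGroup (𝓞 K)) := by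
    rw [← hker, ← Subgroup.index_ker, Subgroup.card_mul_index]
  have e2 : Nat.card i.range * i.range.index = Nat.card (ClassGroup (𝓞 L)) := Subgroup.card_mul_index _
  rcases Nat.even_or_odd' i.range.index with ⟨k, hk | hk⟩
  · exact ⟨k, by rw [← e1, ← e2, hk]; ring⟩
  exfalso
  obtain ⟨A₀, hA₀, ⟨a₀, ha₀⟩, rfl⟩ := hrep c hc
  obtain ⟨A, x, y, hA, hA2, hx, hy, hxy⟩ := moving A₀ (Ideal.span {(2 : 𝓞 K)}) hA₀ (by
    rw [Ne, Ideal.span_singleton_eq_bot]; exact two_ne_zero)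
  have hAc : ClassGroup.mk0 ⟨A, mem_nonZeroDivisors_iff_ne_zero.2 hA⟩ = ClassGroup.mk0 ⟨A₀, mem_nonZeroDivisors_iff_ne_zero.2 hA₀⟩ :=
    (ClassGroup.mk0_eq_mk0_iff).2 ⟨x, y, hx, hy, hxy⟩
  have hAn : ¬ A.IsPrincipal := fun h => hc1 (by rw [← hAc]; exact (ClassGroup.mk0_eq_one_iff _).2 h)
  rw [← hAc, hi, ClassGroup.extendedHom_mk0, ClassGroup.mk0_eq_one_iff] at hc
  obtain ⟨a, ha⟩ := hc
  have ha' : A.map (algebraMap (𝓞 K) (𝓞 L)) = Ideal.span {a} := ha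
  have ha0 : a ≠ 0 := by
    rintro rfl
    rw [Ideal.span_singleton_eq_bot.2 rfl, Ideal.map_eq_bot_iff_of_injective hinj] at ha'
    exact hA ha'
  have hu := relNorm_sq (L := L) h2 A a ha'
  refine core hK hL h2 (Algebra.intNorm (𝓞 K) (𝓞 L) a) ?_ (intNorm_pos hK hL h2 a ha0) A hu hA2 hAn ?_
  · intro h
    rw [h, Ideal.span_singleton_eq_bot.2 rfl] at hu
    exact pow_ne_zero 2 hA hu.symm
  · intro P hP
    have hP' := mem_nonZeroDivisors_iff_ne_zero.2 hP
    obtain ⟨d, hd⟩ := Subgroup.pow_index_mem i.range (ClassGroup.mk0 ⟨P, hP'⟩)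
    obtain ⟨⟨B, hB⟩, rfl⟩ := ClassGroup.mk0_surjective d
    rw [hk, ← map_pow, hi, ClassGroup.extendedHom_mk0, eq_comm, ClassGroup.mk0_eq_mk0_iff] at hd
    obtain ⟨x, y, hx, hy, hxy⟩ := hd
    exact ⟨k, B, x, y, mem_nonZeroDivisors_iff_ne_zero.1 hB, hx, hy, hxy⟩

end
end CN
end

/-- If `L` is a CM-field with maximal totally real subfield `K` (so `L` is totally
imaginary, `K` totally real, and `[L : K] = 2`), then the class number of `K` divides
the class number of `L`. -/
theorem classNumber_real_subfield_dvd (K L : Type*) [Field K] [Field L]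
    [NumberField K] [NumberField L] [Algebra K L]
    (hK : IsTotallyRealField K) (hL : IsTotallyImaginaryField L)
    (h2 : Module.finrank K L = 2) :
    classNumber K ∣ classNumber L := by
  exact CN.final hK hL h2
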